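/- Let S = {a, a', b, b', c, c'} be a six-letter alphabet with complementation, and for i ∈ {1,2,3,4} let U_i, C_i ⊆ S^d be twin pair free disjoint polybox codes with U_i ⊑ C_i and |U_i| = i. Then: (i) |C_1| ≥ 5 for d ≥ 3; (ii) |C_2| ≥ 7 for d = 5, and up to isomorphism there is precisely one cover C_2 of U_2 with |C_2| = 7, namely C_2 = {ba'bbb, aabbb, a'aaaa', a'aaba, a'aa'ab, a'aa'a'a, a'aba'a'} with U_2 = {bbbbb, b'abbb}; (iii) |C_2| ≥ 8 for d = 4, and |C_3| ≥ 9 and |C_4| ≥ 10 for d ∈ {4, 5}. -/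

import Mathlib

/-- The six-letter alphabet `S = {a, a', b, b', c, c'}` is modelled as `Fin 6` with
`a = 0, a' = 1, b = 2, b' = 3, c = 4, c' = 5`; the complementation swaps `0 ↔ 1`,
`2 ↔ 3`, `4 ↔ 5`. -/
def compl6 : Fin 6 → Fin 6 := ![1, 0, 3, 2, 5, 4]

/-- Two words `u, v ∈ S^d` are dichotomous if `v j = (u j)'` for some coordinate `j`. -/
def Dichotomous {S : Type*} (c : S → S) {d : ℕ} (u v : Fin d → S) : Prop :=
  ∃ j, v j = c (u j)

/-- Two words form a twin pair if they differ by complementation at exactly one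
coordinate and agree elsewhere. -/
def TwinPair {S : Type*} (c : S → S) {d : ℕ} (u v : Fin d → S) : Prop :=
  ∃ j, v j = c (u j) ∧ ∀ i, i ≠ j → u i = v i

/-- A polybox code: a set of pairwise dichotomous words. -/
def PolyboxCode {S : Type*} (c : S → S) {d : ℕ} (V : Finset (Fin d → S)) : Prop :=
  ∀ u ∈ V, ∀ v ∈ V, u ≠ v → Dichotomous c u v

/-- A code without twin pairs. -/
def TwinPairFree {S : Type*} (c : S → S) {d : ℕ} (V : Finset (Fin d → S)) : Prop :=
  ∀ u ∈ V, ∀ v ∈ V, ¬ TwinPair c u v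

/-- `ES`: the collection of all `B ⊆ S` containing exactly one letter from each
complementary pair `{s, s'}`. -/
def ESet {S : Type*} (c : S → S) : Set (Set S) :=
  {B | ∀ s : S, Xor' (s ∈ B) (c s ∈ B)}

/-- The equicomplementary realization `v̆ = Ev₁ × ⋯ × Ev_d` of a word `v`,
where `Es = {B ∈ ES : s ∈ B}`. -/
def WordBox {S : Type*} (c : S → S) {d : ℕ} (v : Fin d → S) : Set (Fin d → Set S) :=
  {x | ∀ i, x i ∈ ESet c ∧ v i ∈ x i}

/-- `⋃ E(V)`, the union of the equicomplementary realizations of the words of `V`. -/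
def CodeReal {S : Type*} (c : S → S) {d : ℕ} (V : Finset (Fin d → S)) :
    Set (Fin d → Set S) :=
  ⋃ v ∈ V, WordBox c v

/-- The word `w` is covered by the code `V`, i.e. `w̆ ⊆ ⋃ E(V)`. -/
def Covered {S : Type*} (c : S → S) {d : ℕ} (w : Fin d → S)
    (V : Finset (Fin d → S)) : Prop :=
  WordBox c w ⊆ CodeReal c V

/-- Codes `V` and `W` are equivalent: `⋃ E(V) = ⋃ E(W)`. -/
def EquivalentCodes {S : Type*} (c : S → S) {d : ℕ} (V W : Finset (Fin d → S)) : Prop :=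
  CodeReal c V = CodeReal c W

/-- `U` and `C` are twin pair free disjoint polybox codes with `U ⊑ C`
(`C` is a cover of `U`). -/
def GoodCoverPair {d : ℕ} (U C : Finset (Fin d → Fin 6)) : Prop :=
  PolyboxCode compl6 U ∧ PolyboxCode compl6 C ∧
    TwinPairFree compl6 U ∧ TwinPairFree compl6 C ∧
    Disjoint U C ∧ ∀ u ∈ U, Covered compl6 u C

/-- The pairs of codes `(U, C)` and `(U', C')` are isomorphic: a single isomorphism
(a permutation of coordinates together with per-coordinate letter bijections
commuting with complementation) carries `U` onto `U'` and `C` onto `C'`. -/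
def PairIsomorphic {d : ℕ} (U C U' C' : Finset (Fin d → Fin 6)) : Prop :=
  ∃ σ : Equiv.Perm (Fin d), ∃ h : Fin d → (Fin 6 → Fin 6),
    (∀ i, Function.Bijective (h i)) ∧
    (∀ i l, h i (compl6 l) = compl6 (h i l)) ∧
    U' = U.image (fun v i => h i (v (σ i))) ∧
    C' = C.image (fun v i => h i (v (σ i)))

/-- The code `U₂ = {bbbbb, b'abbb}` (letters `a = 0, a' = 1, b = 2, b' = 3`). -/
def Uex : Finset (Fin 5 → Fin 6) := {![2,2,2,2,2], ![3,0,2,2,2]}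

/-- The cover `C₂ = {ba'bbb, aabbb, a'aaaa', a'aaba, a'aa'ab, a'aa'a'a, a'aba'a'}`. -/
def Cex : Finset (Fin 5 → Fin 6) :=
  {![2,1,2,2,2], ![0,0,2,2,2], ![1,0,0,0,1], ![1,0,0,2,0],
   ![1,0,1,0,2], ![1,0,1,1,0], ![1,0,2,1,1]}

namespace Cov

/-- truth value of a letter at a local point -/
def sat (q : Fin 3 → Bool) (l : Fin 6) : Bool := ![q 0, !q 0, q 1, !q 1, q 2, !q 2] l
/-- make the letter `l` true -/
def setq (q : Fin 3 → Bool) (l : Fin 6) : Fin 3 → Bool :=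
  Function.update q (![0, 0, 1, 1, 2, 2] l) (![true, false, true, false, true, false] l)

theorem cc : ∀ l : Fin 6, compl6 (compl6 l) = l := by decide
theorem c_ne : ∀ l : Fin 6, compl6 l ≠ l := by decide
theorem c_inj : ∀ {l m : Fin 6}, compl6 l = compl6 m → l = m := by decide
theorem c_sw {l m : Fin 6} (h : l = compl6 m) : m = compl6 l := by rw [h, cc]
theorem sat_c : ∀ (q : Fin 3 → Bool) (l : Fin 6), sat q (compl6 l) = !sat q l := by decide
theorem sat_set : ∀ (q : Fin 3 → Bool) (l : Fin 6), sat (setq q l) l = true := by decide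
theorem sat_set' : ∀ (q : Fin 3 → Bool) (l m : Fin 6), m ≠ l → m ≠ compl6 l →
    sat (setq q l) m = sat q m := by decide
theorem sat_set2 (q : Fin 3 → Bool) (l m : Fin 6) (h : m ≠ compl6 l) (hm : sat q m = true) :
    sat (setq q l) m = true := by
  by_cases h1 : m = l
  · subst h1; exact sat_set _ _
  · rw [sat_set' _ _ _ h1 h, hm]
theorem sat_force : ∀ (Q u P : Fin 6), (∀ q, sat q Q = true → sat q u = true → sat q P = true) →
    Q ≠ compl6 u → P ≠ u → Q = P := by decide

abbrev W (d : ℕ) := Fin d → Fin 6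
variable {d : ℕ}

def In (p : Fin d → Fin 3 → Bool) (v : W d) : Prop := ∀ j, sat (p j) (v j) = true
def Dich (u v : W d) : Prop := ∃ j, v j = compl6 (u j)
def Twin (u v : W d) : Prop := ∃ j, v j = compl6 (u j) ∧ ∀ i, i ≠ j → u i = v i
def TF (F : Finset (W d)) : Prop := ∀ u ∈ F, ∀ v ∈ F, ¬ Twin u v
def Nd (u v : W d) : Prop := ∀ j, v j ≠ compl6 (u j)

instance (u v : W d) : Decidable (Dich u v) := by unfold Dich; infer_instance
instance (u v : W d) : Decidable (Twin u v) := by unfold Twin; infer_instance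
instance (u v : W d) : Decidable (Nd u v) := by unfold Nd; infer_instance

theorem Dich.symm {u v : W d} (h : Dich u v) : Dich v u := by
  obtain ⟨j, h⟩ := h; exact ⟨j, c_sw h⟩
theorem Twin.symm {u v : W d} (h : Twin u v) : Twin v u := by
  obtain ⟨j, h, h2⟩ := h; exact ⟨j, c_sw h, fun i hi => (h2 i hi).symm⟩
theorem Nd.symm {u v : W d} (h : Nd u v) : Nd v u := fun j hj => h j (c_sw hj)
theorem not_nd {u v : W d} : ¬ Nd u v ↔ Dich u v := by simp [Nd, Dich]
theorem not_dich {u v : W d} : ¬ Dich u v ↔ Nd u v := by simp [Nd, Dich]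
theorem Dich.ne {u v : W d} (h : Dich u v) : u ≠ v := by
  rintro rfl; obtain ⟨j, h⟩ := h; exact c_ne _ h.symm

structure IsCov (u : W d) (F : Finset (W d)) : Prop where
  dich : ∀ v ∈ F, ∀ w ∈ F, v ≠ w → Dich v w
  nd : ∀ v ∈ F, Nd u v
  cov : ∀ p, In p u → ∃ v ∈ F, In p v

theorem In.not_dich {p : Fin d → Fin 3 → Bool} {u v : W d} (hu : In p u) (hv : In p v) : Nd u v := by
  intro j hj
  have := hv j
  rw [hj, sat_c, hu j] at this; simp at this

/-- a common point -/
def pt (u v : W d) : Fin d → Fin 3 → Bool := fun j => setq (setq (fun _ => false) (u j)) (v j)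
theorem pt_right (u v : W d) : In (pt u v) v := fun _ => sat_set _ _
theorem pt_left {u v : W d} (h : Nd u v) : In (pt u v) u :=
  fun j => sat_set2 _ _ _ (fun hj => h j (c_sw hj)) (sat_set _ _)

/-- set the letter at coordinate i -/
def fl (p : Fin d → Fin 3 → Bool) (i : Fin d) (s : Fin 6) := Function.update p i (setq (p i) s)
theorem fl_ne (p : Fin d → Fin 3 → Bool) {i j : Fin d} (s : Fin 6) (h : j ≠ i) : fl p i s j = p j := by
  simp [fl, h]
theorem fl_eq (p : Fin d → Fin 3 → Bool) (i : Fin d) (s : Fin 6) : fl p i s i = setq (p i) s := by simp [fl]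
theorem In.fl {p : Fin d → Fin 3 → Bool} {u : W d} (h : In p u) (i : Fin d) (s : Fin 6)
    (hs : u i ≠ compl6 s) : In (fl p i s) u := by
  intro j
  by_cases hj : j = i
  · subst hj; rw [fl_eq]; exact sat_set2 _ _ _ hs (h j)
  · rw [fl_ne _ _ hj]; exact h j

/-- key flip principle -/
theorem IsCov.flip {u : W d} {F : Finset (W d)} (h : IsCov u F) {P : W d} (hP : P ∈ F) {i : Fin d}
    (hi : P i ≠ u i) {p : Fin d → Fin 3 → Bool} (hp : ∀ j, j ≠ i → sat (p j) (P j) = true)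
    (hu : In p u) :
    ∃ Q ∈ F, Q i = compl6 (P i) ∧ In (fl p i (compl6 (P i))) Q := by
  have hp' : In (fl p i (compl6 (P i))) u := hu.fl _ _ (by rw [cc]; exact hi.symm)
  obtain ⟨Q, hQ, hpQ⟩ := h.cov _ hp'
  refine ⟨Q, hQ, ?_, hpQ⟩
  have hne : P ≠ Q := by
    rintro rfl
    have := hpQ i
    rw [fl_eq] at this
    have h2 := sat_set (p i) (compl6 (P i))
    rw [sat_c, this] at h2; simp at h2
  obtain ⟨j, hj⟩ := h.dich P hP Q hQ hne
  by_cases hji : j = i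
  · subst hji; exact hj
  · exfalso
    have h1 := hpQ j
    rw [fl_ne _ _ hji, hj, sat_c, hp j hji] at h1; simp at h1

theorem IsCov.compl {u : W d} {F : Finset (W d)} (h : IsCov u F) {P : W d} (hP : P ∈ F) {i : Fin d}
    (hi : P i ≠ u i) : ∃ Q ∈ F, Q i = compl6 (P i) := by
  obtain ⟨Q, hQ, h1, _⟩ := h.flip hP hi (p := pt u P) (fun j _ => pt_right _ _ j) (pt_left (h.nd P hP))
  exact ⟨Q, hQ, h1⟩

section K
variable {u : W d} {F : Finset (W d)} (h : IsCov u F) {P : W d} (hP : P ∈ F) {i : Fin d}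
  (hi : P i ≠ u i) (hun : ∀ Q ∈ F, Q i = P i → Q = P)
include h hP hi hun

theorem K_pt {Q : W d} (hQ : Q ∈ F) (hQi : Q i = compl6 (P i)) {p : Fin d → Fin 3 → Bool}
    (hp : In p Q) (hu : In p u) : ∀ j, j ≠ i → sat (p j) (P j) = true := by
  have hne : Q i ≠ u i := fun e => h.nd P hP i (by rw [← e, hQi, cc])
  obtain ⟨R, hR, hRi, hpR⟩ := h.flip hQ hne (fun j _ => hp j) hu
  rw [hQi, cc] at hRi
  have := hun R hR hRi
  subst this
  intro j hj
  have := hpR j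
  rwa [fl_ne _ _ hj] at this

theorem K_eq {Q : W d} (hQ : Q ∈ F) (hQi : Q i = compl6 (P i)) {j : Fin d} (hj : j ≠ i)
    (hPj : P j ≠ u j) : Q j = P j := by
  refine sat_force _ (u j) _ ?_ (h.nd Q hQ j) hPj
  intro q h1 h2
  have hp : In (Function.update (pt u Q) j q) Q := by
    intro l; by_cases hl : l = j
    · subst hl; simpa using h1
    · simpa [hl] using pt_right u Q l
  have hp' : In (Function.update (pt u Q) j q) u := by
    intro l; by_cases hl : l = j
    · subst hl; simpa using h2
    · simpa [hl] using pt_left (h.nd Q hQ) l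
  have := K_pt h hP hi hun hQ hQi hp hp' j hj
  simpa using this

theorem K_cov : IsCov (Function.update P i (compl6 (P i))) (F.filter (fun Q => Q i = compl6 (P i))) := by
  have hci : compl6 (P i) ≠ compl6 (u i) := fun e => hi (c_inj e)
  refine ⟨fun v hv w hw => h.dich v (Finset.mem_filter.1 hv).1 w (Finset.mem_filter.1 hw).1, ?_, ?_⟩
  · intro v hv j
    obtain ⟨hv, hvi⟩ := Finset.mem_filter.1 hv
    by_cases hj : j = i
    · subst hj; simp [hvi]; exact (c_ne _).symm
    · simp only [Function.update_of_ne hj]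
      by_cases hPj : P j = u j
      · rw [hPj]; exact h.nd v hv j
      · rw [K_eq h hP hi hun hv hvi hj hPj]; exact (c_ne _).symm
  · intro p hp
    -- p' : adjusted to lie in u
    let p' : Fin d → Fin 3 → Bool := fun j => setq (p j) (u j)
    have hpP : ∀ j, j ≠ i → sat (p j) (P j) = true := by
      intro j hj; simpa [Function.update_of_ne hj] using hp j
    have hpi : sat (p i) (compl6 (P i)) = true := by simpa using hp i
    have hu : In p' u := fun j => sat_set _ _
    have hP' : ∀ j, j ≠ i → sat (p' j) (P j) = true := fun j hj =>
      sat_set2 _ _ _ (h.nd P hP j) (hpP j hj)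
    obtain ⟨Q, hQ, hQi, hpQ⟩ := h.flip hP hi hP' hu
    refine ⟨Q, Finset.mem_filter.2 ⟨hQ, hQi⟩, ?_⟩
    intro j
    by_cases hj : j = i
    · subst hj; rw [hQi]; exact hpi
    · have h1 := hpQ j
      rw [fl_ne _ _ hj] at h1
      by_cases hPj : P j = u j
      · have h2 := hpP j hj
        rw [hPj] at h2
        by_cases e : Q j = u j
        · rw [e]; exact h2
        · rw [← h1]; symm; exact sat_set' _ _ _ e (h.nd Q hQ j)
      · rw [K_eq h hP hi hun hQ hQi hj hPj]; exact hpP j hj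
end K

theorem TF.mono {F G : Finset (W d)} (h : TF F) (hs : G ⊆ F) : TF G :=
  fun u hu v hv => h u (hs hu) v (hs hv)

theorem twin_upd (P : W d) (i : Fin d) : Twin P (Function.update P i (compl6 (P i))) :=
  ⟨i, by simp, fun j hj => by simp [hj]⟩

theorem exists_ne {P u : W d} (h : P ≠ u) : ∃ i, P i ≠ u i := Function.ne_iff.1 h

theorem IsCov.nonempty {u : W d} {F : Finset (W d)} (h : IsCov u F) : ∃ P, P ∈ F := by
  obtain ⟨v, hv, _⟩ := h.cov (pt u u) (pt_right _ _)
  exact ⟨v, hv⟩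

theorem IsCov.eq_of_mem {u : W d} {F : Finset (W d)} (h : IsCov u F) (hu : u ∈ F) {P : W d} (hP : P ∈ F) :
    P = u := by
  by_contra hne
  exact not_nd.2 (h.dich u hu P hP (Ne.symm hne)) (h.nd P hP)

theorem five_aux (n : ℕ) : ∀ (u : W d) (F : Finset (W d)), F.card = n → IsCov u F → TF F → u ∉ F → 5 ≤ n := by
  induction n using Nat.strong_induction_on with
  | _ n ih =>
  intro u F hn h tf hu
  by_contra hlt
  have two : ∀ P ∈ F, ∀ i, P i ≠ u i → 2 ≤ (F.filter (fun Q => Q i = P i)).card := by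
    intro P hP i hi
    by_contra hc
    have hc1 : (F.filter (fun Q => Q i = P i)).card ≤ 1 := by omega
    rw [Finset.card_le_one] at hc1
    have hun : ∀ Q ∈ F, Q i = P i → Q = P := fun Q hQ e =>
      hc1 Q (Finset.mem_filter.2 ⟨hQ, e⟩) P (Finset.mem_filter.2 ⟨hP, rfl⟩)
    have hK := K_cov h hP hi hun
    have hlt' : (F.filter (fun Q => Q i = compl6 (P i))).card < n := by
      rw [← hn]; apply Finset.card_lt_card
      rw [Finset.filter_ssubset]; exact ⟨P, hP, fun e => c_ne _ e.symm⟩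
    have := ih _ hlt' _ _ rfl hK (tf.mono (Finset.filter_subset _ _))
      (fun hm => tf P hP _ (Finset.mem_filter.1 hm).1 (twin_upd P i))
    omega
  have all : ∀ P ∈ F, ∀ i, P i ≠ u i → ∀ Q ∈ F, Q i = P i ∨ Q i = compl6 (P i) := by
    intro P hP i hi Q hQ
    by_contra hc
    push Not at hc
    obtain ⟨R, hR, hRi⟩ := h.compl hP hi
    have hRu : R i ≠ u i := fun e => h.nd P hP i (by rw [← e, hRi, cc])
    have h1 := two P hP i hi
    have h2 := two R hR i hRu
    rw [hRi] at h2
    have hdis : Disjoint (F.filter (fun Q => Q i = P i)) (F.filter (fun Q => Q i = compl6 (P i))) := by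
      rw [Finset.disjoint_filter]; intro x _ e1 e2; exact c_ne _ (e2.symm.trans e1)
    have hss : (F.filter (fun Q => Q i = P i)) ∪ (F.filter (fun Q => Q i = compl6 (P i))) ⊂ F := by
      rw [Finset.ssubset_iff_of_subset (Finset.union_subset (Finset.filter_subset _ _) (Finset.filter_subset _ _))]
      exact ⟨Q, hQ, by simp [hc.1, hc.2]⟩
    have := Finset.card_lt_card hss
    rw [Finset.card_union_of_disjoint hdis] at this
    omega
  obtain ⟨P, hP⟩ := h.nonempty
  obtain ⟨i, hi⟩ := exists_ne (fun e : P = u => hu (e ▸ hP))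
  obtain ⟨Q, hQ, hQi, hpQ⟩ := h.flip hP hi (p := pt u P) (fun j _ => pt_right _ _ j) (pt_left (h.nd P hP))
  refine tf P hP Q hQ ⟨i, hQi, fun j hj => ?_⟩
  have h1 := hpQ j
  rw [fl_ne _ _ hj] at h1
  by_cases hPj : P j = u j
  · by_contra hne
    have hQj : Q j ≠ u j := fun e => hne (hPj.trans e.symm)
    rcases all Q hQ j hQj P hP with e | e
    · exact hne e
    · exact h.nd Q hQ j (by rw [← hPj, e, cc])
  · rcases all P hP j hPj Q hQ with e | e
    · exact e.symm
    · rw [e, sat_c, pt_right u P j] at h1; simp at h1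

theorem five {u : W d} {F : Finset (W d)} (h : IsCov u F) (tf : TF F) (hu : u ∉ F) : 5 ≤ F.card :=
  five_aux _ u F rfl h tf hu

end Cov
namespace Cov
variable {d : ℕ}

def K1 (u Q : W d) : Prop := ∃ j s, s ≠ u j ∧ Q = Function.update u j s

theorem upd_nd {u P : W d} (h : Nd u P) (j : Fin d) : Nd u (Function.update P j (u j)) := by
  intro l; by_cases hl : l = j
  · subst hl; simp; exact (c_ne _).symm
  · simp [hl]; exact h l

theorem lemM (n : ℕ) (hn : n ≤ 4) (u : W d) : ∀ (G : Finset (W d)) (P : W d), G.card ≤ n → IsCov u G → P ∈ G → P ≠ u →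
    (∀ v ∈ G, ∀ w ∈ G, Twin v w → v = P ∨ w = P) → ∃ Q ∈ G, Q ≠ P ∧ K1 u Q := by
  induction n with
  | zero =>
    intro G P hc _ hP
    rw [Nat.le_zero, Finset.card_eq_zero] at hc; subst hc; simp at hP
  | succ n ih =>
    intro G P hc h hP hPu htw
    have hu : u ∉ G := fun hu => hPu (h.eq_of_mem hu hP)
    have hntf : ¬ TF G := fun tf => by have := five h tf hu; omega
    unfold TF at hntf
    push Not at hntf
    obtain ⟨v, hv, w, hw, hvw⟩ := hntf
    obtain ⟨Q, hQ, j, hj, hjj⟩ : ∃ Q ∈ G, Twin P Q := by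
      rcases htw v hv w hw hvw with rfl | rfl
      · exact ⟨w, hw, hvw⟩
      · exact ⟨v, hv, hvw.symm⟩
    have hPj : P j ≠ u j := fun e => h.nd Q hQ j (by rw [hj, e])
    have hPQ : P ≠ Q := fun e => by rw [← e] at hj; exact c_ne _ hj.symm
    have hQj : Q j ≠ u j := fun e => h.nd P hP j (by rw [← e, hj, cc])
    have hQR : ∀ l, l ≠ j → Q l = Function.update P j (u j) l := fun l hl => by
      simp [hl, hjj l hl]
    by_cases hRu : Function.update P j (u j) = u
    · refine ⟨Q, hQ, hPQ.symm, j, Q j, hQj, ?_⟩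
      funext l
      by_cases hl : l = j
      · subst hl; simp
      · simp [hl, hQR l hl]
        have := congrFun hRu l
        simpa [hl] using this
    let R := Function.update P j (u j)
    let T := (G.erase P).erase Q
    have hcov : IsCov u (insert R T) := by
      have key : ∀ v ∈ T, Dich R v := by
        intro v hv
        have hv' : v ≠ Q ∧ v ≠ P ∧ v ∈ G := by simpa [T] using hv
        obtain ⟨h1, h2, h3⟩ := hv'
        obtain ⟨l, hl⟩ := h.dich P hP v h3 h2.symm
        by_cases hlj : l = j
        · subst hlj
          obtain ⟨m, hm⟩ := h.dich Q hQ v h3 h1.symm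
          have hml : m ≠ l := by
            rintro rfl; rw [hl, hj, cc] at hm; exact c_ne _ hm
          exact ⟨m, by rw [hm, hQR m hml]⟩
        · exact ⟨l, by simp [R, hlj, hl]⟩
      refine ⟨?_, ?_, ?_⟩
      · intro v hv w hw hvw
        rw [Finset.mem_insert] at hv hw
        rcases hv with rfl | hv
        · rcases hw with rfl | hw
          · exact absurd rfl hvw
          · exact key w hw
        · rcases hw with rfl | hw
          · exact (key v hv).symm
          · exact h.dich v (by simp [T] at hv; exact hv.2.2) w (by simp [T] at hw; exact hw.2.2) hvw
      · intro v hv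
        rw [Finset.mem_insert] at hv
        rcases hv with rfl | hv
        · exact upd_nd (h.nd P hP) j
        · exact h.nd v (by simp [T] at hv; exact hv.2.2)
      · intro p hp
        obtain ⟨v, hv, hpv⟩ := h.cov p hp
        by_cases hvP : v = P ∨ v = Q
        · refine ⟨R, by simp, fun l => ?_⟩
          by_cases hl : l = j
          · subst hl; simp [R]; exact hp l
          · rcases hvP with rfl | rfl
            · simp [R, hl]; exact hpv l
            · have := hpv l; rw [hQR l hl] at this; exact this
        · push Not at hvP
          exact ⟨v, by simp [T, hvP, hv], hpv⟩
    have hcard : (insert R T).card ≤ n := by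
      have h1 := Finset.card_insert_le R T
      have h2 : T.card = G.card - 1 - 1 := by
        rw [Finset.card_erase_of_mem (by simp [hPQ.symm, hQ]), Finset.card_erase_of_mem hP]
      have h3 : 1 < G.card := Finset.one_lt_card.2 ⟨P, hP, Q, hQ, hPQ⟩
      omega
    obtain ⟨Q', h1, h2, h3⟩ := ih (by omega) _ R hcard hcov (by simp) hRu (by
      intro v hv w hw ht
      rw [Finset.mem_insert] at hv hw
      by_contra hcon
      push Not at hcon
      have hv := hv.resolve_left hcon.1
      have hw := hw.resolve_left hcon.2
      simp [T] at hv hw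
      rcases htw v hv.2.2 w hw.2.2 ht with e | e
      · exact hv.2.1 e
      · exact hw.2.1 e)
    rw [Finset.mem_insert] at h1
    have h1 := h1.resolve_left h2
    simp [T] at h1
    exact ⟨Q', h1.2.2, h1.2.1, h3⟩

theorem lemA {u : W d} {F : Finset (W d)} (h : IsCov u F) (tf : TF F) (hu : u ∉ F) (hc : F.card ≤ 9)
    (hk : ∀ Q ∈ F, ¬ K1 u Q) : ∀ P ∈ F, ∀ i, P i ≠ u i → 2 ≤ (F.filter (fun Q => Q i = P i)).card := by
  intro P hP i hi
  by_contra hcc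
  have hc1 : (F.filter (fun Q => Q i = P i)).card ≤ 1 := by omega
  rw [Finset.card_le_one] at hc1
  have hun : ∀ Q ∈ F, Q i = P i → Q = P := fun Q hQ e =>
    hc1 Q (Finset.mem_filter.2 ⟨hQ, e⟩) P (Finset.mem_filter.2 ⟨hP, rfl⟩)
  have hK := K_cov h hP hi hun
  have h5 := five hK (tf.mono (Finset.filter_subset _ _))
      (fun hm => tf P hP _ (Finset.mem_filter.1 hm).1 (twin_upd P i))
  let R := Function.update P i (u i)
  let T := F.filter (fun Q => Q i ≠ P i ∧ Q i ≠ compl6 (P i))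
  have hRu : R ≠ u := by
    intro e
    refine hk P hP ⟨i, P i, hi, ?_⟩
    funext l
    by_cases hl : l = i
    · subst hl; simp
    · have := congrFun e l; simp [R, hl] at this; simp [hl, this]
  have hcov : IsCov u (insert R T) := by
    have key : ∀ v ∈ T, Dich R v := by
      intro v hv
      obtain ⟨h3, h1, h2⟩ := Finset.mem_filter.1 hv
      obtain ⟨l, hl⟩ := h.dich P hP v h3 (fun e => h1 (by rw [e]))
      have hli : l ≠ i := fun e => by subst e; exact h2 hl
      exact ⟨l, by simp [R, hli, hl]⟩
    refine ⟨?_, ?_, ?_⟩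
    · intro v hv w hw hvw
      rw [Finset.mem_insert] at hv hw
      rcases hv with rfl | hv
      · rcases hw with rfl | hw
        · exact absurd rfl hvw
        · exact key w hw
      · rcases hw with rfl | hw
        · exact (key v hv).symm
        · exact h.dich v (Finset.mem_filter.1 hv).1 w (Finset.mem_filter.1 hw).1 hvw
    · intro v hv
      rw [Finset.mem_insert] at hv
      rcases hv with rfl | hv
      · exact upd_nd (h.nd P hP) i
      · exact h.nd v (Finset.mem_filter.1 hv).1
    · intro p hp
      obtain ⟨v, hv, hpv⟩ := h.cov p hp
      by_cases hv1 : v i = P i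
      · refine ⟨R, by simp, fun l => ?_⟩
        have := hun v hv hv1
        subst this
        by_cases hl : l = i
        · subst hl; simp [R]; exact hp l
        · simp [R, hl]; exact hpv l
      by_cases hv2 : v i = compl6 (P i)
      · refine ⟨R, by simp, fun l => ?_⟩
        by_cases hl : l = i
        · subst hl; simp [R]; exact hp l
        · simp [R, hl]; exact K_pt h hP hi hun hv hv2 hpv hp l hl
      · exact ⟨v, by simp [T, hv, hv1, hv2], hpv⟩
  have hcard : (insert R T).card ≤ 4 := by
    have h1 := Finset.card_insert_le R T
    have e1 := Finset.card_filter_add_card_filter_not (s := F) (fun Q => Q i = compl6 (P i))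
    have : T ⊆ (F.filter (fun Q => ¬ Q i = compl6 (P i))).erase P := by
      intro x hx
      obtain ⟨h3, h1, h2⟩ := Finset.mem_filter.1 hx
      simp [h2, h3]
      exact fun e => h1 (by rw [e])
    have h2 := Finset.card_le_card this
    rw [Finset.card_erase_of_mem (by simp [hP]; exact (c_ne _).symm)] at h2
    omega
  obtain ⟨Q, h1, h2, h3⟩ := lemM 4 le_rfl u _ R hcard hcov (by simp) hRu (by
    intro v hv w hw ht
    rw [Finset.mem_insert] at hv hw
    by_contra hcon
    push Not at hcon
    have hv := hv.resolve_left hcon.1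
    have hw := hw.resolve_left hcon.2
    exact tf v (Finset.mem_filter.1 hv).1 w (Finset.mem_filter.1 hw).1 ht)
  rw [Finset.mem_insert] at h1
  have h1 := h1.resolve_left h2
  exact hk Q (Finset.mem_filter.1 h1).1 h3

section k1
variable {u : W d} {F : Finset (W d)} (h : IsCov u F) {i : Fin d} {s : Fin 6} (hs : s ≠ u i)
  (hQ : Function.update u i s ∈ F)
include h hs hQ

theorem k1_other {R : W d} (hR : R ∈ F) (hne : R ≠ Function.update u i s) : R i = compl6 s := by
  obtain ⟨l, hl⟩ := h.dich _ hQ R hR hne.symm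
  by_cases hli : l = i
  · subst hli; simpa using hl
  · simp [hli] at hl; exact absurd hl (h.nd R hR l)

theorem k1_cov : IsCov (Function.update u i (compl6 s)) (F.erase (Function.update u i s)) := by
  refine ⟨fun v hv w hw => h.dich v (Finset.mem_of_mem_erase hv) w (Finset.mem_of_mem_erase hw), ?_, ?_⟩
  · intro v hv l
    by_cases hl : l = i
    · subst hl
      rw [k1_other h hs hQ (Finset.mem_of_mem_erase hv) (Finset.ne_of_mem_erase hv)]
      simp; exact (c_ne _).symm
    · simp [hl]; exact h.nd v (Finset.mem_of_mem_erase hv) l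
  · intro p hp
    have hpi : sat (p i) (compl6 s) = true := by simpa using hp i
    have hu : In (fl p i (u i)) u := by
      intro l
      by_cases hl : l = i
      · subst hl; rw [fl_eq]; exact sat_set _ _
      · rw [fl_ne _ _ hl]; simpa [hl] using hp l
    obtain ⟨v, hv, hpv⟩ := h.cov _ hu
    have hsu : s ≠ compl6 (u i) := by
      have := h.nd _ hQ i; simpa using this
    have hne : v ≠ Function.update u i s := by
      rintro rfl
      have := hpv i
      rw [fl_eq] at this
      simp at this
      rw [sat_set' _ _ _ hs hsu] at this
      rw [sat_c, this] at hpi; simp at hpi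
    refine ⟨v, Finset.mem_erase.2 ⟨hne, hv⟩, fun l => ?_⟩
    by_cases hl : l = i
    · subst hl; rw [k1_other h hs hQ hv hne]; exact hpi
    · have := hpv l; rwa [fl_ne _ _ hl] at this

theorem k1_not (tf : TF F) : Function.update u i (compl6 s) ∉ F := by
  intro hm
  refine tf _ hQ _ hm ⟨i, by simp, fun j hj => by simp [hj]⟩
end k1

def Boo (u : W d) (F : Finset (W d)) : Prop :=
  ∀ P ∈ F, ∀ Q ∈ F, ∀ i, P i ≠ u i → Q i ≠ u i → Q i = P i ∨ Q i = compl6 (P i)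

theorem boo_k1 {u : W d} {F : Finset (W d)} (h : IsCov u F) {i : Fin d} {s : Fin 6} (hs : s ≠ u i)
    (hQ : Function.update u i s ∈ F)
    (hb : Boo (Function.update u i (compl6 s)) (F.erase (Function.update u i s))) : Boo u F := by
  have hi : ∀ P ∈ F, P i = s ∨ P i = compl6 s := fun P hP => by
    by_cases e : P = Function.update u i s
    · left; simp [e]
    · right; exact k1_other h hs hQ hP e
  intro P hP R hR j hPj hRj
  by_cases hj : j = i
  · subst hj
    rcases hi P hP with e | e <;> rcases hi R hR with e' | e' <;> simp [e, e', cc]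
  · have h1 : P ≠ Function.update u i s := fun e => hPj (by simp [e, hj])
    have h2 : R ≠ Function.update u i s := fun e => hRj (by simp [e, hj])
    exact hb P (by simp [h1, hP]) R (by simp [h2, hR]) j (by simpa [hj] using hPj) (by simpa [hj] using hRj)

/-- the four letter classes -/
theorem four_cls {u : W d} {F : Finset (W d)} (i : Fin d) (a c : Fin 6)
    (h1 : c ≠ a) (h2 : c ≠ compl6 a) :
    (F.filter (fun Q => Q i = a)).card + (F.filter (fun Q => Q i = compl6 a)).card +
    (F.filter (fun Q => Q i = c)).card + (F.filter (fun Q => Q i = compl6 c)).card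
    + (F.filter (fun Q => Q i ≠ a ∧ Q i ≠ compl6 a ∧ Q i ≠ c ∧ Q i ≠ compl6 c)).card = F.card := by
  have h3 : compl6 c ≠ compl6 a := fun e => h1 (c_inj e)
  have h4 : compl6 c ≠ a := fun e => h2 (c_sw e.symm)
  have h5 := c_ne a
  have h6 := c_ne c
  simp only [Finset.card_filter, ← Finset.sum_add_distrib]
  rw [Finset.card_eq_sum_ones]
  apply Finset.sum_congr rfl
  intro x _
  by_cases e1 : x i = a
  · simp [e1, h5.symm, h1.symm, h4.symm]
  by_cases e2 : x i = compl6 a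
  · simp [e2, h5, h2.symm, h3.symm]
  by_cases e3 : x i = c
  · simp [e3, h6.symm, h1, h2]
  by_cases e4 : x i = compl6 c
  · simp [e4, h6, h3, h4]
  · simp [e1, e2, e3, e4]

theorem four_two {u : W d} {F : Finset (W d)} (h : IsCov u F) (tf : TF F) (hu : u ∉ F) (hc : F.card ≤ 9)
    (hk : ∀ Q ∈ F, ¬ K1 u Q) {P Q : W d} (hP : P ∈ F) (hQ : Q ∈ F) {i : Fin d} (hPi : P i ≠ u i)
    (hQi : Q i ≠ u i) :
    2 ≤ (F.filter (fun R => R i = P i)).card ∧ 2 ≤ (F.filter (fun R => R i = compl6 (P i))).card ∧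
    2 ≤ (F.filter (fun R => R i = Q i)).card ∧ 2 ≤ (F.filter (fun R => R i = compl6 (Q i))).card := by
  have two := lemA h tf hu hc hk
  have aux : ∀ P ∈ F, P i ≠ u i → 2 ≤ (F.filter (fun R => R i = compl6 (P i))).card := by
    intro P hP hPi
    obtain ⟨R, hR, hRi⟩ := h.compl hP hPi
    rw [← hRi]
    exact two R hR i (fun e => h.nd P hP i (by rw [← e, hRi, cc]))
  exact ⟨two P hP i hPi, aux P hP hPi, two Q hQ i hQi, aux Q hQ hQi⟩

/-- general induction: Boolean if no counterexample without k=1 words -/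
theorem boo_of (N : ℕ) (H : ∀ (u : W d) (F : Finset (W d)), F.card ≤ N → IsCov u F → TF F → u ∉ F →
    (∀ Q ∈ F, ¬ K1 u Q) → Boo u F) :
    ∀ (n : ℕ) (u : W d) (F : Finset (W d)), F.card = n → n ≤ N → IsCov u F → TF F → u ∉ F → Boo u F := by
  intro n
  induction n with
  | zero =>
    intro u F hn _ h
    obtain ⟨P, hP⟩ := h.nonempty
    rw [Finset.card_eq_zero] at hn; subst hn; simp at hP
  | succ n ih =>
    intro u F hn hN h tf hu
    by_cases hk : ∀ Q ∈ F, ¬ K1 u Q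
    · exact H u F (by omega) h tf hu hk
    · push Not at hk
      obtain ⟨Q, hQ, i, s, hs, rfl⟩ := hk
      apply boo_k1 h hs hQ
      apply ih
      · rw [Finset.card_erase_of_mem hQ, hn]; rfl
      · omega
      · exact k1_cov h hs hQ
      · exact tf.mono (Finset.erase_subset _ _)
      · exact fun hm => k1_not h hs hQ tf (Finset.mem_of_mem_erase hm)

theorem bool7 {u : W d} {F : Finset (W d)} (hc : F.card ≤ 7) (h : IsCov u F) (tf : TF F) (hu : u ∉ F) :
    Boo u F := by
  refine boo_of 7 ?_ _ u F rfl hc h tf hu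
  clear hc h tf hu u F
  intro u F hc h tf hu hk P hP Q hQ i hPi hQi
  by_contra hcon
  push Not at hcon
  obtain ⟨h1, h2, h3, h4⟩ := four_two h tf hu (by omega) hk hP hQ hPi hQi
  have := four_cls (u := u) (F := F) i (P i) (Q i) hcon.1 hcon.2
  omega

def Six (d : ℕ) : Prop := ∀ (u : W d) (G : Finset (W d)), IsCov u G → TF G → u ∉ G → G.card = 6 →
  ∃ Q ∈ G, K1 u Q

theorem lemT (six : Six d) {u : W d} {F : Finset (W d)} (h : IsCov u F) (tf : TF F)
    (hk : ∀ Q ∈ F, ¬ K1 u Q) {i : Fin d} {a c : Fin 6} (hau : a ≠ u i) (hcu : c ≠ u i)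
    (hac : c ≠ a) (hac' : c ≠ compl6 a)
    (hau' : a ≠ compl6 (u i)) (hcu' : c ≠ compl6 (u i))
    (hsf : ∀ R ∈ F, R i = a ∨ R i = compl6 a ∨ R i = c ∨ R i = compl6 c)
    (n1 : (F.filter (fun R => R i = a)).card = 2) (n2 : (F.filter (fun R => R i = compl6 a)).card = 2)
    (n3 : (F.filter (fun R => R i = c)).card = 2) :
    ∃ j x, j ≠ i ∧ x ≠ u j ∧ Function.update (Function.update u j x) i c ∈ F ∧
      ∀ R ∈ F, (R i = a ∨ R i = compl6 a) → R j = compl6 x := by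
  let e : W d → W d := fun R => Function.update R i (u i)
  let A := F.filter (fun R => R i = a ∨ R i = compl6 a)
  let B := (F.filter (fun R => R i = c)).image e
  have hca : compl6 a ≠ u i := fun h => hau' (by rw [← h, cc])
  have hA : ∀ R, R ∈ A ↔ R ∈ F ∧ (R i = a ∨ R i = compl6 a) := fun R => Finset.mem_filter
  have hB : ∀ R, R ∈ B ↔ ∃ Q ∈ F, Q i = c ∧ e Q = R := by
    intro R; simp [B, and_assoc]
  have hAi : ∀ R ∈ A, R i ≠ u i := by
    intro R hR; rcases ((hA R).1 hR).2 with e | e <;> rw [e] <;> assumption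
  have hBi : ∀ R ∈ B, R i = u i := by
    intro R hR; obtain ⟨Q, _, _, rfl⟩ := (hB R).1 hR; simp [e]
  have einj : ∀ Q ∈ F.filter (fun R => R i = c), ∀ Q' ∈ F.filter (fun R => R i = c), e Q = e Q' → Q = Q' := by
    intro Q hQ Q' hQ' he
    funext l
    by_cases hl : l = i
    · subst hl; rw [(Finset.mem_filter.1 hQ).2, (Finset.mem_filter.1 hQ').2]
    · have := congrFun he l; simpa [e, hl] using this
  have hdAB : ∀ R ∈ A, ∀ Q ∈ B, Dich R Q := by
    intro R hR Q hQ
    obtain ⟨hRF, hRi⟩ := (hA R).1 hR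
    obtain ⟨Q', hQ', hQi, rfl⟩ := (hB Q).1 hQ
    have hne : R ≠ Q' := by
      rintro rfl; rw [hQi] at hRi; rcases hRi with h | h
      · exact hac h
      · exact hac' h
    obtain ⟨l, hl⟩ := h.dich R hRF Q' hQ' hne
    have hli : l ≠ i := by
      rintro rfl
      rw [hQi] at hl
      rcases hRi with h | h
      · rw [h] at hl; exact hac' hl
      · rw [h, cc] at hl; exact hac hl
    exact ⟨l, by simp [e, hli, hl]⟩
  have hdB : ∀ R ∈ B, ∀ Q ∈ B, R ≠ Q → Dich R Q ∧ ¬ Twin R Q := by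
    intro R hR Q hQ hne
    obtain ⟨R', hR', hRi, rfl⟩ := (hB R).1 hR
    obtain ⟨Q', hQ', hQi, rfl⟩ := (hB Q).1 hQ
    have hne' : R' ≠ Q' := by rintro rfl; exact hne rfl
    constructor
    · obtain ⟨l, hl⟩ := h.dich R' hR' Q' hQ' hne'
      have hli : l ≠ i := by
        rintro rfl; rw [hRi, hQi] at hl; exact c_ne _ hl.symm
      exact ⟨l, by simp [e, hli, hl]⟩
    · rintro ⟨l, hl, hll⟩
      have hli : l ≠ i := by
        rintro rfl; simp [e] at hl; exact c_ne _ hl.symm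
      refine tf R' hR' Q' hQ' ⟨l, by simpa [e, hli] using hl, fun m hm => ?_⟩
      by_cases hmi : m = i
      · subst hmi; rw [hRi, hQi]
      · simpa [e, hmi] using hll m hm
  have hcov : IsCov u (A ∪ B) := by
    refine ⟨?_, ?_, ?_⟩
    · intro v hv w hw hne
      rcases Finset.mem_union.1 hv with hv | hv <;> rcases Finset.mem_union.1 hw with hw | hw
      · exact h.dich v ((hA v).1 hv).1 w ((hA w).1 hw).1 hne
      · exact hdAB v hv w hw
      · exact (hdAB w hw v hv).symm
      · exact (hdB v hv w hw hne).1
    · intro v hv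
      rcases Finset.mem_union.1 hv with hv | hv
      · exact h.nd v ((hA v).1 hv).1
      · obtain ⟨Q, hQ, _, rfl⟩ := (hB v).1 hv
        exact upd_nd (h.nd Q hQ) i
    · intro p hp
      obtain ⟨v, hv, hpv⟩ := h.cov _ (hp.fl i c (fun hh => hcu' (c_sw hh)))
      have hpl : ∀ l, l ≠ i → sat (p l) (v l) = true := fun l hl => by
        have := hpv l; rwa [fl_ne _ _ hl] at this
      have hpi := hpv i
      rw [fl_eq] at hpi
      have hcase : (v i = a ∨ v i = compl6 a) ∨ v i = c ∨ v i = compl6 c := by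
        rcases hsf v hv with h | h | h | h <;> simp [h]
      rcases hcase with hva | hva | hva
      · refine ⟨v, Finset.mem_union_left _ ((hA v).2 ⟨hv, hva⟩), fun l => ?_⟩
        by_cases hl : l = i
        · subst hl
          rw [sat_set'] at hpi
          · exact hpi
          · rcases hva with h | h <;> rw [h]
            · exact hac.symm
            · exact hac'.symm
          · rcases hva with h | h <;> rw [h]
            · exact fun h => hac' (c_sw h)
            · exact fun h => hac (c_inj h).symm
        · exact hpl l hl
      · refine ⟨e v, Finset.mem_union_right _ ((hB _).2 ⟨v, hv, hva, rfl⟩), fun l => ?_⟩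
        by_cases hl : l = i
        · subst hl; simp [e]; exact hp l
        · simp [e, hl]; exact hpl l hl
      · rw [hva, sat_c, sat_set] at hpi; simp at hpi
  have htf : TF (A ∪ B) := by
    intro v hv w hw
    have hAB : ∀ R ∈ A, ∀ Q ∈ B, ¬ Twin R Q := by
      rintro R hR Q hQ ⟨l, hl, hll⟩
      by_cases hli : l = i
      · subst hli; rw [hBi Q hQ] at hl
        rcases ((hA R).1 hR).2 with h | h
        · rw [h] at hl; exact hca hl.symm
        · rw [h, cc] at hl; exact hau hl.symm
      · exact hAi R hR ((hll i (Ne.symm hli)).trans (hBi Q hQ))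
    rcases Finset.mem_union.1 hv with hv | hv <;> rcases Finset.mem_union.1 hw with hw | hw
    · exact tf v ((hA v).1 hv).1 w ((hA w).1 hw).1
    · exact hAB v hv w hw
    · exact fun h => hAB w hw v hv h.symm
    · by_cases hne : v = w
      · subst hne; rintro ⟨l, hl, _⟩; exact c_ne _ hl.symm
      · exact (hdB v hv w hw hne).2
  have hkk : ∀ Q ∈ F, ∀ j x, x ≠ u j → Q ≠ Function.update u j x := fun Q hQ j x hx e => hk Q hQ ⟨j, x, hx, e⟩
  have hu : u ∉ A ∪ B := by
    intro hu
    rcases Finset.mem_union.1 hu with hu | hu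
    · exact hAi u hu rfl
    · obtain ⟨Q, hQ, hQi, he⟩ := (hB u).1 hu
      refine hkk Q hQ i c hcu ?_
      funext l
      by_cases hl : l = i
      · subst hl; simp [hQi]
      · have := congrFun he l; simp [e, hl] at this; simp [hl, this]
  have hcard : (A ∪ B).card = 6 := by
    rw [Finset.card_union_of_disjoint, Finset.card_image_of_injOn (fun x hx y hy => einj x hx y hy), n3]
    · have : A = F.filter (fun R => R i = a) ∪ F.filter (fun R => R i = compl6 a) := by
        rw [← Finset.filter_or]
      rw [this, Finset.card_union_of_disjoint, n1, n2]
      rw [Finset.disjoint_filter]; intro x _ e1 e2; exact c_ne _ (e2.symm.trans e1)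
    · rw [Finset.disjoint_left]; intro x hx hx'; exact hAi x hx (hBi x hx')
  obtain ⟨Q, hQ, j, x, hx, rfl⟩ := six u _ hcov htf hu hcard
  rcases Finset.mem_union.1 hQ with hQ' | hQ'
  · exact absurd rfl (hkk _ ((hA _).1 hQ').1 j x hx)
  have hji : j ≠ i := by
    rintro rfl; have := hBi _ hQ'; simp at this; exact hx this
  refine ⟨j, x, hji, hx, ?_, ?_⟩
  · obtain ⟨Q', h1, h2, h3⟩ := (hB _).1 hQ'
    have : Q' = Function.update (Function.update u j x) i c := by
      funext l
      by_cases hl : l = i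
      · subst hl; simp [h2]
      · have := congrFun h3 l; simp [e, hl] at this; simp [hl, this]
    rwa [← this]
  · intro R hR hRi
    have hRA : R ∈ A := (hA R).2 ⟨hR, hRi⟩
    exact k1_other hcov hx hQ (Finset.mem_union_left _ hRA) (hkk R hR j x hx)

end Cov
namespace Cov
variable {d : ℕ}

theorem bool8 (six : Six d) {u : W d} {F : Finset (W d)} (hc : F.card ≤ 8) (h : IsCov u F) (tf : TF F)
    (hu : u ∉ F) : Boo u F := by
  refine boo_of 8 ?_ _ u F rfl hc h tf hu
  clear hc h tf hu u F
  intro u F hc h tf hu hk P hP Q hQ i hPi hQi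
  by_contra hcon
  push Not at hcon
  obtain ⟨h1, h2, h3, h4⟩ := four_two h tf hu (by omega) hk hP hQ hPi hQi
  have h5 := four_cls (u := u) (F := F) i (P i) (Q i) hcon.1 hcon.2
  have h0 : (F.filter (fun R => R i ≠ P i ∧ R i ≠ compl6 (P i) ∧ R i ≠ Q i ∧ R i ≠ compl6 (Q i))).card = 0 := by
    omega
  rw [Finset.card_eq_zero, Finset.filter_eq_empty_iff] at h0
  have hsf : ∀ R ∈ F, R i = P i ∨ R i = compl6 (P i) ∨ R i = Q i ∨ R i = compl6 (Q i) := by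
    intro R hR; have := h0 hR; tauto
  have nP := h.nd P hP i
  have nQ := h.nd Q hQ i
  have hQ' : compl6 (Q i) ≠ P i := fun e => hcon.2 (c_sw e.symm)
  obtain ⟨j, x, hj, hx, hm, hall⟩ := lemT six h tf hk hPi hQi hcon.1 hcon.2 nP nQ hsf (by omega) (by omega) (by omega)
  obtain ⟨j2, y, hj2, hy, hm2, hall2⟩ := lemT six h tf hk hPi (c := compl6 (Q i)) (fun e => nQ (c_sw e.symm))
    hQ' (fun e => hcon.1 (c_inj e)) nP
    (fun e => hQi (c_inj e)) (by intro R hR; rw [cc]; have := hsf R hR; tauto) (by omega) (by omega) (by omega)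
  obtain ⟨j3, z, hj3, hz, hm3, hall3⟩ := lemT six h tf hk hQi hPi hcon.1.symm hQ'.symm nQ nP
    (by intro R hR; have := hsf R hR; tauto) (by omega) (by omega) (by omega)
  have k1 := hall _ hm3 (by simp)
  have k2 := hall2 _ hm3 (by simp)
  have n1 : compl6 x ≠ u j := by
    intro e
    have := h.nd _ hm j; simp [hj] at this; exact this (c_sw e.symm)
  have n2 : compl6 y ≠ u j2 := by
    intro e
    have := h.nd _ hm2 j2; simp [hj2] at this; exact this (c_sw e.symm)
  have e1 : j = j3 := by
    by_contra hne; simp [hj, hne] at k1; exact n1 k1.symm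
  have e2 : j2 = j3 := by
    by_contra hne; simp [hj2, hne] at k2; exact n2 k2.symm
  subst e1; subst e2
  simp [hj] at k1 k2
  have : x = y := c_inj (k1.symm.trans k2)
  subst this
  exact tf _ hm _ hm2 ⟨i, by simp, fun l hl => by simp [hl]⟩

theorem half_cov {u : W d} {C : Finset (W d)} (h : IsCov u C) {i : Fin d} {a : Fin 6} (h1 : a ≠ u i)
    (h2 : a ≠ compl6 (u i)) (hall : ∀ R ∈ C, R i = a ∨ R i = compl6 a) :
    IsCov (Function.update u i a) (C.filter (fun R => R i = a)) := by
  refine ⟨fun v hv w hw => h.dich v (Finset.mem_filter.1 hv).1 w (Finset.mem_filter.1 hw).1, ?_, ?_⟩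
  · intro v hv l
    obtain ⟨hv, hvi⟩ := Finset.mem_filter.1 hv
    by_cases hl : l = i
    · subst hl; simp [hvi]; exact (c_ne _).symm
    · simp [hl]; exact h.nd v hv l
  · intro p hp
    have hpi : sat (p i) a = true := by simpa using hp i
    have hu : In (fl p i (u i)) u := by
      intro l
      by_cases hl : l = i
      · subst hl; rw [fl_eq]; exact sat_set _ _
      · rw [fl_ne _ _ hl]; simpa [hl] using hp l
    obtain ⟨v, hv, hpv⟩ := h.cov _ hu
    have hvi : v i = a := by
      rcases hall v hv with e | e
      · exact e
      · have := hpv i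
        rw [fl_eq, e, sat_c, sat_set' _ _ _ h1 h2, hpi] at this; simp at this
    refine ⟨v, Finset.mem_filter.2 ⟨hv, hvi⟩, fun l => ?_⟩
    by_cases hl : l = i
    · subst hl; rw [hvi]; exact hpi
    · have := hpv l; rwa [fl_ne _ _ hl] at this

theorem lemP {u v : W d} {C : Finset (W d)} (hu : IsCov u C) (hv : IsCov v C) (tf : TF C)
    {i : Fin d} (hd : v i = compl6 (u i)) (ht : ¬ Twin u v) (hc : C.card ≤ 9) :
    (∀ R ∈ C, R i ≠ u i) ∧ (∃ P ∈ C, ∃ Q ∈ C, Q i ≠ P i ∧ Q i ≠ compl6 (P i)) ∧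
    (∀ Q ∈ C, ¬ K1 u Q) := by
  have hsf : ∀ R ∈ C, R i ≠ u i := fun R hR e => hv.nd R hR i (by rw [hd, cc, e])
  have hex : ∃ P ∈ C, ∃ Q ∈ C, Q i ≠ P i ∧ Q i ≠ compl6 (P i) := by
    by_contra hcon
    push Not at hcon
    have hcon' : ∀ P ∈ C, ∀ Q ∈ C, Q i = P i ∨ Q i = compl6 (P i) := fun P hP Q hQ => by
      have := hcon P hP Q hQ; tauto
    obtain ⟨P, hP⟩ := hu.nonempty
    have key : ∀ a, a ≠ u i → a ≠ compl6 (u i) → (∀ R ∈ C, R i = a ∨ R i = compl6 a) →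
        5 ≤ (C.filter (fun R => R i = a)).card := by
      intro a h1 h2 hall
      by_contra hlt
      have cu := half_cov hu h1 h2 hall
      have cv := half_cov hv (i := i) (a := a) (by rw [hd]; exact h2) (by rw [hd, cc]; exact h1) hall
      have tf' := tf.mono (Finset.filter_subset (fun R => R i = a) C)
      have mu : Function.update u i a ∈ C.filter (fun R => R i = a) := by
        by_contra hm; exact hlt (five cu tf' hm)
      have mv : Function.update v i a ∈ C.filter (fun R => R i = a) := by
        by_contra hm; exact hlt (five cv tf' hm)
      have e := cu.eq_of_mem mu mv
      refine ht ⟨i, hd, fun l hl => ?_⟩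
      have := congrFun e l; simp [hl] at this; exact this.symm
    have hP1 := hsf P hP
    have hP2 := hu.nd P hP i
    have a1 := key (P i) hP1 hP2 (hcon' P hP)
    have a2 := key (compl6 (P i)) (fun e => hP2 (c_sw e.symm)) (fun e => hP1 (c_inj e))
      (fun R hR => by rw [cc]; exact (hcon' P hP R hR).symm)
    have hdis : Disjoint (C.filter (fun Q => Q i = P i)) (C.filter (fun Q => Q i = compl6 (P i))) := by
      rw [Finset.disjoint_filter]; intro x _ e1 e2; exact c_ne _ (e2.symm.trans e1)
    have h3 := Finset.card_le_card (Finset.union_subset (Finset.filter_subset (fun Q => Q i = P i) C)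
      (Finset.filter_subset (fun Q => Q i = compl6 (P i)) C))
    rw [Finset.card_union_of_disjoint hdis] at h3
    omega
  refine ⟨hsf, hex, ?_⟩
  rintro Q hQ ⟨l, s, hs, rfl⟩
  have hli : l = i := by
    by_contra hl; exact hsf _ hQ (by simp [Ne.symm hl])
  subst hli
  have hi : ∀ P ∈ C, P l = s ∨ P l = compl6 s := fun P hP => by
    by_cases e : P = Function.update u l s
    · left; simp [e]
    · right; exact k1_other hu hs hQ hP e
  obtain ⟨P, hP, R, hR, n1, n2⟩ := hex
  rcases hi P hP with e | e <;> rcases hi R hR with e' | e' <;> simp [e, e', cc] at n1 n2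

theorem core2 (six : Six d) {u : W d} {C : Finset (W d)} (h : IsCov u C) (tf : TF C) (hu : u ∉ C)
    (hk : ∀ Q ∈ C, ¬ K1 u Q) (hc : C.card ≤ 9) {i i' : Fin d} (hii : i' ≠ i)
    (hsf' : ∀ R ∈ C, R i' ≠ u i') (hex : ∃ P ∈ C, ∃ Q ∈ C, Q i' ≠ P i' ∧ Q i' ≠ compl6 (P i'))
    {a c : Fin 6} (hau : a ≠ u i) (hcu : c ≠ u i)
    (hac : c ≠ a) (hac' : c ≠ compl6 a)
    (hau' : a ≠ compl6 (u i)) (hcu' : c ≠ compl6 (u i))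
    (hsf : ∀ R ∈ C, R i = a ∨ R i = compl6 a ∨ R i = c ∨ R i = compl6 c)
    (n1 : (C.filter (fun R => R i = a)).card = 2) (n2 : (C.filter (fun R => R i = compl6 a)).card = 2)
    (n3 : (C.filter (fun R => R i = c)).card = 2) : False := by
  obtain ⟨j, x, hj, hx, hm, hall⟩ := lemT six h tf hk hau hcu hac hac' hau' hcu' hsf n1 n2 n3
  have e : i' = j := by
    by_contra hne; exact hsf' _ hm (by simp [hii, hne])
  subst e
  have h4 : 4 ≤ (C.filter (fun R => R i' = compl6 x)).card := by
    have hdis : Disjoint (C.filter (fun Q => Q i = a)) (C.filter (fun Q => Q i = compl6 a)) := by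
      rw [Finset.disjoint_filter]; intro x _ e1 e2; exact c_ne _ (e2.symm.trans e1)
    have hss : (C.filter (fun Q => Q i = a)) ∪ (C.filter (fun Q => Q i = compl6 a)) ⊆
        C.filter (fun R => R i' = compl6 x) := by
      intro R hR
      rw [← Finset.filter_or] at hR
      obtain ⟨hR, hRi⟩ := Finset.mem_filter.1 hR
      exact Finset.mem_filter.2 ⟨hR, hall R hR hRi⟩
    have := Finset.card_le_card hss
    rw [Finset.card_union_of_disjoint hdis] at this
    omega
  obtain ⟨P, hP, hPx, hPx'⟩ : ∃ P ∈ C, P i' ≠ x ∧ P i' ≠ compl6 x := by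
    by_contra hcon
    push Not at hcon
    obtain ⟨P, hP, R, hR, m1, m2⟩ := hex
    have hi : ∀ P ∈ C, P i' = x ∨ P i' = compl6 x := fun P hP => by
      have := hcon P hP; tauto
    rcases hi P hP with e | e <;> rcases hi R hR with e' | e' <;> simp [e, e', cc] at m1 m2
  obtain ⟨k1, k2, k3, k4⟩ := four_two h tf hu hc hk hm hP (i := i') (by simp [hii, hx]) (hsf' P hP)
  simp [hii] at k1 k2
  have := four_cls (u := u) (F := C) i' x (P i') hPx hPx'
  omega

theorem three_core (six : Six d) {u : W d} {C : Finset (W d)} (h : IsCov u C) (tf : TF C) (hu : u ∉ C)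
    (hk : ∀ Q ∈ C, ¬ K1 u Q) (hc : C.card ≤ 9) {i i' : Fin d} (hii : i' ≠ i)
    (hsf : ∀ R ∈ C, R i ≠ u i) (hex : ∃ P ∈ C, ∃ Q ∈ C, Q i ≠ P i ∧ Q i ≠ compl6 (P i))
    (hsf' : ∀ R ∈ C, R i' ≠ u i') (hex' : ∃ P ∈ C, ∃ Q ∈ C, Q i' ≠ P i' ∧ Q i' ≠ compl6 (P i')) : False := by
  obtain ⟨P, hP, Q, hQ, m1, m2⟩ := hex
  have hPi := hsf P hP
  have hQi := hsf Q hQ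
  have nP := h.nd P hP i
  have nQ := h.nd Q hQ i
  obtain ⟨k1, k2, k3, k4⟩ := four_two h tf hu hc hk hP hQ hPi hQi
  have h5 := four_cls (u := u) (F := C) i (P i) (Q i) m1 m2
  have hl : ∀ u p q r : Fin 6, p ≠ u → p ≠ compl6 u → q ≠ u → q ≠ compl6 u → q ≠ p → q ≠ compl6 p →
    r ≠ u → r ≠ compl6 u → r = p ∨ r = compl6 p ∨ r = q ∨ r = compl6 q := by decide
  have hall : ∀ R ∈ C, R i = P i ∨ R i = compl6 (P i) ∨ R i = Q i ∨ R i = compl6 (Q i) :=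
    fun R hR => hl (u i) _ _ _ hPi nP hQi nQ m1 m2 (hsf R hR) (h.nd R hR i)
  have hQ' : compl6 (Q i) ≠ P i := fun e => m2 (c_sw e.symm)
  have hP' : compl6 (P i) ≠ Q i := fun e => m2 e.symm
  have cQ : compl6 (Q i) ≠ u i := fun e => nQ (c_sw e.symm)
  have cP : compl6 (P i) ≠ u i := fun e => nP (c_sw e.symm)
  have cQ2 : compl6 (Q i) ≠ compl6 (u i) := fun e => hQi (c_inj e)
  have cP2 : compl6 (P i) ≠ compl6 (u i) := fun e => hPi (c_inj e)
  have cPQ : compl6 (Q i) ≠ compl6 (P i) := fun e => m1 (c_inj e)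
  by_cases a1 : (C.filter (fun R => R i = P i)).card = 2
  · by_cases a2 : (C.filter (fun R => R i = compl6 (P i))).card = 2
    · by_cases a3 : (C.filter (fun R => R i = Q i)).card = 2
      · exact core2 six h tf hu hk hc hii hsf' hex' hPi hQi m1 m2 nP nQ hall a1 a2 a3
      · exact core2 six h tf hu hk hc hii hsf' hex' (c := compl6 (Q i)) hPi cQ hQ' cPQ nP cQ2
          (fun R hR => by rw [cc]; have := hall R hR; tauto) a1 a2 (by omega)
    · exact core2 six h tf hu hk hc hii hsf' hex' hQi hPi m1.symm hQ'.symm nQ nP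
          (fun R hR => by have := hall R hR; tauto) (by omega) (by omega) a1
  · exact core2 six h tf hu hk hc hii hsf' hex' (c := compl6 (P i)) hQi cP hP' cPQ.symm nQ cP2
          (fun R hR => by rw [cc]; have := hall R hR; tauto) (by omega) (by omega) (by omega)

theorem three (six : Six d) {u v w : W d} {C : Finset (W d)} (hu : IsCov u C) (hv : IsCov v C) (hw : IsCov w C)
    (tf : TF C) (nu : u ∉ C) (nv : v ∉ C) (hc : C.card ≤ 9)
    (duv : Dich u v) (duw : Dich u w) (dvw : Dich v w) (tuv : ¬ Twin u v) (tuw : ¬ Twin u w) (tvw : ¬ Twin v w) :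
    False := by
  obtain ⟨i, hi⟩ := duv
  obtain ⟨i', hi'⟩ := duw
  obtain ⟨s1, e1, k1⟩ := lemP hu hv tf hi tuv hc
  by_cases hii : i' = i
  · subst hii
    obtain ⟨i2, hi2⟩ := dvw
    have hne : i2 ≠ i' := by
      rintro rfl; rw [hi', hi, cc] at hi2; exact c_ne _ hi2
    obtain ⟨s2, e2, k2⟩ := lemP hv hw tf hi2 tvw hc
    obtain ⟨s3, e3, k3⟩ := lemP hv hu tf (c_sw hi) (fun t => tuv t.symm) hc
    exact three_core six hv tf nv k2 hc hne s3 e3 s2 e2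
  · obtain ⟨s2, e2, k2⟩ := lemP hu hw tf hi' tuw hc
    exact three_core six hu tf nu k1 hc hii s1 e1 s2 e2

end Cov
noncomputable section
namespace Cov

def force {α : Type} (n : ℕ) (f : ℕ → α) : α := Nat.rec (f 0) (fun k _ => f (Nat.succ k)) n
def sel {α : Type} (c : Bool) (x y : α) : α := Bool.rec y x c
def app {α : Type} (xs ys : List α) : List α := List.rec ys (fun x _ ih => x :: ih) xs
def fmap {α β : Type} (f : α → List β) (xs : List α) : List β := List.rec [] (fun x _ ih => app (f x) ih) xs
def flt (p : ℕ → Bool) (xs : List ℕ) : List ℕ := List.rec [] (fun x _ ih => sel (p x) (x :: ih) ih) xs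
def len {α : Type} (xs : List α) : ℕ := List.rec 0 (fun _ _ ih => Nat.succ ih) xs
def fold {α : Type} (f : α → ℕ → ℕ) (c : ℕ) (xs : List α) : ℕ := List.rec c (fun x _ ih => f x ih) xs
def all {α : Type} (f : α → Bool) (xs : List α) : Bool := List.rec true (fun x _ ih => sel (f x) ih false) xs

def six (b s : ℕ) : ℕ := Nat.lor b (Nat.lor (Nat.shiftLeft b s) (Nat.lor (Nat.shiftLeft b (Nat.mul 2 s))
  (Nat.lor (Nat.shiftLeft b (Nat.mul 3 s)) (Nat.lor (Nat.shiftLeft b (Nat.mul 4 s)) (Nat.shiftLeft b (Nat.mul 5 s))))))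

def bs (p : ℕ) : ℕ :=
  sel (Nat.beq p 1) (six (six (six (six 1 6) 36) 216) 1296)
  (sel (Nat.beq p 6) (six (six (six 63 36) 216) 1296)
  (sel (Nat.beq p 36) (six (six (Nat.sub (Nat.pow 2 36) 1) 216) 1296)
  (sel (Nat.beq p 216) (six (Nat.sub (Nat.pow 2 216) 1) 1296)
  (Nat.sub (Nat.pow 2 1296) 1))))

def b64 : ℕ := 18446744073709551616
def ones : ℕ := 18446744073709551615
def top : ℕ := Nat.sub (Nat.pow 2 7840) 1
def slt (w : ℕ) : ℕ := Nat.mul w 173961102589771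
def nz (m : ℕ) : Bool := Nat.ble 18446744073709551616 m
def b1 (x : ℕ) : ℕ := Nat.shiftLeft 18446744073709551616 x
/-- digit at place p -/
def dg (p x : ℕ) : ℕ := Nat.mod (Nat.div x p) 6
/-- words having letter l at place p -/
def lit (p l : ℕ) : ℕ := Nat.shiftLeft (bs p) (Nat.add 64 (Nat.mul l p))
def ps : List ℕ := [1, 6, 36, 216, 1296]
def dm (w : ℕ) : ℕ := fold (fun p c => Nat.lor c (lit p (Nat.xor (dg p w) 1))) 0 ps
/-- twin of w at place p -/
def tw (p w : ℕ) : ℕ := sel (Nat.beq (Nat.mod (dg p w) 2) 0) (Nat.add w p) (Nat.sub w p)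
def tm (w : ℕ) : ℕ := fold (fun p c => Nat.lor c (b1 (tw p w))) 0 ps
/-- good words (with ones as low bits) -/
def gm (w : ℕ) : ℕ := Nat.lor ones (Nat.xor (dm w) (tm w))
def mem (m w : ℕ) : Bool := nz (Nat.land m (b1 w))

def lgs : List ℕ := [4096, 2048, 1024, 512, 256, 128, 64, 32, 16, 8, 4, 2, 1]
/-- index of an isolated bit -/
def lg (b : ℕ) : ℕ := (List.rec (motive := fun _ => ℕ → ℕ → ℕ) (fun _ a => a)
  (fun k _ ih b a => sel (Nat.ble (Nat.shiftLeft 1 k) b)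
     (force (Nat.shiftRight b k) fun b => force (Nat.add a k) fun a => ih b a) (ih b a)) lgs) (Nat.shiftRight b 64) 0
def lg2 (_ b : ℕ) : ℕ := lg b

/-- loop over set bits -/
def bloop {β : Type} (f : ℕ → List β) (fuel : ℕ) : ℕ → List β :=
  Nat.rec (fun _ => []) (fun _ ih m =>
    force m fun m => sel (nz m) (
      force (Nat.land m (Nat.sub m b64)) fun m1 =>
      force (Nat.xor m m1) fun b =>
      force (Nat.mod b 8191) fun r =>
      force (lg2 r b) fun w => app (f w) (ih m1)) []) fuel

def scan (ch : ℕ) (pts : List ℕ) : List ℕ :=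
  List.rec [] (fun p t ih => sel (nz (Nat.land p ch)) ih (p :: t)) pts

def lastc (ch : ℕ) (pts : List ℕ) : ℕ → ℕ :=
  List.rec (fun c => c) (fun p _ ih c =>
    force c fun c => sel (nz c) (sel (nz (Nat.land p ch)) (ih c) (ih (Nat.land c p))) 0) pts

def run (k : ℕ) : ℕ → ℕ → List ℕ → List ℕ → List (List ℕ) :=
  Nat.rec
    (fun cand ch pts acc =>
      List.rec [acc] (fun p t _ => bloop (fun w => [w :: acc]) 8000 (lastc ch (p :: t) cand)) (scan ch pts))
    (fun _ ih cand ch pts acc =>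
      List.rec [acc] (fun p t _ => bloop (fun w =>
          force (Nat.xor (Nat.land cand (gm w)) (slt w)) fun c =>
          force (Nat.xor (Nat.lor ch (b1 w)) (slt w)) fun ch' => ih c ch' t (w :: acc)) 8000 (Nat.land cand p))
        (scan ch pts)) k

/-- words agreeing with v at p, or having parity s at p -/
def half (p s v : ℕ) : ℕ := Nat.lor ones (Nat.lor (lit p (dg p v)) (Nat.lor (lit p s) (Nat.lor (lit p (Nat.add s 2)) (lit p (Nat.add s 4)))))

def split (ms : List ℕ) (e o : ℕ) : List ℕ :=
  List.rec [] (fun m _ ih => force (Nat.land m e) fun a => force (Nat.land m o) fun b => a :: b :: ih) ms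

def ptl (js : List ℕ) (v : ℕ) : List ℕ :=
  List.rec (motive := fun _ => List ℕ) [Nat.sub top (slt v)] (fun p _ ih => split ih (half p 0 v) (half p 1 v)) js
def pts (v : ℕ) : List ℕ := ptl ps v

def orb (xs : List ℕ) : ℕ := fold (fun x c => Nat.lor c (b1 x)) 0 xs

/-- Boolean restriction at place p: center letter a, other letter b -/
def rl (p a b : ℕ) : ℕ := sel (Nat.beq a b) top (Nat.lor (lit p a) (Nat.lor (lit p b) (lit p (Nat.xor b 1))))
def rest (v : ℕ) (xs : List ℕ) : ℕ :=
  fold (fun p c => fold (fun x c => Nat.land c (rl p (dg p v) (dg p x))) c xs) top ps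
def ndl (p a : ℕ) : ℕ := Nat.sub top (lit p (Nat.xor a 1))
def ndm (v c : ℕ) : ℕ := fold (fun p c => Nat.land c (ndl p (dg p v))) c ps

def vgo {β : Type} (mn : ℕ) (lets : ℕ → List ℕ) (leaf : ℕ → List ℕ → List β) (js : List ℕ) : ℕ → List ℕ → List β :=
  List.rec leaf (fun p _ ih v sh =>
    fmap (fun l => 
      (fun sh' => sel (Nat.ble mn (len sh')) (force (Nat.add v (Nat.mul l p)) fun v' => ih v' sh') [])
       (flt (fun x => sel (Nat.beq (dg p x) (Nat.xor l 1)) false true) sh))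
      (lets p)) js

def mn (a b : ℕ) : ℕ := sel (Nat.ble a b) a b

def U0 : ℕ := 3110

def leaf2 (n : ℕ) (C : List ℕ) (c0 : ℕ) (v : ℕ) (sh : List ℕ) : List (ℕ × List ℕ) :=
  sel (mem (gm U0) v) (sel (mem (orb C) v) [] (
    force (rest v sh) fun R =>
    force (orb sh) fun o =>
    sel (Nat.beq (Nat.land o R) o) (
      force (Nat.xor (slt v) (ndm v (Nat.land c0 R))) fun cand =>
      force (Nat.xor (slt v) o) fun ch =>
      force (mn (Nat.sub 9 n) (Nat.sub n (len sh))) fun k =>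
      fmap (fun x => [(v, x)])
       (run (Nat.sub k 1) (sel (Nat.beq k 0) 0 cand) ch (pts v) [])) [])) []

def cand0 (C : List ℕ) : ℕ := Nat.shiftLeft (Nat.shiftRight (fold (fun x c => Nat.land c (gm x)) (dm U0) C) 64) 64

def stage2 (n : ℕ) (C : List ℕ) : List (ℕ × List ℕ) :=
  force (cand0 C) fun c0 => vgo (Nat.sub n 4) (fun p => sel (all (fun x => Nat.beq (dg p x) 2) C) [2,3,4] [0,1,2,3,4]) (leaf2 n C c0) ps 0 C

end Cov
end
namespace Cov

theorem force_eq {α : Type} (n : ℕ) (f : ℕ → α) : force n f = f n := by cases n <;> rfl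
theorem sel_eq {α : Type} (c : Bool) (x y : α) : sel c x y = if c = true then x else y := by cases c <;> rfl
theorem app_eq {α : Type} (xs ys : List α) : app xs ys = xs ++ ys := by
  induction xs with
  | nil => rfl
  | cons x t ih => exact congrArg (x :: ·) ih
theorem fmap_eq {α β : Type} (f : α → List β) (xs : List α) : fmap f xs = xs.flatMap f := by
  induction xs with
  | nil => rfl
  | cons x t ih =>
    have : fmap f (x :: t) = app (f x) (fmap f t) := rfl
    rw [this, app_eq, ih]; rfl
theorem flt_eq (p : ℕ → Bool) (xs : List ℕ) : flt p xs = xs.filter p := by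
  induction xs with
  | nil => rfl
  | cons x t ih =>
    have : flt p (x :: t) = sel (p x) (x :: flt p t) (flt p t) := rfl
    rw [this, sel_eq, ih, List.filter_cons]
theorem len_eq {α : Type} (xs : List α) : len xs = xs.length := by
  induction xs with
  | nil => rfl
  | cons x t ih => exact congrArg Nat.succ ih
theorem all_eq {α : Type} (f : α → Bool) (xs : List α) : all f xs = xs.all f := by
  induction xs with
  | nil => rfl
  | cons x t ih =>
    have : all f (x :: t) = sel (f x) (all f t) false := rfl
    rw [this, sel_eq, ih, List.all_cons]; cases f x <;> rfl
theorem fold_cons {α : Type} (f : α → ℕ → ℕ) (c : ℕ) (x : α) (t : List α) :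
    fold f c (x :: t) = f x (fold f c t) := rfl
theorem fold_nil {α : Type} (f : α → ℕ → ℕ) (c : ℕ) : fold f c [] = c := rfl

def tb (m x : ℕ) : Bool := Nat.testBit m (64 + x)

theorem tb_land (a b x : ℕ) : tb (Nat.land a b) x = (tb a x && tb b x) := Nat.testBit_land ..
theorem tb_lor (a b x : ℕ) : tb (Nat.lor a b) x = (tb a x || tb b x) := Nat.testBit_lor ..
theorem tb_xor (a b x : ℕ) : tb (Nat.xor a b) x = (tb a x ^^ tb b x) := Nat.testBit_xor ..
theorem tb_small {a : ℕ} (h : a < 2 ^ 64) (x : ℕ) : tb a x = false :=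
  Nat.testBit_lt_two_pow (h.trans_le (Nat.pow_le_pow_right (by norm_num) (by omega)))
theorem tb_ones (x : ℕ) : tb ones x = false := tb_small (by norm_num [ones]) x
theorem tb_zero (x : ℕ) : tb 0 x = false := tb_small (by norm_num) x
theorem slt_lt {w : ℕ} (h : w < 7776) : slt w < 2 ^ 64 := by
  have : slt w = w * 173961102589771 := rfl
  omega
theorem tb_slt {w : ℕ} (h : w < 7776) (x : ℕ) : tb (slt w) x = false := tb_small (slt_lt h) x
theorem tb_b1 (x y : ℕ) : tb (b1 x) y = decide (y = x) := by
  have : b1 x = 2 ^ (64 + x) := by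
    have : b1 x = 18446744073709551616 <<< x := rfl
    rw [this, Nat.shiftLeft_eq, pow_add]; norm_num
  rw [tb, this, Nat.testBit_two_pow]
  simp [eq_comm]
theorem nz_iff (m : ℕ) : nz m = true ↔ ∃ x, tb m x = true := by
  have h : nz m = true ↔ 2 ^ 64 ≤ m := by
    show Nat.ble _ m = true ↔ _
    rw [Nat.ble_eq]; norm_num
  rw [h]
  constructor
  · intro h
    obtain ⟨i, hi, hm⟩ := Nat.exists_ge_and_testBit_of_ge_two_pow h
    exact ⟨i - 64, by rw [tb, show 64 + (i - 64) = i by omega]; exact hm⟩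
  · rintro ⟨x, hx⟩
    by_contra hc
    rw [tb_small (by omega)] at hx; simp at hx
theorem nz_false {m : ℕ} (h : nz m = false) (x : ℕ) : tb m x = false := by
  by_contra hc
  have := (nz_iff m).2 ⟨x, by simpa using hc⟩
  rw [h] at this; simp at this

/-- lowest bit -/
theorem low_bit {m t : ℕ} (h0 : ∀ y < t, tb m y = false) (ht : tb m t = true) :
    Nat.xor m (Nat.land m (Nat.sub m b64)) = 2 ^ (64 + t) ∧
    ∀ y, tb (Nat.land m (Nat.sub m b64)) y = (tb m y && decide (y ≠ t)) := by
  have e : ∃ q L, L < 2 ^ 64 ∧ m = 2 ^ (64 + t + 1) * q + (2 ^ (64 + t) + L) := by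
    refine ⟨m / 2 ^ (64 + t + 1), m % 2 ^ 64, Nat.mod_lt _ (by positivity), ?_⟩
    conv_lhs => rw [← Nat.div_add_mod m (2 ^ (64 + t + 1))]
    congr 1
    apply Nat.eq_of_testBit_eq
    intro i
    rw [Nat.testBit_mod_two_pow, add_comm (2 ^ (64 + t))]
    have hl : m % 2 ^ 64 < 2 ^ (64 + t) :=
      (Nat.mod_lt _ (by positivity)).trans_le (Nat.pow_le_pow_right (by norm_num) (by omega))
    have := Nat.testBit_two_pow_mul_add 1 hl i
    rw [mul_one, add_comm] at this
    rw [this, Nat.testBit_mod_two_pow]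
    split_ifs with hi
    · by_cases h64 : i < 64
      · simp [h64]; omega
      · have := h0 (i - 64) (by omega)
        rw [tb, show 64 + (i - 64) = i by omega] at this
        simp [this]
    · by_cases hh : i = 64 + t
      · subst hh
        simpa [tb] using ht
      · have : ¬ i < 64 + t + 1 := by omega
        simp only [this, decide_false, Bool.false_and]
        symm; apply Nat.testBit_lt_two_pow
        exact Nat.one_lt_two_pow (by omega)
  obtain ⟨q, L, hL, rfl⟩ := e
  set n := 64 + t with hn
  have h1 : 2 ^ n = 2 ^ 64 * 2 ^ t := by rw [hn, pow_add]
  have hpos : 0 < 2 ^ t := by positivity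
  have hs : Nat.sub (2 ^ (n + 1) * q + (2 ^ n + L)) b64 = 2 ^ (n + 1) * q + (2 ^ n - 2 ^ 64 + L) := by
    have : 2 ^ 64 ≤ 2 ^ n := by rw [h1]; nlinarith
    have hb : b64 = 2 ^ 64 := by norm_num [b64]
    show _ - b64 = _
    rw [hb]; omega
  have hA : 2 ^ n - 2 ^ 64 + L < 2 ^ n := by
    have : 2 ^ 64 ≤ 2 ^ n := by rw [h1]; nlinarith
    omega
  have hLn : L < 2 ^ n := by rw [h1]; nlinarith
  have h2 : 2 ^ n < 2 ^ (n + 1) := Nat.pow_lt_pow_right (by norm_num) (by omega)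
  have hB : 2 ^ n + L < 2 ^ (n + 1) := by rw [pow_succ]; omega
  have key : ∀ i, Nat.testBit (Nat.land (2 ^ (n + 1) * q + (2 ^ n + L)) (2 ^ (n + 1) * q + (2 ^ n - 2 ^ 64 + L))) i
      = (Nat.testBit (2 ^ (n + 1) * q + (2 ^ n + L)) i && decide (i ≠ n)) := by
    intro i
    refine (Nat.testBit_land ..).trans ?_
    rw [Nat.testBit_two_pow_mul_add _ hB, Nat.testBit_two_pow_mul_add _ (hA.trans h2)]
    split_ifs with hi
    · have a1 : (2 ^ n + L).testBit i = if i < n then L.testBit i else Nat.testBit 1 (i - n) := by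
        have := Nat.testBit_two_pow_mul_add 1 hLn i
        rwa [mul_one] at this
      by_cases h3 : i = n
      · subst h3
        rw [Nat.testBit_lt_two_pow hA]; simp
      · have hin : i < n := by omega
        rw [a1, if_pos hin]
        by_cases h64 : i < 64
        · have a2 : (2 ^ n - 2 ^ 64 + L).testBit i = L.testBit i := by
            rw [h1, show 2 ^ 64 * 2 ^ t - 2 ^ 64 + L = 2 ^ 64 * (2 ^ t - 1) + L by rw [Nat.mul_sub, mul_one]]
            rw [Nat.testBit_two_pow_mul_add _ hL, if_pos h64]
          rw [a2]; simp [h3]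
        · rw [Nat.testBit_lt_two_pow (hL.trans_le (Nat.pow_le_pow_right (by norm_num) (by omega)))]; simp
    · have : i ≠ n := by omega
      simp [this]
  rw [hs]
  constructor
  · apply Nat.eq_of_testBit_eq
    intro i
    refine (Nat.testBit_xor ..).trans ?_
    rw [key, Nat.testBit_two_pow]
    by_cases h3 : i = n
    · subst h3; rw [tb, ← hn] at ht; simp [ht]
    · simp [h3, Ne.symm h3]
  · intro y
    have k := key (64 + y)
    have e : decide (64 + y ≠ n) = decide (y ≠ t) := decide_eq_decide.2 (by omega)
    rw [e] at k
    unfold tb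
    exact k

def lgr (l : List ℕ) : ℕ → ℕ → ℕ := List.rec (motive := fun _ => ℕ → ℕ → ℕ) (fun _ a => a)
  (fun k _ ih b a => sel (Nat.ble (Nat.shiftLeft 1 k) b)
     (force (Nat.shiftRight b k) fun b => force (Nat.add a k) fun a => ih b a) (ih b a)) l
def LP (l : List ℕ) (K : ℕ) : Prop := ∀ b t a : ℕ, b = 2 ^ t → t < K → lgr l b a = a + t

theorem lp_step {l : List ℕ} {k : ℕ} (K : ℕ) (ih : LP l k) (hK : K = 2 * k) : LP (k :: l) K := by
  intro b t a hb ht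
  show sel (Nat.ble (Nat.shiftLeft 1 k) b) (force (Nat.shiftRight b k) fun b => force (Nat.add a k) fun a => lgr l b a) (lgr l b a) = _
  have e1 : Nat.shiftLeft 1 k = 2 ^ k := by
    show 1 <<< k = _
    rw [Nat.shiftLeft_eq, one_mul]
  rw [sel_eq, e1]
  have : (Nat.ble (2 ^ k) b = true) ↔ k ≤ t := by
    rw [Nat.ble_eq, hb]; exact Nat.pow_le_pow_iff_right (by norm_num)
  split_ifs with hc
  · rw [force_eq, force_eq]
    have hc := this.1 hc
    rw [ih (Nat.shiftRight b k) (t - k) (Nat.add a k) ?_ (by omega)]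
    · show a + k + (t - k) = a + t
      omega
    · show b >>> k = _
      rw [hb, Nat.shiftRight_eq_div_pow, Nat.pow_div hc (by norm_num)]
  · exact ih b t a hb (by by_contra h; exact hc (this.2 (by omega)))

theorem lp_all : LP lgs 8192 := by
  have h : LP [] 1 := fun b t a _ ht => by show a = a + t; omega
  exact lp_step 8192 (lp_step 4096 (lp_step 2048 (lp_step 1024 (lp_step 512 (lp_step 256 (lp_step 128 (lp_step 64
    (lp_step 32 (lp_step 16 (lp_step 8 (lp_step 4 (lp_step 2 h rfl) rfl) rfl) rfl) rfl) rfl) rfl) rfl) rfl) rfl) rfl) rfl) rfl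

theorem lg_eq {t : ℕ} (ht : t < 8192) : lg (2 ^ (64 + t)) = t := by
  have h := lp_all (Nat.shiftRight (2 ^ (64 + t)) 64) t 0 (by
    show (2 ^ (64 + t)) >>> 64 = _
    rw [Nat.shiftRight_eq_div_pow, Nat.pow_div (by omega) (by norm_num)]; congr 1; omega) ht
  rw [zero_add] at h
  exact h

theorem bloop_sound {β : Type} (f : ℕ → List β) {x : ℕ} (hx : x < 8000) {r : β} (hr : r ∈ f x) :
    ∀ fuel m t, (∀ y < t, tb m y = false) → tb m x = true → 8000 ≤ fuel + t → r ∈ bloop f fuel m := by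
  intro fuel
  induction fuel with
  | zero => intro m t h0 hm hf; rw [h0 x (by omega)] at hm; simp at hm
  | succ n ih =>
    intro m t h0 hm hf
    have e : bloop f (n + 1) m = force m fun m => sel (nz m) (
      force (Nat.land m (Nat.sub m b64)) fun m1 =>
      force (Nat.xor m m1) fun b =>
      force (Nat.mod b 8191) fun r =>
      force (lg2 r b) fun w => app (f w) (bloop f n m1)) [] := rfl
    rw [e]
    simp only [force_eq, sel_eq, (nz_iff m).2 ⟨x, hm⟩, if_true, app_eq, lg2]
    obtain ⟨s, hs, hmin⟩ : ∃ s, tb m s = true ∧ ∀ y < s, tb m y = false := by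
      classical
      refine ⟨Nat.find ⟨x, hm⟩, Nat.find_spec (⟨x, hm⟩ : ∃ s, tb m s = true), fun y hy => ?_⟩
      simpa using Nat.find_min _ hy
    have hsx : s ≤ x := by
      by_contra hc
      rw [hmin x (by omega)] at hm; simp at hm
    have hts : t ≤ s := by
      by_contra hc
      rw [h0 s (by omega)] at hs; simp at hs
    obtain ⟨h1, h2⟩ := low_bit hmin hs
    rw [h1, lg_eq (by omega)]
    rw [List.mem_append]
    by_cases hsx' : s = x
    · left; rw [hsx']; exact hr
    · right
      apply ih _ (s + 1)
      · intro y hy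
        rw [h2]
        by_cases hys : y = s
        · simp [hys]
        · rw [hmin y (by omega)]; rfl
      · rw [h2, hm]; simp [Ne.symm hsx']
      · omega

def Hit (p ch : ℕ) : Prop := ∃ x, tb p x = true ∧ tb ch x = true
theorem hit_iff (p ch : ℕ) : nz (Nat.land p ch) = true ↔ Hit p ch := by
  rw [nz_iff]
  exact exists_congr fun x => by rw [tb_land]; simp

theorem scan_spec (ch : ℕ) (pts : List ℕ) : ∃ pre, pts = pre ++ scan ch pts ∧ (∀ p ∈ pre, Hit p ch) ∧
    ∀ p t, scan ch pts = p :: t → ¬ Hit p ch := by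
  induction pts with
  | nil => exact ⟨[], rfl, by simp, by intro p t h; simp [scan] at h⟩
  | cons p t ih =>
    have e : scan ch (p :: t) = sel (nz (Nat.land p ch)) (scan ch t) (p :: t) := rfl
    rw [e, sel_eq]
    by_cases h : nz (Nat.land p ch) = true
    · rw [if_pos h]
      obtain ⟨pre, h1, h2, h3⟩ := ih
      exact ⟨p :: pre, by rw [List.cons_append, ← h1], by
        intro q hq
        rcases List.mem_cons.1 hq with rfl | hq
        · exact (hit_iff _ _).1 h
        · exact h2 q hq, h3⟩
    · rw [if_neg h]
      exact ⟨[], rfl, by simp, by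
        intro q s hq
        simp only [List.cons.injEq] at hq
        rw [← hq.1, ← hit_iff]; exact h⟩

theorem lastc_spec (ch : ℕ) (pts : List ℕ) {x : ℕ} (h : ∀ p ∈ pts, Hit p ch ∨ tb p x = true) :
    ∀ c, tb c x = true → tb (lastc ch pts c) x = true := by
  induction pts with
  | nil => intro c hc; exact hc
  | cons p t ih =>
    intro c hc
    have e : lastc ch (p :: t) c = force c fun c => sel (nz c) (sel (nz (Nat.land p ch)) (lastc ch t c) (lastc ch t (Nat.land c p))) 0 := rfl
    rw [e, force_eq, sel_eq, if_pos ((nz_iff c).2 ⟨x, hc⟩), sel_eq]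
    have ih := ih (fun q hq => h q (List.mem_cons_of_mem _ hq))
    split_ifs with hh
    · exact ih c hc
    · apply ih
      rcases h p List.mem_cons_self with h1 | h1
      · exact absurd ((hit_iff _ _).2 h1) hh
      · rw [tb_land, hc, h1]; rfl

theorem run_zero (cand ch : ℕ) (pts acc : List ℕ) : run 0 cand ch pts acc =
      List.rec [acc] (fun p t _ => bloop (fun w => [w :: acc]) 8000 (lastc ch (p :: t) cand)) (scan ch pts) := rfl
theorem run_succ (k cand ch : ℕ) (pts acc : List ℕ) : run (k + 1) cand ch pts acc =
      List.rec [acc] (fun p t _ => bloop (fun w =>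
          force (Nat.xor (Nat.land cand (gm w)) (slt w)) fun c =>
          force (Nat.xor (Nat.lor ch (b1 w)) (slt w)) fun ch' => run k c ch' t (w :: acc)) 8000 (Nat.land cand p))
        (scan ch pts) := rfl

theorem run_sound (k : ℕ) : ∀ (cand ch : ℕ) (pts acc : List ℕ) (X : Finset ℕ),
    (∀ x ∈ X, x < 7776 ∧ tb cand x = true) →
    (∀ x ∈ X, ∀ y ∈ X, x ≠ y → tb (gm x) y = true) → X.card ≤ k + 1 →
    (∀ p ∈ pts, Hit p ch ∨ ∃ x ∈ X, tb p x = true) →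
    ∃ Y : List ℕ, Y ++ acc ∈ run k cand ch pts acc ∧ (∀ y ∈ Y, y ∈ X) ∧
      ∀ p ∈ pts, Hit p ch ∨ ∃ y ∈ Y, tb p y = true := by
  induction k with
  | zero =>
    intro cand ch pts acc X hX hg hk hp
    rw [run_zero]
    obtain ⟨pre, h1, h2, h3⟩ := scan_spec ch pts
    rcases e : scan ch pts with _ | ⟨p, t⟩
    · refine ⟨[], by simp, by simp, fun p hpp => Or.inl (h2 p ?_)⟩
      rw [e, List.append_nil] at h1; rwa [← h1]
    · have hps : ∀ q ∈ p :: t, q ∈ pts := fun q hq => by rw [h1, e]; exact List.mem_append_right _ hq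
      obtain ⟨x, hx, hpx⟩ := (hp p (hps p List.mem_cons_self)).resolve_left (h3 p t e)
      have hX1 : ∀ y ∈ X, y = x := fun y hy => Finset.card_le_one.1 (by omega) y hy x hx
      refine ⟨[x], ?_, by simpa using hx, ?_⟩
      · apply bloop_sound (x := x) _ (by have := (hX x hx).1; omega) (by simp) 8000 _ 0 (by simp) _ (by omega)
        apply lastc_spec _ _ _ _ (hX x hx).2
        intro q hq
        rcases hp q (hps q hq) with h | ⟨y, hy, h⟩
        · exact Or.inl h
        · right; rwa [hX1 y hy] at h
      · intro q hq
        rcases hp q hq with h | ⟨y, hy, h⟩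
        · exact Or.inl h
        · right; exact ⟨x, by simp, by rwa [hX1 y hy] at h⟩
  | succ k ih =>
    intro cand ch pts acc X hX hg hk hp
    rw [run_succ]
    obtain ⟨pre, h1, h2, h3⟩ := scan_spec ch pts
    rcases e : scan ch pts with _ | ⟨p, t⟩
    · refine ⟨[], by simp, by simp, fun p hpp => Or.inl (h2 p ?_)⟩
      rw [e, List.append_nil] at h1; rwa [← h1]
    · have hps : ∀ q ∈ p :: t, q ∈ pts := fun q hq => by rw [h1, e]; exact List.mem_append_right _ hq
      obtain ⟨x, hx, hpx⟩ := (hp p (hps p List.mem_cons_self)).resolve_left (h3 p t e)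
      have hx7 := (hX x hx).1
      have hch : ∀ y, tb (Nat.xor (Nat.lor ch (b1 x)) (slt x)) y = true ↔ tb ch y = true ∨ y = x := by
        intro y; rw [tb_xor, tb_lor, tb_slt hx7, tb_b1]; simp
      obtain ⟨Y, hY1, hY2, hY3⟩ := ih (Nat.xor (Nat.land cand (gm x)) (slt x)) (Nat.xor (Nat.lor ch (b1 x)) (slt x))
        t (x :: acc) (X.erase x) (by
          intro y hy
          rw [Finset.mem_erase] at hy
          refine ⟨(hX y hy.2).1, ?_⟩
          rw [tb_xor, tb_land, tb_slt hx7, (hX y hy.2).2, hg x hx y hy.2 (Ne.symm hy.1)]; rfl)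
        (fun a ha b hb hab => hg a (Finset.mem_of_mem_erase ha) b (Finset.mem_of_mem_erase hb) hab)
        (by rw [Finset.card_erase_of_mem hx]; omega)
        (by
          intro q hq
          rcases hp q (hps q (List.mem_cons_of_mem _ hq)) with ⟨y, ha, hb⟩ | ⟨y, hy, h⟩
          · exact Or.inl ⟨y, ha, (hch y).2 (Or.inl hb)⟩
          · by_cases hyx : y = x
            · exact Or.inl ⟨y, h, (hch y).2 (Or.inr hyx)⟩
            · exact Or.inr ⟨y, Finset.mem_erase.2 ⟨hyx, hy⟩, h⟩)
      refine ⟨Y ++ [x], ?_, ?_, ?_⟩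
      · apply bloop_sound (x := x) _ (by omega) _ 8000 _ 0 (by simp) _ (by omega)
        · rw [force_eq, force_eq]; simpa using hY1
        · rw [tb_land, (hX x hx).2, hpx]; rfl
      · intro y hy
        rcases List.mem_append.1 hy with hy | hy
        · exact Finset.mem_of_mem_erase (hY2 y hy)
        · rw [List.mem_singleton.1 hy]; exact hx
      · intro q hq
        rw [h1, e] at hq
        rcases List.mem_append.1 hq with hq | hq
        · exact Or.inl (h2 q hq)
        · rcases List.mem_cons.1 hq with rfl | hq
          · exact Or.inr ⟨x, by simp, hpx⟩
          · rcases hY3 q hq with ⟨y, ha, hb⟩ | ⟨y, hy, h⟩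
            · rcases (hch y).1 hb with hb | rfl
              · exact Or.inl ⟨y, ha, hb⟩
              · exact Or.inr ⟨y, by simp, ha⟩
            · exact Or.inr ⟨y, by simp [hy], h⟩

end Cov
set_option exponentiation.threshold 10000
namespace Cov

theorem tb_six {b s : ℕ} (hb : b < 2 ^ s) (y : ℕ) :
    Nat.testBit (six b s) y = (decide (y < 6 * s) && Nat.testBit b (y % s)) := by
  have e : six b s = b ||| (b <<< s ||| (b <<< (2 * s) ||| (b <<< (3 * s) ||| (b <<< (4 * s) ||| b <<< (5 * s))))) := rfl
  rw [e]
  simp only [Nat.testBit_or, Nat.testBit_shiftLeft]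
  have hbig : ∀ z, s ≤ z → b.testBit z = false := fun z hz =>
    Nat.testBit_lt_two_pow (hb.trans_le (Nat.pow_le_pow_right (by norm_num) hz))
  rcases Nat.eq_zero_or_pos s with rfl | hs
  · have : b = 0 := by simpa using hb
    subst this; simp
  have hr : y % s < s := Nat.mod_lt _ hs
  have hy := Nat.div_add_mod y s
  generalize y / s = k at hy
  generalize y % s = r at hy hr ⊢
  by_cases hk : k < 6
  · have h6 : y < 6 * s := by
      have : s * k ≤ s * 5 := Nat.mul_le_mul_left _ (by omega)
      omega
    have key : ∀ j, (decide (j * s ≤ y) && b.testBit (y - j * s)) = (decide (j = k) && b.testBit r) := by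
      intro j
      rcases lt_trichotomy j k with h | h | h
      · have : s * (j + 1) ≤ s * k := Nat.mul_le_mul_left _ h
        have e2 : s * (j + 1) = j * s + s := by ring
        rw [hbig (y - j * s) (by omega)]
        simp [h.ne]
      · subst h
        have : s * j = j * s := mul_comm _ _
        rw [show y - j * s = r by omega]
        simp; intro; omega
      · have : s * (k + 1) ≤ s * j := Nat.mul_le_mul_left _ h
        have e2 : s * (k + 1) = s * k + s := by ring
        have e3 : s * j = j * s := mul_comm _ _
        have : ¬ j * s ≤ y := by omega
        simp [this, h.ne']
    have k0 := key 0
    have k1 := key 1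
    simp only [zero_mul, Nat.sub_zero, one_mul] at k0 k1
    have z : (decide (0 ≤ y)) = true := by simp
    rw [z, Bool.true_and] at k0
    simp only [ge_iff_le, k0, k1, key, h6, decide_true, Bool.true_and]
    interval_cases k <;> simp
  · have h6 : ¬ y < 6 * s := by
      have : s * 6 ≤ s * k := Nat.mul_le_mul_left _ (by omega)
      omega
    rw [hbig y (by omega), hbig (y - s) (by omega), hbig (y - 2 * s) (by omega), hbig (y - 3 * s) (by omega),
      hbig (y - 4 * s) (by omega), hbig (y - 5 * s) (by omega)]
    simp [h6]

theorem six_lt {b s : ℕ} (hb : b < 2 ^ s) : six b s < 2 ^ (6 * s) := by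
  apply Nat.lt_pow_two_of_testBit
  intro i hi
  rw [tb_six hb]; simp; omega

theorem tb_m1 (n y : ℕ) : Nat.testBit (Nat.sub (Nat.pow 2 n) 1) y = decide (y < n) := Nat.testBit_two_pow_sub_one n y

theorem m1_lt (n : ℕ) : Nat.sub (Nat.pow 2 n) 1 < 2 ^ n := by
  show 2 ^ n - 1 < 2 ^ n
  have : 0 < 2 ^ n := by positivity
  omega

theorem tb_bs {p : ℕ} (hp : p ∈ ps) (y : ℕ) : Nat.testBit (bs p) y = (decide (y < 7776) && decide (y % (6 * p) < p)) := by
  simp only [ps, List.mem_cons, List.not_mem_nil, or_false] at hp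
  rcases hp with rfl | rfl | rfl | rfl | rfl
  · have h : bs 1 = six (six (six (six (Nat.sub (Nat.pow 2 1) 1) 6) 36) 216) 1296 := rfl
    have h1 : Nat.sub (Nat.pow 2 1) 1 < 2 ^ 6 := by decide
    rw [h, tb_six (six_lt (six_lt (six_lt h1))), tb_six (six_lt (six_lt h1)), tb_six (six_lt h1), tb_six h1, tb_m1, Bool.eq_iff_iff]
    simp only [Bool.and_eq_true, decide_eq_true_eq]
    try omega
  · have h : bs 6 = six (six (six (Nat.sub (Nat.pow 2 6) 1) 36) 216) 1296 := rfl
    have h1 : Nat.sub (Nat.pow 2 6) 1 < 2 ^ 36 := by norm_num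
    rw [h, tb_six (six_lt (six_lt h1)), tb_six (six_lt h1), tb_six h1, tb_m1, Bool.eq_iff_iff]
    simp only [Bool.and_eq_true, decide_eq_true_eq]
    try omega
  · have h : bs 36 = six (six (Nat.sub (Nat.pow 2 36) 1) 216) 1296 := rfl
    have h1 : Nat.sub (Nat.pow 2 36) 1 < 2 ^ 216 := by norm_num
    rw [h, tb_six (six_lt h1), tb_six h1, tb_m1, Bool.eq_iff_iff]
    simp only [Bool.and_eq_true, decide_eq_true_eq]
    try omega
  · have h : bs 216 = six (Nat.sub (Nat.pow 2 216) 1) 1296 := rfl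
    have h1 : Nat.sub (Nat.pow 2 216) 1 < 2 ^ 1296 :=
      (m1_lt 216).trans (Nat.pow_lt_pow_right (by norm_num) (by norm_num))
    rw [h, tb_six h1, tb_m1]
  · have h : bs 1296 = Nat.sub (Nat.pow 2 1296) 1 := rfl
    rw [h, tb_m1, Bool.eq_iff_iff]
    simp only [Bool.and_eq_true, decide_eq_true_eq]
    try omega

theorem dg_eq (p x : ℕ) : dg p x = x / p % 6 := rfl

theorem tb_lit {p l x : ℕ} (hp : p ∈ ps) (hl : l < 6) (hx : x < 7776) : tb (lit p l) x = decide (dg p x = l) := by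
  have e : tb (lit p l) x = Nat.testBit (bs p <<< (64 + l * p)) (64 + x) := rfl
  rw [e, Nat.testBit_shiftLeft, tb_bs hp, Bool.eq_iff_iff, dg_eq]
  simp only [Bool.and_eq_true, decide_eq_true_eq, ge_iff_le]
  simp only [ps, List.mem_cons, List.not_mem_nil, or_false] at hp
  rcases hp with rfl | rfl | rfl | rfl | rfl <;> omega

def pl : Fin 5 → ℕ := ![1, 6, 36, 216, 1296]
theorem pl_mem (j : Fin 5) : pl j ∈ ps := by revert j; decide
theorem mem_ps {p : ℕ} (h : p ∈ ps) : ∃ j, p = pl j := by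
  simp only [ps, List.mem_cons, List.not_mem_nil, or_false] at h
  rcases h with rfl | rfl | rfl | rfl | rfl
  exacts [⟨0, rfl⟩, ⟨1, rfl⟩, ⟨2, rfl⟩, ⟨3, rfl⟩, ⟨4, rfl⟩]

def enc (w : W 5) : ℕ := (w 0).val + 6 * (w 1).val + 36 * (w 2).val + 216 * (w 3).val + 1296 * (w 4).val
def dec (x : ℕ) : W 5 := fun j => ⟨dg (pl j) x, Nat.mod_lt _ (by norm_num)⟩

theorem enc_lt (w : W 5) : enc w < 7776 := by
  have := (w 0).isLt; have := (w 1).isLt; have := (w 2).isLt; have := (w 3).isLt; have := (w 4).isLt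
  unfold enc; omega
theorem dg_enc (w : W 5) (j : Fin 5) : dg (pl j) (enc w) = (w j).val := by
  have := (w 0).isLt; have := (w 1).isLt; have := (w 2).isLt; have := (w 3).isLt; have := (w 4).isLt
  rw [dg_eq]; unfold enc
  fin_cases j <;> simp [pl] <;> omega
theorem dec_enc (w : W 5) : dec (enc w) = w := by
  funext j; apply Fin.ext; exact dg_enc w j
theorem enc_dec {x : ℕ} (h : x < 7776) : enc (dec x) = x := by
  simp only [enc, dec, dg_eq, pl]
  simp
  omega
theorem enc_inj {v w : W 5} (h : enc v = enc w) : v = w := by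
  rw [← dec_enc v, h, dec_enc]
theorem enc_inj' : Function.Injective enc := fun _ _ h => enc_inj h

theorem compl_val : ∀ l : Fin 6, (compl6 l).val = Nat.xor l.val 1 := by decide
theorem xor_lt : ∀ l < 6, Nat.xor l 1 < 6 := by decide

theorem tb_lit_enc {j : Fin 5} {l : ℕ} (hl : l < 6) (w : W 5) : tb (lit (pl j) l) (enc w) = decide ((w j).val = l) := by
  rw [tb_lit (pl_mem j) hl (enc_lt w), dg_enc]

theorem tb_fold_lor (f : ℕ → ℕ) (xs : List ℕ) (y : ℕ) :
    tb (fold (fun p c => Nat.lor c (f p)) 0 xs) y = true ↔ ∃ p ∈ xs, tb (f p) y = true := by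
  induction xs with
  | nil => simp [fold_nil, tb_zero]
  | cons x t ih => rw [fold_cons, tb_lor, Bool.or_eq_true, ih]; simp [or_comm]

theorem tb_fold_land (f : ℕ → ℕ) (c0 : ℕ) (xs : List ℕ) (y : ℕ) :
    tb (fold (fun p c => Nat.land c (f p)) c0 xs) y = true ↔ tb c0 y = true ∧ ∀ p ∈ xs, tb (f p) y = true := by
  induction xs with
  | nil => simp [fold_nil]
  | cons x t ih => rw [fold_cons, tb_land, Bool.and_eq_true, ih]; simp; tauto

theorem tb_dm (w x : W 5) : tb (dm (enc w)) (enc x) = true ↔ Dich w x := by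
  unfold dm
  rw [tb_fold_lor (fun p => lit p (Nat.xor (dg p (enc w)) 1))]
  constructor
  · rintro ⟨p, hp, h⟩
    obtain ⟨j, rfl⟩ := mem_ps hp
    rw [dg_enc, tb_lit_enc (xor_lt _ (w j).isLt)] at h
    exact ⟨j, Fin.ext (by rw [compl_val]; simpa using h)⟩
  · rintro ⟨j, h⟩
    refine ⟨pl j, pl_mem j, ?_⟩
    rw [dg_enc, tb_lit_enc (xor_lt _ (w j).isLt), ← compl_val, h]; simp

theorem tw_enc (w : W 5) (j : Fin 5) : tw (pl j) (enc w) = enc (Function.update w j (compl6 (w j))) := by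
  have e : tw (pl j) (enc w) = if (w j).val % 2 = 0 then enc w + pl j else enc w - pl j := by
    unfold tw; rw [sel_eq, dg_enc]
    have : (((w j).val.mod 2).beq 0 = true) ↔ (w j).val % 2 = 0 := by
      rw [Nat.beq_eq]; rfl
    simp only [this]; rfl
  have hc : (compl6 (w j)).val = if (w j).val % 2 = 0 then (w j).val + 1 else (w j).val - 1 := by
    generalize w j = l; revert l; decide
  rw [e]
  have h2 : ∀ i, (Function.update w j (compl6 (w j)) i).val = if i = j then (compl6 (w j)).val else (w i).val := by
    intro i; by_cases h : i = j
    · subst h; simp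
    · simp [h]
  simp only [enc, h2, hc]
  fin_cases j <;> simp [pl] <;> split_ifs <;> omega

theorem tb_tm (w x : W 5) : tb (tm (enc w)) (enc x) = true ↔ Twin w x := by
  unfold tm
  rw [tb_fold_lor (fun p => b1 (tw p (enc w)))]
  constructor
  · rintro ⟨p, hp, h⟩
    obtain ⟨j, rfl⟩ := mem_ps hp
    rw [tw_enc, tb_b1] at h
    have := enc_inj (of_decide_eq_true h)
    exact ⟨j, by simp [this], fun i hi => by simp [this, hi]⟩
  · rintro ⟨j, h, h'⟩
    refine ⟨pl j, pl_mem j, ?_⟩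
    rw [tw_enc, tb_b1, decide_eq_true_eq]
    congr 1
    funext i
    by_cases hi : i = j
    · subst hi; simp [h]
    · simp [hi, h' i hi]

def Gd (w x : W 5) : Prop := Dich w x ∧ ¬ Twin w x

theorem tb_gm (w x : W 5) : tb (gm (enc w)) (enc x) = true ↔ Gd w x := by
  unfold gm
  rw [tb_lor, tb_ones, tb_xor, Bool.false_or]
  have h1 := tb_dm w x
  have h2 := tb_tm w x
  have h3 : Twin w x → Dich w x := fun ⟨j, h, _⟩ => ⟨j, h⟩
  unfold Gd
  rw [← h1, ← h2] at *
  revert h3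
  cases tb (dm (enc w)) (enc x) <;> cases tb (tm (enc w)) (enc x) <;> simp

theorem tb_top {x : ℕ} (hx : x < 7776) : tb top x = true := by
  unfold tb top
  rw [tb_m1]; simp; omega

theorem m1_sub (n s : ℕ) : Nat.sub (Nat.sub (Nat.pow 2 n) 1) s = 2 ^ n - (s + 1) := by
  show 2 ^ n - 1 - s = _
  omega

theorem tb_topsub {x s : ℕ} (hx : x < 7776) (hs : s < 2 ^ 64) : tb (Nat.sub top s) x = true := by
  have : tb (Nat.sub top s) x = Nat.testBit (2 ^ 7840 - (s + 1)) (64 + x) := by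
    unfold tb top; rw [m1_sub]
  rw [this, Nat.testBit_two_pow_sub_succ]
  · have h := tb_small hs x
    rw [tb] at h
    rw [h]; simp; omega
  · exact hs.trans (Nat.pow_lt_pow_right (by norm_num) (by norm_num))

theorem tb_topsub' {x m : ℕ} (hx : x < 7776) (hm : m < 2 ^ 7840) : tb (Nat.sub top m) x = !tb m x := by
  have : tb (Nat.sub top m) x = Nat.testBit (2 ^ 7840 - (m + 1)) (64 + x) := by
    unfold tb top; rw [m1_sub]
  rw [this, Nat.testBit_two_pow_sub_succ hm]
  have : 64 + x < 7840 := by omega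
  simp [this, tb]

theorem half_spec {p v s x : ℕ} (hp : p ∈ ps) (hs : s < 2) (hx : x < 7776) :
    tb (half p s v) x = true ↔ dg p x = dg p v ∨ dg p x % 2 = s := by
  have hv : dg p v < 6 := Nat.mod_lt _ (by norm_num)
  have hx6 : dg p x < 6 := Nat.mod_lt _ (by norm_num)
  unfold half
  have a2 : Nat.add s 2 = s + 2 := rfl
  have a4 : Nat.add s 4 = s + 4 := rfl
  rw [tb_lor, tb_lor, tb_lor, tb_lor, tb_ones, tb_lit hp hv hx, tb_lit hp (by omega) hx, a2, a4, tb_lit hp (by omega) hx, tb_lit hp (by omega) hx]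
  simp only [Bool.false_or, Bool.or_eq_true, decide_eq_true_eq]
  omega

theorem split_eq (ms : List ℕ) (e o : ℕ) : split ms e o = ms.flatMap (fun m => [Nat.land m e, Nat.land m o]) := by
  induction ms with
  | nil => rfl
  | cons m t ih =>
    have : split (m :: t) e o = force (Nat.land m e) fun a => force (Nat.land m o) fun b => a :: b :: split t e o := rfl
    rw [this, force_eq, force_eq, ih]; rfl

def PtS (js : List ℕ) (v m : ℕ) (s : ℕ → Fin 2) : Prop :=
  ∀ x < 7776, tb m x = true ↔ ∀ p ∈ js, dg p x = dg p v ∨ dg p x % 2 = (s p).val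

theorem pts_step {js : List ℕ} {v m p : ℕ} {s : ℕ → Fin 2} (hp : p ∈ ps) (hj : p ∉ js) (h : PtS js v m s) (e : Fin 2) :
    PtS (p :: js) v (Nat.land m (half p e.val v)) (Function.update s p e) := by
  intro x hx
  rw [tb_land, Bool.and_eq_true, h x hx, half_spec hp e.isLt hx, List.forall_mem_cons, and_comm]
  simp only [Function.update_self]
  refine and_congr Iff.rfl (forall_congr' fun q => forall_congr' fun hq => ?_)
  rw [Function.update_of_ne]
  rintro rfl; exact hj hq

theorem ptl_spec (js : List ℕ) {v : ℕ} (hv : v < 7776) (hs : ∀ p ∈ js, p ∈ ps) (hn : js.Nodup) :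
    (∀ m ∈ ptl js v, ∃ s, PtS js v m s) ∧ ∀ s, ∃ m ∈ ptl js v, PtS js v m s := by
  induction js with
  | nil =>
    have e : ptl [] v = [Nat.sub top (slt v)] := rfl
    have k : ∀ s, PtS [] v (Nat.sub top (slt v)) s := fun s x hx => by
      rw [tb_topsub hx (slt_lt hv)]; simp
    rw [e]
    exact ⟨fun m hm => ⟨fun _ => 0, by rw [List.mem_singleton.1 hm]; exact k _⟩, fun s => ⟨_, by simp, k s⟩⟩
  | cons p js ih =>
    have e : ptl (p :: js) v = split (ptl js v) (half p 0 v) (half p 1 v) := rfl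
    obtain ⟨h1, h2⟩ := ih (fun q hq => hs q (List.mem_cons_of_mem _ hq)) hn.of_cons
    have hp := hs p List.mem_cons_self
    have hj := (List.nodup_cons.1 hn).1
    rw [e, split_eq]
    constructor
    · intro m hm
      obtain ⟨m', hm', h⟩ := List.mem_flatMap.1 hm
      obtain ⟨s, hs'⟩ := h1 m' hm'
      simp only [List.mem_cons, List.not_mem_nil, or_false] at h
      rcases h with rfl | rfl
      · exact ⟨_, pts_step hp hj hs' 0⟩
      · exact ⟨_, pts_step hp hj hs' 1⟩
    · intro s
      obtain ⟨m, hm, h⟩ := h2 s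
      have h3 := pts_step hp hj h (s p)
      rw [Function.update_eq_self] at h3
      refine ⟨_, List.mem_flatMap.2 ⟨m, hm, ?_⟩, h3⟩
      generalize s p = e; revert e
      intro e; fin_cases e <;> simp

theorem diag_key : ∀ (s : Fin 2) (v l : Fin 6), l ≠ compl6 v →
    sat (setq (fun _ => decide (s = 0)) v) l = true → l = v ∨ l.val % 2 = s.val := by decide
theorem par_key : ∀ (v q r : Fin 6) , r ≠ compl6 v → r = compl6 q → (q = v ∨ q.val % 2 = r.val % 2) → False := by decide

theorem pts_hit {js : List ℕ} (hs : ∀ p ∈ js, p ∈ ps) (hn : js.Nodup) {v : W 5} {F : Finset (W 5)} (h : IsCov v F)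
    {m : ℕ} (hm : m ∈ ptl js (enc v)) : ∃ Q ∈ F, tb m (enc Q) = true := by
  obtain ⟨s, hs'⟩ := (ptl_spec js (enc_lt v) hs hn).1 m hm
  obtain ⟨Q, hQ, hin⟩ := h.cov (fun j => setq (fun _ => decide (s (pl j) = 0)) (v j)) (fun j => sat_set _ _)
  refine ⟨Q, hQ, (hs' _ (enc_lt Q)).2 fun p hp => ?_⟩
  obtain ⟨j, rfl⟩ := mem_ps (hs p hp)
  rw [dg_enc, dg_enc]
  rcases diag_key _ _ _ (h.nd Q hQ j) (hin j) with h | h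
  · left; rw [h]
  · right; exact h

theorem pts_uniq {js : List ℕ} (hs : ∀ p ∈ js, p ∈ ps) (hn : js.Nodup) (hj : ∀ p ∈ ps, p ∈ js) {v R : W 5} (h : Nd v R) :
    ∃ m ∈ ptl js (enc v), ∀ Q, tb m (enc Q) = true → ¬ Dich Q R := by
  obtain ⟨m, hm, h'⟩ := (ptl_spec js (enc_lt v) hs hn).2 (fun p => ⟨dg p (enc R) % 2, Nat.mod_lt _ (by norm_num)⟩)
  refine ⟨m, hm, fun Q hQ ⟨j, hj'⟩ => ?_⟩
  have := (h' _ (enc_lt Q)).1 hQ (pl j) (hj _ (pl_mem j))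
  simp only [dg_enc] at this
  exact par_key (v j) (Q j) (R j) (h j) hj' (this.imp Fin.ext id)

theorem tb_orb (xs : List ℕ) (y : ℕ) : tb (orb xs) y = true ↔ y ∈ xs := by
  unfold orb
  rw [tb_fold_lor (fun x => b1 x)]
  simp [tb_b1]

theorem orb_mem_iff {xs ys : List ℕ} (h : orb xs = orb ys) (y : ℕ) : y ∈ xs ↔ y ∈ ys := by
  rw [← tb_orb, h, tb_orb]

/-- complete extension: the covers `F` of `v` containing the words in `L` are found by `run` -/
theorem run_full {js : List ℕ} (hs : ∀ p ∈ js, p ∈ ps) (hn : js.Nodup) (hj : ∀ p ∈ ps, p ∈ js)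
    {v : W 5} {F X : Finset (W 5)} {L : List ℕ} (h : IsCov v F) (tf : TF F) (hX : X ⊆ F)
    (hL : ∀ Q, Q ∈ F ↔ enc Q ∈ L ∨ Q ∈ X) {k cand ch : ℕ} (hk : X.card ≤ k + 1)
    (hc : ∀ Q ∈ X, tb cand (enc Q) = true) (hch : ∀ Q, tb ch (enc Q) = true ↔ enc Q ∈ L)
    (hch' : ∀ x, tb ch x = true → x ∈ L) (hL7 : ∀ x ∈ L, x < 7776) (acc : List ℕ) :
    ∃ Y, Y ++ acc ∈ run k cand ch (ptl js (enc v)) acc ∧ (∀ y ∈ Y, y < 7776) ∧ (∀ Q ∈ X, enc Q ∈ Y ∨ enc Q ∈ L) ∧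
      (∀ Q, enc Q ∈ Y → Q ∈ X) := by
  obtain ⟨Y, h1, h2, h3⟩ := run_sound k cand ch (ptl js (enc v)) acc (X.image enc) (by
      intro x hx
      obtain ⟨Q, hQ, rfl⟩ := Finset.mem_image.1 hx
      exact ⟨enc_lt Q, hc Q hQ⟩) (by
      intro x hx y hy hxy
      obtain ⟨P, hP, rfl⟩ := Finset.mem_image.1 hx
      obtain ⟨Q, hQ, rfl⟩ := Finset.mem_image.1 hy
      exact (tb_gm P Q).2 ⟨h.dich P (hX hP) Q (hX hQ) (fun e => hxy (by rw [e])), tf P (hX hP) Q (hX hQ)⟩)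
    (Finset.card_image_le.trans hk) (by
      intro m hm
      obtain ⟨Q, hQ, hq⟩ := pts_hit hs hn h hm
      rcases (hL Q).1 hQ with h | h
      · exact Or.inl ⟨_, hq, (hch Q).2 h⟩
      · exact Or.inr ⟨_, Finset.mem_image_of_mem _ h, hq⟩)
  refine ⟨Y, h1, ?_, ?_, ?_⟩
  · intro y hy
    obtain ⟨Q, hQ, rfl⟩ := Finset.mem_image.1 (h2 y hy)
    exact enc_lt Q
  · intro R hR
    obtain ⟨m, hm, hu⟩ := pts_uniq hs hn hj (h.nd R (hX hR))
    have : ∃ Q ∈ F, tb m (enc Q) = true ∧ (enc Q ∈ Y ∨ enc Q ∈ L) := by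
      rcases h3 m hm with ⟨x, hx, hx'⟩ | ⟨y, hy, hy'⟩
      · have hxL := hch' x hx'
        have e := enc_dec (hL7 x hxL)
        rw [← e] at hx hxL
        exact ⟨dec x, (hL _).2 (Or.inl hxL), hx, Or.inr hxL⟩
      · obtain ⟨Q, hQ, rfl⟩ := Finset.mem_image.1 (h2 y hy)
        exact ⟨Q, hX hQ, hy', Or.inl hy⟩
    obtain ⟨Q, hQ, hm', ho⟩ := this
    by_cases e : Q = R
    · rw [← e]; exact ho
    · exact absurd (h.dich Q hQ R (hX hR) e) (hu Q hm')
  · intro Q hQ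
    obtain ⟨Q', hQ', e⟩ := Finset.mem_image.1 (h2 _ hQ)
    rwa [← enc_inj e]

end Cov
namespace Cov

def IsoF (f : W d → W d) : Prop := ∃ σ : Equiv.Perm (Fin d), ∃ h : Fin d → Fin 6 → Fin 6,
  (∀ i, Function.Bijective (h i)) ∧ (∀ i l, h i (compl6 l) = compl6 (h i l)) ∧ f = fun v i => h i (v (σ i))

theorem IsoF.comp {f g : W d → W d} (hf : IsoF f) (hg : IsoF g) : IsoF (fun v => f (g v)) := by
  obtain ⟨σ, h, h1, h2, rfl⟩ := hf
  obtain ⟨τ, k, k1, k2, rfl⟩ := hg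
  refine ⟨σ.trans τ, fun i l => h i (k (σ i) l), fun i => (h1 i).comp (k1 _), fun i l => by show h i (k _ _) = _; rw [k2, h2], ?_⟩
  funext v i; rfl

theorem IsoF.id : IsoF (fun v : W d => v) :=
  ⟨Equiv.refl _, fun _ l => l, fun _ => Function.bijective_id, fun _ _ => rfl, rfl⟩

theorem IsoF.inv {f : W d → W d} (hf : IsoF f) : ∃ g, IsoF g ∧ (∀ v, g (f v) = v) ∧ ∀ v, f (g v) = v := by
  obtain ⟨σ, h, h1, h2, rfl⟩ := hf
  let e : Fin d → Equiv.Perm (Fin 6) := fun i => Equiv.ofBijective (h i) (h1 i)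
  have he : ∀ i l, (e i).symm (h i l) = l := fun i l => (e i).symm_apply_apply l
  have he' : ∀ i l, h i ((e i).symm l) = l := fun i l => (e i).apply_symm_apply l
  refine ⟨fun v i => (e (σ.symm i)).symm (v (σ.symm i)), ⟨σ.symm, fun i => (e (σ.symm i)).symm, fun i => Equiv.bijective _, ?_, rfl⟩, ?_, ?_⟩
  · intro i l
    apply (h1 (σ.symm i)).1
    rw [he', h2, he']
  · intro v; funext i; simp [he]
  · intro v; funext i; simp [he']

theorem IsoF.inj {f : W d → W d} (hf : IsoF f) : Function.Injective f := by
  obtain ⟨g, _, h, _⟩ := hf.inv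
  intro a b hab
  rw [← h a, hab, h]

theorem IsoF.nd {f : W d → W d} (hf : IsoF f) {u v : W d} : Nd (f u) (f v) ↔ Nd u v := by
  obtain ⟨σ, h, h1, h2, rfl⟩ := hf
  constructor
  · intro H j e
    apply H (σ.symm j)
    simp only [Equiv.apply_symm_apply, e, h2]
  · intro H j e
    apply H (σ j)
    apply (h1 j).1
    rw [h2]; exact e

theorem IsoF.dich {f : W d → W d} (hf : IsoF f) {u v : W d} : Dich (f u) (f v) ↔ Dich u v := by
  have := hf.nd (u := u) (v := v)
  unfold Nd at this; unfold Dich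
  rw [← not_iff_not]; push Not; exact this

theorem IsoF.twin {f : W d → W d} (hf : IsoF f) {u v : W d} : Twin (f u) (f v) ↔ Twin u v := by
  obtain ⟨σ, h, h1, h2, rfl⟩ := hf
  constructor
  · rintro ⟨j, e, H⟩
    refine ⟨σ j, (h1 j).1 (by rw [h2]; exact e), fun i hi => ?_⟩
    have := H (σ.symm i) (fun h => hi (by rw [← h]; simp))
    simpa using (h1 _).1 this
  · rintro ⟨j, e, H⟩
    refine ⟨σ.symm j, by simp only [Equiv.apply_symm_apply, e, h2], fun i hi => ?_⟩
    have : σ i ≠ j := fun h => hi (by rw [← h]; simp)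
    show h i (u (σ i)) = h i (v (σ i))
    rw [H _ this]

theorem sat_tr (h : Fin 6 → Fin 6) (hc : ∀ l, h (compl6 l) = compl6 (h l)) (q : Fin 3 → Bool) (l : Fin 6) :
    sat (fun m => sat q (h (![0, 2, 4] m))) l = sat q (h l) := by
  have h0 := hc 0
  have h2 := hc 2
  have h4 := hc 4
  have e0 : compl6 0 = 1 := rfl
  have e2 : compl6 2 = 3 := rfl
  have e4 : compl6 4 = 5 := rfl
  have key : ∀ l, sat q (compl6 l) = !sat q l := by intro l; fin_cases l <;> simp [sat, compl6]
  rw [e0] at h0; rw [e2] at h2; rw [e4] at h4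
  have s0 := key (h 0)
  have s2 := key (h 2)
  have s4 := key (h 4)
  rw [← h0] at s0; rw [← h2] at s2; rw [← h4] at s4
  generalize sat q = z at *
  fin_cases l
  · rfl
  · exact s0.symm
  · rfl
  · exact s2.symm
  · rfl
  · exact s4.symm

theorem IsoF.cov {f : W d → W d} (hf : IsoF f) {u : W d} {F : Finset (W d)} (H : IsCov u F) : IsCov (f u) (F.image f) := by
  refine ⟨?_, ?_, ?_⟩
  · intro v hv w hw hvw
    obtain ⟨v, kv, rfl⟩ := Finset.mem_image.1 hv
    obtain ⟨w, kw, rfl⟩ := Finset.mem_image.1 hw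
    exact hf.dich.2 (H.dich v kv w kw (fun e => hvw (by rw [e])))
  · intro v hv
    obtain ⟨v, kv, rfl⟩ := Finset.mem_image.1 hv
    exact hf.nd.2 (H.nd v kv)
  · intro p hp
    obtain ⟨σ, h, h1, h2, rfl⟩ := hf
    have key : ∀ v : W d, In (fun k => fun m => sat (p (σ.symm k)) (h (σ.symm k) (![0, 2, 4] m))) v ↔
        In p (fun i => h i (v (σ i))) := by
      intro v
      unfold In
      simp only [sat_tr _ (h2 _)]
      constructor
      · intro H j; simpa using H (σ j)
      · intro H j; simpa using H (σ.symm j)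
    obtain ⟨v, hv, hin⟩ := H.cov _ ((key u).2 hp)
    exact ⟨_, Finset.mem_image_of_mem _ hv, (key v).1 hin⟩

theorem IsoF.tf {f : W d → W d} (hf : IsoF f) {F : Finset (W d)} (H : TF F) : TF (F.image f) := by
  intro v hv w hw
  obtain ⟨v, kv, rfl⟩ := Finset.mem_image.1 hv
  obtain ⟨w, kw, rfl⟩ := Finset.mem_image.1 hw
  rw [hf.twin]; exact H v kv w kw

theorem IsoF.not_mem {f : W d → W d} (hf : IsoF f) {u : W d} {F : Finset (W d)} (H : u ∉ F) : f u ∉ F.image f := by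
  rwa [Finset.mem_image, exists_congr (fun a => and_congr_right (fun _ => hf.inj.eq_iff)), exists_eq_right]

theorem IsoF.filter {f : W d → W d} (hf : IsoF f) (u : W d) (C : Finset (W d)) :
    (C.image f).filter (Nd (f u) ·) = (C.filter (Nd u ·)).image f := by
  ext v
  simp only [Finset.mem_filter, Finset.mem_image]
  constructor
  · rintro ⟨⟨w, hw, rfl⟩, h⟩; exact ⟨w, ⟨hw, hf.nd.1 h⟩, rfl⟩
  · rintro ⟨w, ⟨hw, h⟩, rfl⟩; exact ⟨⟨w, hw, rfl⟩, hf.nd.2 h⟩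

theorem isoF_lp (j : Fin d) (π : Fin 6 → Fin 6) (h1 : Function.Bijective π) (h2 : ∀ l, π (compl6 l) = compl6 (π l)) :
    IsoF (fun v : W d => Function.update v j (π (v j))) := by
  refine ⟨Equiv.refl _, fun i => if i = j then π else fun l => l, ?_, ?_, ?_⟩
  · intro i; beta_reduce; split_ifs
    · exact h1
    · exact Function.bijective_id
  · intro i l; beta_reduce; split_ifs
    · exact h2 l
    · rfl
  · funext v i
    by_cases hi : i = j
    · subst hi; simp
    · simp [hi]

theorem isoF_sw (i j : Fin d) : IsoF (fun v : W d => fun k => v (Equiv.swap i j k)) :=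
  ⟨Equiv.swap i j, fun _ l => l, fun _ => Function.bijective_id, fun _ _ => rfl, rfl⟩

/-! code level symmetries -/
noncomputable section
def rps : List ℕ := [1296, 216, 36, 6, 1]
def lpc (f : ℕ → ℕ) (p x : ℕ) : ℕ := Nat.add (Nat.sub x (Nat.mul (dg p x) p)) (Nat.mul (f (dg p x)) p)
def swc (p x : ℕ) : ℕ := Nat.sub (Nat.add x (Nat.mul (Nat.add (Nat.mul 6 (dg p x)) (dg (Nat.mul 6 p) x)) p))
  (Nat.mul (Nat.add (dg p x) (Nat.mul 6 (dg (Nat.mul 6 p) x))) p)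
def f01 (l : ℕ) : ℕ := sel (Nat.ble l 1) (Nat.xor l 1) l
def f45 (l : ℕ) : ℕ := sel (Nat.ble 4 l) (Nat.xor l 1) l
def f04 (l : ℕ) : ℕ := sel (Nat.beq (Nat.div l 2) 1) l (Nat.xor l 4)
def tr1 (g x : ℕ) : ℕ := sel (Nat.ble g 5) (lpc f01 (Nat.pow 6 (Nat.sub g 1)) x) (swc (Nat.pow 6 (Nat.sub g 6)) x)
def trs (h x : ℕ) : ℕ := (Nat.rec (motive := fun _ => ℕ → ℕ → ℕ) (fun _ x => x) (fun _ ih h x =>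
  sel (Nat.beq h 0) x (force (tr1 (Nat.mod h 10) x) fun y => ih (Nat.div h 10) y)) 40) h x
def b3g (js : List ℕ) : List ℕ := List.rec [0] (fun p _ ih => fmap (fun x => [x, Nat.add x p, Nat.add x (Nat.mul 2 p)]) ih) js
def wtc (x : ℕ) : ℕ := fold (fun p c => sel (Nat.beq (dg p x) 2) c (Nat.succ c)) 0 ps
def mp (f : ℕ → ℕ) (xs : List ℕ) : List ℕ := List.rec [] (fun x _ ih => f x :: ih) xs
def anyn (m : ℕ) (xs : List ℕ) : Bool := List.rec false (fun x _ ih => sel (Nat.beq m x) true ih) xs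
end

theorem mp_eq (f : ℕ → ℕ) (xs : List ℕ) : mp f xs = xs.map f := by
  induction xs with
  | nil => rfl
  | cons x t ih => exact congrArg (f x :: ·) ih
theorem anyn_iff (m : ℕ) (xs : List ℕ) : anyn m xs = true ↔ m ∈ xs := by
  induction xs with
  | nil => simp [anyn]
  | cons x t ih =>
    have e : anyn m (x :: t) = sel (Nat.beq m x) true (anyn m t) := rfl
    rw [e, sel_eq, List.mem_cons, ← ih]
    by_cases h : Nat.beq m x = true
    · simp [h]; left; simpa using h
    · rw [if_neg h]
      have : m ≠ x := fun e => h (by simp [e])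
      simp [this]

theorem enc_upd (w : W 5) (j : Fin 5) (l : Fin 6) : enc (Function.update w j l) = enc w - (w j).val * pl j + l.val * pl j := by
  have h2 : ∀ i, (Function.update w j l i).val = if i = j then l.val else (w i).val := by
    intro i; by_cases h : i = j
    · subst h; simp
    · simp [h]
  simp only [enc, h2]
  fin_cases j <;> simp [pl] <;> omega

theorem enc_lp (w : W 5) (j : Fin 5) (π : Fin 6 → Fin 6) (f : ℕ → ℕ) (hf : ∀ l, (π l).val = f l.val) :
    enc (Function.update w j (π (w j))) = lpc f (pl j) (enc w) := by
  rw [enc_upd, hf]; unfold lpc; rw [dg_enc]; rfl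

theorem enc_sw (w : W 5) (i j : Fin 5) (hij : j.val = i.val + 1) :
    enc (fun k => w (Equiv.swap i j k)) = swc (pl i) (enc w) := by
  have hp : Nat.mul 6 (pl i) = pl j := by revert i j; decide
  unfold swc
  rw [hp, dg_enc, dg_enc]
  show _ = enc w + (6 * (w i).val + (w j).val) * pl i - ((w i).val + 6 * (w j).val) * pl i
  have h2 : ∀ k, (w (Equiv.swap i j k)).val = if k = i then (w j).val else if k = j then (w i).val else (w k).val := by
    intro k; rw [Equiv.swap_apply_def]; split_ifs <;> rfl
  simp only [enc, h2]
  have := (w i).isLt; have := (w j).isLt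
  fin_cases i <;> fin_cases j <;> simp at hij <;> simp [pl] <;> omega

def p01 : Fin 6 → Fin 6 := ![1, 0, 2, 3, 4, 5]
def p45 : Fin 6 → Fin 6 := ![0, 1, 2, 3, 5, 4]
def p04 : Fin 6 → Fin 6 := ![4, 5, 2, 3, 0, 1]
theorem p01_v : ∀ l, (p01 l).val = f01 l.val := by decide
theorem p45_v : ∀ l, (p45 l).val = f45 l.val := by decide
theorem p04_v : ∀ l, (p04 l).val = f04 l.val := by decide
theorem p01_b : Function.Bijective p01 := by decide
theorem p45_b : Function.Bijective p45 := by decide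
theorem p04_b : Function.Bijective p04 := by decide
theorem p01_c : ∀ l, p01 (compl6 l) = compl6 (p01 l) := by decide
theorem p45_c : ∀ l, p45 (compl6 l) = compl6 (p45 l) := by decide
theorem p04_c : ∀ l, p04 (compl6 l) = compl6 (p04 l) := by decide

def u0 : W 5 := fun _ => 2
theorem enc_u0 : enc u0 = U0 := rfl
def B3 (w : W 5) : Prop := ∀ j, (w j).val ≤ 2
def wt (w : W 5) : ℕ := (Finset.univ.filter (fun j => w j ≠ 2)).card

theorem b3g_mem (js : List ℕ) (f : ℕ → ℕ) (hf : ∀ p ∈ js, f p ≤ 2) : (js.map (fun p => f p * p)).sum ∈ b3g js := by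
  induction js with
  | nil => simp [b3g]
  | cons p t ih =>
    have e : b3g (p :: t) = fmap (fun x => [x, Nat.add x p, Nat.add x (Nat.mul 2 p)]) (b3g t) := rfl
    rw [e, fmap_eq, List.mem_flatMap]
    refine ⟨_, ih (fun q hq => hf q (List.mem_cons_of_mem _ hq)), ?_⟩
    have := hf p List.mem_cons_self
    rw [List.map_cons, List.sum_cons, add_comm]
    interval_cases f p
    · simp
    · simp
    · simp

theorem b3_mem {w : W 5} (h : B3 w) : enc w ∈ b3g ps := by
  have h1 := b3g_mem ps (fun p => dg p (enc w)) (fun p hp => by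
    obtain ⟨j, rfl⟩ := mem_ps hp
    rw [dg_enc]; exact h j)
  convert h1 using 1
  have e0 := dg_enc w 0
  have e1 := dg_enc w 1
  have e2 := dg_enc w 2
  have e3 := dg_enc w 3
  have e4 := dg_enc w 4
  simp only [ps, List.map_cons, List.map_nil, List.sum_cons, List.sum_nil]
  simp only [pl] at e0 e1 e2 e3 e4
  simp at e0 e1 e2 e3 e4
  rw [e0, e1, e2, e3, e4]
  unfold enc; ring

theorem wtc_enc (w : W 5) : wtc (enc w) = wt w := by
  have key : ∀ (j : Fin 5) (c : ℕ), sel (Nat.beq (dg (pl j) (enc w)) 2) c (Nat.succ c) = (if w j ≠ 2 then 1 else 0) + c := by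
    intro j c
    rw [dg_enc, sel_eq]
    have : (Nat.beq (w j).val 2 = true) ↔ w j = 2 := by
      rw [Nat.beq_eq, Fin.ext_iff]; rfl
    by_cases h : w j = 2
    · simp [h]
    · rw [if_neg (fun e => h (this.1 e))]; simp [h]; omega
  have : wtc (enc w) = fold (fun p c => sel (Nat.beq (dg p (enc w)) 2) c (Nat.succ c)) 0 [pl 0, pl 1, pl 2, pl 3, pl 4] := rfl
  rw [this, fold_cons, fold_cons, fold_cons, fold_cons, fold_cons, fold_nil, key, key, key, key, key]
  rw [wt, Finset.card_filter]
  simp only [Fin.sum_univ_five]; omega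

theorem IsoF.wt {f : W 5 → W 5} (hf : IsoF f) (h0 : f u0 = u0) (w : W 5) : wt (f w) = wt w := by
  obtain ⟨σ, h, h1, h2, rfl⟩ := hf
  unfold Cov.wt
  apply Finset.card_bij (fun j _ => σ j)
  · intro j hj
    simp only [Finset.mem_filter, Finset.mem_univ, true_and] at hj ⊢
    intro e; apply hj
    have := congrFun h0 j
    simp only [u0] at this
    rw [e, this]
  · intro a _ b _ e; exact σ.injective e
  · intro j hj
    simp only [Finset.mem_filter, Finset.mem_univ, true_and] at hj ⊢
    refine ⟨σ.symm j, ?_, by simp⟩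
    intro e; apply hj
    have := congrFun h0 (σ.symm j)
    simp only [u0] at this
    apply (h1 (σ.symm j)).1
    rw [this, ← e, Equiv.apply_symm_apply]

/-- symmetries fixing the center, the Boolean words and words living on the first `t` coordinates -/
def S1 (t : ℕ) (f : W 5 → W 5) : Prop := IsoF f ∧ (∀ w, B3 w → B3 (f w)) ∧
  ∀ w : W 5, (∀ i, t ≤ i.val → w i = 2) → f w = w

theorem S1.comp {t : ℕ} {f g : W 5 → W 5} (hf : S1 t f) (hg : S1 t g) : S1 t (fun v => f (g v)) :=
  ⟨hf.1.comp hg.1, fun w hw => hf.2.1 _ (hg.2.1 w hw), fun w hw => by beta_reduce; rw [hg.2.2 w hw, hf.2.2 w hw]⟩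
theorem S1.id {t : ℕ} : S1 t (fun v => v) := ⟨IsoF.id, fun _ h => h, fun _ _ => rfl⟩
theorem S1.u0 {t : ℕ} {f : W 5 → W 5} (hf : S1 t f) : f u0 = u0 := hf.2.2 _ (fun _ _ => rfl)

def gmin (g : ℕ) : ℕ := if g ≤ 5 then g - 1 else g - 6

theorem gen_ok {g : ℕ} (hg : g < 10) : ∃ f, S1 (gmin g) f ∧ ∀ w, enc (f w) = tr1 g (enc w) := by
  unfold tr1
  by_cases h5 : g ≤ 5
  · have hj : g - 1 < 5 := by omega
    refine ⟨_, ⟨isoF_lp (⟨g - 1, hj⟩ : Fin 5) p01 p01_b p01_c, ?_, ?_⟩, ?_⟩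
    · intro w hw j
      by_cases e : j = ⟨g - 1, hj⟩
      · subst e
        have := hw ⟨g - 1, hj⟩
        simp only [Function.update_self]
        generalize w ⟨g - 1, hj⟩ = l at this ⊢
        revert l; decide
      · simp [e]; exact hw j
    · intro w hw
      have := hw ⟨g - 1, hj⟩ (by simp [gmin, h5])
      rw [this]; conv_rhs => rw [← Function.update_eq_self ⟨g - 1, hj⟩ w]
      rw [this]; rfl
    · intro w
      rw [enc_lp w _ p01 f01 p01_v, sel_eq, if_pos (Nat.ble_eq ▸ h5)]
      congr 1
      interval_cases g <;> rfl
  · have hj : g - 6 + 1 < 5 := by omega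
    refine ⟨_, ⟨isoF_sw (⟨g - 6, by omega⟩ : Fin 5) ⟨g - 6 + 1, hj⟩, ?_, ?_⟩, ?_⟩
    · intro w hw j; exact hw _
    · intro w hw
      have a := hw ⟨g - 6, by omega⟩ (by simp [gmin, h5])
      have b := hw ⟨g - 6 + 1, hj⟩ (by simp [gmin, h5])
      funext k
      rw [Equiv.swap_apply_def]; split_ifs with h h'
      · rw [h, a, b]
      · rw [h', a, b]
      · rfl
    · intro w
      rw [enc_sw _ _ _ rfl, sel_eq, if_neg (by rw [Nat.ble_eq]; exact h5)]
      congr 1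
      have : 6 ≤ g := by omega
      interval_cases g <;> rfl

theorem S1.mono {t s : ℕ} {f : W 5 → W 5} (hf : S1 t f) (h : s ≤ t) : S1 s f :=
  ⟨hf.1, hf.2.1, fun w hw => hf.2.2 w (fun i hi => hw i (h.trans hi))⟩

theorem trs_ok (h : ℕ) : ∃ f, S1 0 f ∧ ∀ w, enc (f w) = trs h (enc w) := by
  unfold trs
  generalize 40 = n
  induction n generalizing h with
  | zero => exact ⟨_, S1.id, fun w => rfl⟩
  | succ n ih =>
    by_cases e : Nat.beq h 0 = true
    · refine ⟨_, S1.id, fun w => ?_⟩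
      show _ = sel (Nat.beq h 0) _ _
      rw [sel_eq, if_pos e]
    · obtain ⟨f, hf, hf'⟩ := gen_ok (g := Nat.mod h 10) (Nat.mod_lt _ (by norm_num))
      obtain ⟨g, hg, hg'⟩ := ih (Nat.div h 10)
      refine ⟨_, hg.comp (hf.mono (Nat.zero_le _)), fun w => ?_⟩
      show _ = sel (Nat.beq h 0) _ (force _ _)
      rw [sel_eq, if_neg e, force_eq, hg', hf']

noncomputable section
def nst (g x : ℕ) : ℕ := sel (Nat.ble g 5) (sel (Nat.beq (dg (Nat.pow 6 (Nat.sub g 1)) x) 1) (tr1 g x) x)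
  (sel (Nat.beq (dg (Nat.pow 6 (Nat.sub g 6)) x) 2) (tr1 g x) x)
def nf (gs : List ℕ) (x : ℕ) : ℕ := List.rec (motive := fun _ => ℕ → ℕ) (fun x => x) (fun g _ ih x => force (nst g x) fun y => ih y) gs x
end

theorem nst_ok {g : ℕ} (hg : g < 10) (w : W 5) : ∃ f, S1 (gmin g) f ∧ enc (f w) = nst g (enc w) := by
  obtain ⟨f, hf, hf'⟩ := gen_ok hg
  unfold nst
  simp only [sel_eq]
  split_ifs
  exacts [⟨f, hf, hf' w⟩, ⟨_, S1.id, rfl⟩, ⟨f, hf, hf' w⟩, ⟨_, S1.id, rfl⟩]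

theorem nf_ok {t : ℕ} (gs : List ℕ) (hg : ∀ g ∈ gs, g < 10 ∧ t ≤ gmin g) (w : W 5) : ∃ f, S1 t f ∧ enc (f w) = nf gs (enc w) := by
  induction gs generalizing w with
  | nil => exact ⟨_, S1.id, rfl⟩
  | cons g gs ih =>
    obtain ⟨h1, h2⟩ := hg g List.mem_cons_self
    obtain ⟨f, hf, e⟩ := nst_ok h1 w
    obtain ⟨f', hf', e'⟩ := ih (fun g hg' => hg g (List.mem_cons_of_mem _ hg')) (f w)
    refine ⟨_, hf'.comp (hf.mono h2), ?_⟩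
    show _ = force (nst g (enc w)) fun y => nf gs y
    rw [force_eq, ← e, ← e']

end Cov
namespace Cov

def repl : List (List ℕ) := [[3096, 3037, 3030, 3061, 3068],
  [3108, 3025, 2671, 2629, 2815, 2857],
  [3108, 3097, 2599, 475, 223, 1339, 1591],
  [3096, 3037, 3030, 2641, 2634, 2845, 2852],
  [3096, 3037, 2670, 2814, 2852, 2641, 2845],
  [3108, 3025, 2671, 2629, 265, 1549, 1591, 223],
  [3108, 3025, 2671, 469, 1333, 1561, 295, 1519],
  [3096, 3025, 2641, 2845, 2600, 3066, 2814, 2887],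
  [3024, 2665, 2640, 2600, 3067, 2821, 2886, 2846]]
def N0 : List ℕ := [3110, 3108, 3096, 3024, 2592, 0]
def N1 : List ℕ := [3109, 3097, 3025, 2593, 1]
def N2 : List ℕ := [3102, 3030, 2598, 6, 3104, 3032, 2600, 8]
noncomputable section
def cnd (q : ℕ → Bool) (L : List ℕ) : ℕ := fold (fun x c => Nat.land c (gm x)) (orb (flt q (b3g ps))) L
def srun (k : ℕ) (q : ℕ → Bool) (L : List ℕ) : List (List ℕ) :=
  force (cnd q L) fun c => force (orb L) fun ch => run k c ch (ptl rps 3110) L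
def isrep (m : ℕ) (rs : List (List ℕ)) : Bool := List.rec false (fun r _ ih => sel (Nat.beq m (orb r)) true ih) rs
def chk (outs : List (List ℕ)) : List ℕ → Bool := List.rec (motive := fun _ => List ℕ → Bool) (fun _ => true)
  (fun l _ ih hs => List.rec false (fun h t _ => sel (force (orb (mp (trs h) l)) fun m => isrep m repl) (ih t) false) hs) outs
def g0 : List ℕ := [1, 2, 3, 4, 5, 6, 7, 8, 9, 6, 7, 8, 9, 6, 7, 8, 9, 6, 7, 8, 9]
def g1 : List ℕ := [2, 3, 4, 5, 7, 8, 9, 7, 8, 9, 7, 8, 9]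
def g2 : List ℕ := [3, 4, 5, 8, 9, 8, 9]
end
theorem n0 : all (fun x => anyn (nf g0 x) N0) (b3g ps) = true := by decide +kernel
theorem n1 : all (fun x => sel (Nat.beq (dg 1 x) 1) (anyn (nf g1 x) N1) true) (b3g ps) = true := by decide +kernel
theorem n2 : all (fun x => sel (Nat.beq (dg 6 x) 1) (sel (Nat.beq (dg 1 x) 1) true (anyn (nf g2 x) N2)) true) (b3g ps) = true := by decide +kernel
theorem r0 : chk (srun 5 (fun x => Nat.ble 2 (wtc x)) [3030, 3096]) [953, 89, 7891, 9, 93, 895, 78951, 95, 43, 8, 781, 0, 3, 84, 7841, 4, 976532, 97632, 76432, 7632, 0] = true := by decide +kernel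
theorem r1 : chk (srun 5 (fun x => Nat.ble 2 (wtc x)) [2598, 3096]) [3, 83, 7831, 4, 643, 643, 84, 83, 4, 741, 8643, 8643] = true := by decide +kernel
theorem r2 : chk (srun 5 (fun x => Nat.ble 2 (wtc x)) [6, 3096]) [] = true := by decide +kernel
theorem r3 : chk (srun 5 (fun x => Nat.ble 2 (wtc x)) [3032, 3096]) [965, 965, 96, 96, 64, 64, 6, 6, 97652, 9762, 7642, 762, 3] = true := by decide +kernel
theorem r4 : chk (srun 5 (fun x => Nat.ble 2 (wtc x)) [2600, 3096]) [43, 843, 78431, 0, 63, 63, 43, 843, 8, 7431, 864, 864] = true := by decide +kernel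
theorem r5 : chk (srun 5 (fun x => Nat.ble 2 (wtc x)) [8, 3096]) [] = true := by decide +kernel
theorem r6 : chk (srun 6 (fun x => Nat.beq (wtc x) 3) [3024]) [95, 9, 4, 0] = true := by decide +kernel
theorem r7 : chk (srun 5 (fun x => Nat.ble 2 (wtc x)) [3097, 3108]) [4, 53, 54, 543, 3, 43, 0, 5] = true := by decide +kernel
theorem r8 : chk (srun 5 (fun x => Nat.ble 3 (wtc x)) [3025, 3108]) [54, 94, 892, 74, 754, 954, 5, 82, 9754, 975, 4, 954, 8952, 754, 74, 54, 95, 842, 9754, 975, 94, 0, 852, 4, 9, 8542, 89753, 9, 897543, 974, 97, 974,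
  97, 8973, 95, 89743, 9, 8942, 5, 95, 89542, 0, 8743, 87543, 0, 75, 7, 7, 75, 873, 8753, 4] = true := by decide +kernel
theorem r9 : chk (srun 5 (fun x => Nat.ble 4 (wtc x)) [2593, 3108]) [] = true := by decide +kernel
theorem r10 : chk (srun 5 (fun x => Nat.ble 5 (wtc x)) [1, 3108]) [] = true := by decide +kernel
end Cov
namespace Cov

def GG (F : Finset (W 5)) : Prop := ∃ f, IsoF f ∧ f u0 = u0 ∧ ∃ r ∈ repl, ∀ Q, Q ∈ F.image f ↔ enc Q ∈ r
structure BN (F : Finset (W 5)) : Prop where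
  cov : IsCov u0 F
  tf : TF F
  nu : u0 ∉ F
  card : F.card ≤ 8
  b3 : ∀ Q ∈ F, B3 Q

theorem GG.of {F : Finset (W 5)} {f : W 5 → W 5} (hf : IsoF f) (h0 : f u0 = u0) (h : GG (F.image f)) : GG F := by
  obtain ⟨g, hg, hg0, r, hr, h⟩ := h
  refine ⟨_, hg.comp hf, by rw [h0, hg0], r, hr, fun Q => ?_⟩
  rw [← h, Finset.image_image]; rfl

theorem BN.image {F : Finset (W 5)} (h : BN F) {f : W 5 → W 5} (hf : S1 0 f) : BN (F.image f) := by
  refine ⟨?_, hf.1.tf h.tf, ?_, ?_, ?_⟩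
  · have := hf.1.cov h.cov; rwa [hf.u0] at this
  · have := hf.1.not_mem h.nu; rwa [hf.u0] at this
  · rw [Finset.card_image_of_injective _ hf.1.inj]; exact h.card
  · intro Q hQ
    obtain ⟨P, hP, rfl⟩ := Finset.mem_image.1 hQ
    exact hf.2.1 _ (h.b3 P hP)

theorem isrep_ok {m : ℕ} {rs : List (List ℕ)} (h : isrep m rs = true) : ∃ r ∈ rs, m = orb r := by
  induction rs with
  | nil => simp [isrep] at h
  | cons r t ih =>
    have e : isrep m (r :: t) = sel (Nat.beq m (orb r)) true (isrep m t) := rfl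
    rw [e, sel_eq] at h
    split_ifs at h with h1
    · exact ⟨r, List.mem_cons_self, Nat.eq_of_beq_eq_true h1⟩
    · obtain ⟨r, hr, e⟩ := ih h
      exact ⟨r, List.mem_cons_of_mem _ hr, e⟩

theorem chk_ok {outs : List (List ℕ)} {hs : List ℕ} (h : chk outs hs = true) {l : List ℕ} (hl : l ∈ outs) :
    ∃ g, ∃ r ∈ repl, orb (l.map (trs g)) = orb r := by
  induction outs generalizing hs with
  | nil => simp at hl
  | cons l' t ih =>
    cases hs with
    | nil => exact absurd h (by intro h; exact Bool.false_ne_true h)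
    | cons g hs =>
      have e : chk (l' :: t) (g :: hs) = sel (force (orb (mp (trs g) l')) fun m => isrep m repl) (chk t hs) false := rfl
      rw [e, sel_eq, force_eq, mp_eq] at h
      split_ifs at h with h1
      rcases List.mem_cons.1 hl with rfl | hl
      · obtain ⟨r, hr, e⟩ := isrep_ok h1
        exact ⟨g, r, hr, e⟩
      · exact ih h hl

theorem fin1 {F : Finset (W 5)} (h : BN F) {k : ℕ} {q : ℕ → Bool} {L hs : List ℕ} (hk : 8 ≤ L.length + (k + 1))
    (hn : L.Nodup) (hL : ∀ x ∈ L, ∃ Q ∈ F, enc Q = x) (hq : ∀ Q ∈ F, enc Q ∉ L → q (enc Q) = true)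
    (hc : chk (srun k q L) hs = true) : GG F := by
  have hF : ∀ Q, enc Q ∈ L → Q ∈ F := fun Q hQ => by
    obtain ⟨P, hP, e⟩ := hL _ hQ
    rwa [← enc_inj e]
  obtain ⟨Y, h1, h2, h3, h4⟩ := run_full (js := rps) (by decide) (by decide) (by decide) (v := u0) (F := F)
    (X := F.filter (fun Q => enc Q ∉ L)) (L := L) h.cov h.tf (Finset.filter_subset _ _) (k := k) (cand := cnd q L) (ch := orb L)
    (by
      intro Q; rw [Finset.mem_filter]
      constructor
      · intro hQ; by_cases e : enc Q ∈ L
        · exact Or.inl e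
        · exact Or.inr ⟨hQ, e⟩
      · rintro (e | e)
        · exact hF Q e
        · exact e.1) (by
      have a := Finset.card_filter_add_card_filter_not (s := F) (fun Q => enc Q ∈ L)
      have b : L.length ≤ (F.filter (fun Q => enc Q ∈ L)).card := by
        rw [← List.toFinset_card_of_nodup hn, ← Finset.card_image_of_injective _ enc_inj']
        apply Finset.card_le_card
        intro x hx
        rw [List.mem_toFinset] at hx
        obtain ⟨Q, hQ, rfl⟩ := hL x hx
        exact Finset.mem_image_of_mem _ (Finset.mem_filter.2 ⟨hQ, hx⟩)
      have := h.card
      omega) (by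
      intro Q hQ
      obtain ⟨hQ, hQL⟩ := Finset.mem_filter.1 hQ
      unfold cnd
      rw [tb_fold_land, tb_orb, flt_eq, List.mem_filter]
      refine ⟨⟨b3_mem (h.b3 Q hQ), hq Q hQ hQL⟩, fun x hx => ?_⟩
      obtain ⟨P, hP, rfl⟩ := hL x hx
      rw [tb_gm]
      exact ⟨h.cov.dich P hP Q hQ (fun e => hQL (e ▸ hx)), h.tf P hP Q hQ⟩)
    (fun Q => tb_orb _ _) (fun x => (tb_orb _ _).1) (fun x hx => by
      obtain ⟨P, hP, rfl⟩ := hL x hx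
      exact enc_lt P) L
  have e : Y ++ L ∈ srun k q L := by
    unfold srun; rw [force_eq, force_eq]; exact h1
  obtain ⟨g, r, hr, hor⟩ := chk_ok hc e
  obtain ⟨f, hf, hf'⟩ := trs_ok g
  refine ⟨f, hf.1, hf.u0, r, hr, fun Q => ?_⟩
  rw [← orb_mem_iff hor, Finset.mem_image, List.mem_map]
  constructor
  · rintro ⟨P, hP, rfl⟩
    refine ⟨enc P, ?_, (hf' P).symm⟩
    rw [List.mem_append]
    by_cases e : enc P ∈ L
    · exact Or.inr e
    · exact h3 P (Finset.mem_filter.2 ⟨hP, e⟩)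
  · rintro ⟨y, hy, e⟩
    have hy7 : y < 7776 := by
      rcases List.mem_append.1 hy with hy | hy
      · exact h2 y hy
      · obtain ⟨P, _, rfl⟩ := hL y hy
        exact enc_lt P
    rw [← enc_dec hy7] at hy e
    rw [← hf'] at e
    refine ⟨dec y, ?_, enc_inj e⟩
    rcases List.mem_append.1 hy with hy | hy
    · exact (Finset.mem_filter.1 (h4 _ hy)).1
    · exact hF _ hy

theorem wt_zero {w : W 5} (h : wt w = 0) : w = u0 := by
  funext j
  rw [wt, Finset.card_eq_zero, Finset.filter_eq_empty_iff] at h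
  have := h (Finset.mem_univ j)
  show w j = 2
  simpa using this

theorem nf0 {w : W 5} (h : B3 w) : nf g0 (enc w) ∈ N0 := by
  have := n0; rw [all_eq, List.all_eq_true] at this
  exact (anyn_iff _ _).1 (this _ (b3_mem h))
theorem nf1 {w : W 5} (h : B3 w) (h0 : w 0 = 1) : nf g1 (enc w) ∈ N1 := by
  have := n1; rw [all_eq, List.all_eq_true] at this
  have := this _ (b3_mem h)
  have e : dg 1 (enc w) = 1 := by have := dg_enc w 0; rw [h0] at this; exact this
  rw [e] at this
  exact (anyn_iff _ _).1 this
theorem nf2 {w : W 5} (h : B3 w) (h1 : w 1 = 1) (h0 : w 0 ≠ 1) : nf g2 (enc w) ∈ N2 := by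
  have := n2; rw [all_eq, List.all_eq_true] at this
  have := this _ (b3_mem h)
  have e : dg 6 (enc w) = 1 := by have := dg_enc w 1; rw [h1] at this; exact this
  have e' : dg 1 (enc w) = (w 0).val := dg_enc w 0
  rw [e, e', sel_eq, sel_eq, if_pos (show Nat.beq 1 1 = true from rfl), if_neg] at this
  · exact (anyn_iff _ _).1 this
  · intro hb; apply h0; apply Fin.ext; exact Nat.eq_of_beq_eq_true hb

theorem pk : ∀ s : Bool, sat (setq (setq (fun _ => false) 2) (if s then 1 else 0)) 2 = true := by decide
theorem pk2 : ∀ (s : Bool) (l : Fin 6), l.val ≤ 2 → sat (setq (setq (fun _ => false) 2) (if s then 1 else 0)) l = true →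
  l ≠ 2 → s = decide (l = 1) := by decide

theorem vol {F : Finset (W 5)} (h : BN F) (h3 : ∀ Q ∈ F, 3 ≤ wt Q) : ∀ Q ∈ F, wt Q = 3 := by
  let T : W 5 → Finset (Fin 5 → Bool) := fun Q => Fintype.piFinset (fun j => if Q j = 2 then Finset.univ else {decide (Q j = 1)})
  have hT : ∀ Q, (T Q).card = 2 ^ (5 - wt Q) := by
    intro Q
    have e : ∀ j, (if Q j = 2 then (Finset.univ : Finset Bool) else {decide (Q j = 1)}).card = if Q j = 2 then 2 else 1 := by
      intro j; split_ifs <;> rfl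
    rw [Fintype.card_piFinset]
    simp only [e]
    rw [Finset.prod_ite, Finset.prod_const, Finset.prod_const, one_pow, mul_one]
    congr 1
    have := Finset.card_filter_add_card_filter_not (s := (Finset.univ : Finset (Fin 5))) (fun j => Q j = 2)
    have e2 : (Finset.univ : Finset (Fin 5)).card = 5 := rfl
    unfold wt
    simp only [ne_eq]
    omega
  have hcov : (Finset.univ : Finset (Fin 5 → Bool)) ⊆ F.biUnion T := by
    intro s _
    obtain ⟨Q, hQ, hin⟩ := h.cov.cov (fun j => setq (setq (fun _ => false) 2) (if s j then 1 else 0)) (fun j => pk (s j))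
    rw [Finset.mem_biUnion]
    refine ⟨Q, hQ, Fintype.mem_piFinset.2 fun j => ?_⟩
    split_ifs with e
    · exact Finset.mem_univ _
    · rw [Finset.mem_singleton]; exact pk2 _ _ (h.b3 Q hQ j) (hin j) e
  have h32 := (Finset.card_le_card hcov).trans Finset.card_biUnion_le
  have e : (Finset.univ : Finset (Fin 5 → Bool)).card = 32 := by simp
  rw [e] at h32
  have h4 : ∀ Q ∈ F, (T Q).card ≤ 4 := fun Q hQ => by
    rw [hT]; calc 2 ^ (5 - wt Q) ≤ 2 ^ 2 := Nat.pow_le_pow_right (by norm_num) (by have := h3 Q hQ; omega)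
      _ = 4 := by norm_num
  intro Q hQ
  by_contra hne
  have hlt : (T Q).card < 4 := by
    rw [hT]; calc 2 ^ (5 - wt Q) ≤ 2 ^ 1 := Nat.pow_le_pow_right (by norm_num) (by have := h3 Q hQ; omega)
      _ < 4 := by norm_num
  have := Finset.sum_lt_sum h4 ⟨Q, hQ, hlt⟩
  rw [Finset.sum_const, smul_eq_mul] at this
  have := h.card
  omega


theorem enc_letters {w : W 5} {x : ℕ} (h : enc w = x) (j : Fin 5) : (w j).val = dg (pl j) x := by rw [← h, dg_enc]

theorem BN.ltr {F : Finset (W 5)} (h : BN F) {P Q : W 5} (hP : P ∈ F) (hQ : Q ∈ F) (hne : Q ≠ P) {j : Fin 5}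
    (hj : ∀ i, i ≠ j → P i = 2) (h0 : P j = 0) : Q j = 1 := by
  obtain ⟨i, hi⟩ := h.cov.dich P hP Q hQ (Ne.symm hne)
  by_cases e : i = j
  · subst e; rw [hi, h0]; rfl
  · exfalso
    have := h.b3 Q hQ i
    rw [hi, hj i e] at this
    exact absurd this (by decide)

theorem st1 {F : Finset (W 5)} (h : BN F) {P : W 5} (hP : P ∈ F) (e : enc P = 3108) : GG F := by
  have eP := enc_letters e
  have e0 : P 0 = 0 := Fin.ext (eP 0)
  have er : ∀ i, i ≠ 0 → P i = 2 := by
    intro i hi; apply Fin.ext; rw [eP]; revert i; decide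
  obtain ⟨Q1, hQ1, hQ1', -⟩ := h.cov.flip hP (i := 0) (by rw [e0]; decide) (p := pt u0 P) (fun j _ => pt_right u0 P j)
    (pt_left (h.cov.nd P hP))
  have hne : (F.erase P).Nonempty := ⟨Q1, Finset.mem_erase.2 ⟨fun e => by rw [e, e0] at hQ1'; exact absurd hQ1' (by decide), hQ1⟩⟩
  obtain ⟨Q, hQ, hmin⟩ := Finset.exists_min_image (F.erase P) wt hne
  obtain ⟨hQP, hQ⟩ := Finset.mem_erase.1 hQ
  have hQ0 := h.ltr hP hQ hQP er e0
  obtain ⟨f, hf, hf'⟩ := nf_ok (t := 1) g1 (by decide) Q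
  have hfP : f P = P := hf.2.2 P (fun i hi => er i (by rintro rfl; simp at hi))
  have hfm := hf.mono (Nat.zero_le 1)
  apply GG.of hfm.1 hfm.u0
  have h' := h.image hfm
  have hP' : P ∈ F.image f := by rw [← hfP]; exact Finset.mem_image_of_mem _ hP
  have hQ' := Finset.mem_image_of_mem f hQ
  have hmin' : ∀ R ∈ F.image f, R ≠ P → wtc (enc (f Q)) ≤ wtc (enc R) := by
    intro R hR hRP
    obtain ⟨R, hR', rfl⟩ := Finset.mem_image.1 hR
    rw [wtc_enc, wtc_enc, hfm.1.wt hfm.u0, hfm.1.wt hfm.u0]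
    exact hmin R (Finset.mem_erase.2 ⟨fun e => hRP (by rw [e, hfP]), hR'⟩)
  have hN := nf1 (h.b3 Q hQ) hQ0
  rw [← hf'] at hN
  generalize f Q = Q at *
  have fin : ∀ x k, enc Q = x → wtc x = k → 8 ≤ [x, 3108].length + (5 + 1) ∧ (∀ y ∈ [x, 3108], ∃ R ∈ F.image f, enc R = y) ∧
      ∀ R ∈ F.image f, enc R ∉ [x, 3108] → Nat.ble k (wtc (enc R)) = true := by
    rintro x k rfl rfl
    refine ⟨le_rfl, ?_, ?_⟩
    · intro y hy
      rcases List.mem_pair.1 hy with rfl | rfl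
      · exact ⟨Q, hQ', rfl⟩
      · exact ⟨P, hP', e⟩
    · intro R hR hR'
      rw [Nat.ble_eq]
      exact hmin' R hR (by rintro rfl; exact hR' (by rw [e]; simp))
  simp only [N1, List.mem_cons, List.not_mem_nil, or_false] at hN
  rcases hN with hN | hN | hN | hN | hN
  · exfalso
    apply h'.tf P hP' Q hQ'
    rw [← tb_tm, e, hN]; decide +kernel
  · obtain ⟨a, b, c⟩ := fin _ 2 hN rfl
    exact fin1 h' a (by decide) b c r7
  · obtain ⟨a, b, c⟩ := fin _ 3 hN rfl
    exact fin1 h' a (by decide) b c r8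
  · obtain ⟨a, b, c⟩ := fin _ 4 hN rfl
    exact fin1 h' a (by decide) b c r9
  · obtain ⟨a, b, c⟩ := fin _ 5 hN rfl
    exact fin1 h' a (by decide) b c r10

theorem st2 {F : Finset (W 5)} (h : BN F) {P : W 5} (hP : P ∈ F) (e : enc P = 3096) (hm : ∀ Q ∈ F, 2 ≤ wt Q) : GG F := by
  have eP := enc_letters e
  have e0 : P 0 = 0 := Fin.ext (eP 0)
  have e1 : P 1 = 0 := Fin.ext (eP 1)
  obtain ⟨Q, hQ, hQ1, hQin⟩ := h.cov.flip hP (i := 1) (by rw [e1]; decide) (p := pt u0 P) (fun j _ => pt_right u0 P j)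
    (pt_left (h.cov.nd P hP))
  rw [e1] at hQ1
  have hQ0 : Q 0 ≠ 1 := by
    intro e
    have a := hQin 0
    rw [fl_ne _ _ (by decide), e] at a
    have b := pt_right u0 P 0
    rw [e0] at b
    have c := sat_c (pt u0 P 0) 0
    rw [b] at c
    exact absurd (a.symm.trans c) (by decide)
  obtain ⟨f, hf, hf'⟩ := nf_ok (t := 2) g2 (by decide) Q
  have hfP : f P = P := hf.2.2 P (fun i hi => by
    apply Fin.ext; rw [eP]; revert i; decide)
  have hfm := hf.mono (Nat.zero_le 2)
  apply GG.of hfm.1 hfm.u0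
  have h' := h.image hfm
  have hP' : P ∈ F.image f := by rw [← hfP]; exact Finset.mem_image_of_mem _ hP
  have hQ' := Finset.mem_image_of_mem f hQ
  have hmin' : ∀ R ∈ F.image f, 2 ≤ wtc (enc R) := by
    intro R hR
    obtain ⟨R, hR', rfl⟩ := Finset.mem_image.1 hR
    rw [wtc_enc, hfm.1.wt hfm.u0]
    exact hm R hR'
  have hN := nf2 (h.b3 Q hQ) hQ1 hQ0
  rw [← hf'] at hN
  generalize f Q = Q at *
  have fin : ∀ x, enc Q = x → 8 ≤ [x, 3096].length + (5 + 1) ∧ (∀ y ∈ [x, 3096], ∃ R ∈ F.image f, enc R = y) ∧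
      ∀ R ∈ F.image f, enc R ∉ [x, 3096] → Nat.ble 2 (wtc (enc R)) = true := by
    rintro x rfl
    refine ⟨le_rfl, ?_, ?_⟩
    · intro y hy
      rcases List.mem_pair.1 hy with rfl | rfl
      · exact ⟨Q, hQ', rfl⟩
      · exact ⟨P, hP', e⟩
    · intro R hR hR'
      rw [Nat.ble_eq]
      exact hmin' R hR
  simp only [N2, List.mem_cons, List.not_mem_nil, or_false] at hN
  rcases hN with hN | hN | hN | hN | hN | hN | hN | hN
  · exfalso
    apply h'.tf P hP' Q hQ'
    rw [← tb_tm, e, hN]; decide +kernel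
  · obtain ⟨a, b, c⟩ := fin _ hN
    exact fin1 h' a (by decide) b c r0
  · obtain ⟨a, b, c⟩ := fin _ hN
    exact fin1 h' a (by decide) b c r1
  · obtain ⟨a, b, c⟩ := fin _ hN
    exact fin1 h' a (by decide) b c r2
  · exfalso
    have := hmin' Q hQ'
    rw [hN] at this
    exact absurd this (by decide +kernel)
  · obtain ⟨a, b, c⟩ := fin _ hN
    exact fin1 h' a (by decide) b c r3
  · obtain ⟨a, b, c⟩ := fin _ hN
    exact fin1 h' a (by decide) b c r4
  · obtain ⟨a, b, c⟩ := fin _ hN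
    exact fin1 h' a (by decide) b c r5

theorem stage1 {F : Finset (W 5)} (h : BN F) : GG F := by
  obtain ⟨P, hP, hmin⟩ := Finset.exists_min_image F wt (h.cov.nonempty)
  obtain ⟨f, hf, hf'⟩ := nf_ok (t := 0) g0 (by decide) P
  apply GG.of hf.1 hf.u0
  have h' := h.image hf
  have hP' := Finset.mem_image_of_mem f hP
  have hmin' : ∀ R ∈ F.image f, wtc (enc (f P)) ≤ wt R := by
    intro R hR
    obtain ⟨R, hR', rfl⟩ := Finset.mem_image.1 hR
    rw [wtc_enc, hf.1.wt hf.u0, hf.1.wt hf.u0]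
    exact hmin R hR'
  have hN := nf0 (h.b3 P hP)
  rw [← hf'] at hN
  generalize f P = P at *
  simp only [N0, List.mem_cons, List.not_mem_nil, or_false] at hN
  have fin : 3 ≤ wtc (enc P) → GG (F.image f) := by
    intro h3
    have hv := vol h' (fun R hR => h3.trans (hmin' R hR))
    have hP3 := hv P hP'
    rw [← wtc_enc] at hP3
    have e : enc P = 3024 := by
      rcases hN with hN | hN | hN | hN | hN | hN
      · rw [hN] at hP3; exact absurd hP3 (by decide +kernel)
      · rw [hN] at hP3; exact absurd hP3 (by decide +kernel)
      · rw [hN] at hP3; exact absurd hP3 (by decide +kernel)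
      · exact hN
      · rw [hN] at hP3; exact absurd hP3 (by decide +kernel)
      · rw [hN] at hP3; exact absurd hP3 (by decide +kernel)
    refine fin1 h' (L := [3024]) (k := 6) le_rfl (by decide) ?_ ?_ r6
    · intro x hx; rw [List.mem_singleton] at hx; exact ⟨P, hP', by rw [e, hx]⟩
    · intro Q hQ _
      rw [wtc_enc, hv Q hQ]; rfl
  rcases hN with hN | hN | hN | hN | hN | hN
  · exact absurd (enc_inj (hN.trans enc_u0.symm) ▸ hP') h'.nu
  · exact st1 h' hP' hN
  · exact st2 h' hP' hN (fun Q hQ => by have := hmin' Q hQ; rw [hN] at this; exact this)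
  · exact fin (by rw [hN]; decide +kernel)
  · exact fin (by rw [hN]; decide +kernel)
  · exact fin (by rw [hN]; decide +kernel)

def hh (a b l : Fin 6) : Fin 6 := if l = a then 2 else if l = compl6 a then 3 else if l = b then 0 else
  if l = compl6 b then 1 else if l.val % 2 = 0 then 4 else 5
theorem hh_bij : ∀ a b : Fin 6, b ≠ a → b ≠ compl6 a → Function.Bijective (hh a b) := by decide
theorem hh_c : ∀ a b : Fin 6, b ≠ a → b ≠ compl6 a → ∀ l, hh a b (compl6 l) = compl6 (hh a b l) := by decide
theorem hh_a : ∀ a b : Fin 6, hh a b a = 2 := by decide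
theorem hh_l : ∀ a b : Fin 6, b ≠ a → b ≠ compl6 a → (hh a b b).val ≤ 2 ∧ (hh a b (compl6 b)).val ≤ 2 := by decide
theorem hh_ex : ∀ a : Fin 6, ∃ b, b ≠ a ∧ b ≠ compl6 a := by decide

theorem boo_norm {u : W 5} {F : Finset (W 5)} (h : IsCov u F) (hb : Boo u F) : ∃ f, IsoF f ∧ f u = u0 ∧ ∀ Q ∈ F, B3 (f Q) := by
  have key : ∀ j, ∃ b, b ≠ u j ∧ b ≠ compl6 (u j) ∧ ∀ Q ∈ F, Q j = u j ∨ Q j = b ∨ Q j = compl6 b := by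
    intro j
    by_cases e : ∃ P ∈ F, P j ≠ u j
    · obtain ⟨P, hP, hj⟩ := e
      exact ⟨P j, hj, h.nd P hP j, fun Q hQ => by
        by_cases e : Q j = u j
        · exact Or.inl e
        · exact Or.inr (hb P hP Q hQ j hj e)⟩
    · push Not at e
      obtain ⟨b, h1, h2⟩ := hh_ex (u j)
      exact ⟨b, h1, h2, fun Q hQ => Or.inl (e Q hQ)⟩
  choose b h1 h2 h3 using key
  refine ⟨_, ⟨Equiv.refl _, fun j => hh (u j) (b j), fun j => hh_bij _ _ (h1 j) (h2 j), fun j => hh_c _ _ (h1 j) (h2 j), rfl⟩, ?_, ?_⟩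
  · funext j; exact hh_a _ _
  · intro Q hQ j
    show (hh (u j) (b j) (Q j)).val ≤ 2
    rcases h3 j Q hQ with e | e | e
    · rw [e, hh_a]; exact le_rfl
    · rw [e]; exact (hh_l _ _ (h1 j) (h2 j)).1
    · rw [e]; exact (hh_l _ _ (h1 j) (h2 j)).2

theorem cls {u : W 5} {F : Finset (W 5)} (h : IsCov u F) (hb : Boo u F) (tf : TF F) (hu : u ∉ F) (hc : F.card ≤ 8) :
    ∃ f, IsoF f ∧ f u = u0 ∧ ∃ r ∈ repl, ∀ Q, Q ∈ F.image f ↔ enc Q ∈ r := by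
  obtain ⟨f, hf, h0, hB⟩ := boo_norm h hb
  obtain ⟨g, hg, hg0, r, hr, H⟩ := stage1 (F := F.image f) ⟨by have := hf.cov h; rwa [h0] at this, hf.tf tf,
    by have := hf.not_mem hu; rwa [h0] at this, Finset.card_image_le.trans hc, fun Q hQ => by
      obtain ⟨P, hP, rfl⟩ := Finset.mem_image.1 hQ
      exact hB P hP⟩
  refine ⟨_, hg.comp hf, by rw [h0, hg0], r, hr, fun Q => ?_⟩
  rw [← H, Finset.image_image]; rfl

theorem repl_ok : ∀ r ∈ repl, r.Nodup ∧ ∀ x ∈ r, x < 7776 := by decide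

theorem rep_card {F : Finset (W 5)} {r : List ℕ} (hr : r ∈ repl) (H : ∀ Q, Q ∈ F ↔ enc Q ∈ r) : F.card = r.length := by
  obtain ⟨h1, h2⟩ := repl_ok r hr
  rw [← List.toFinset_card_of_nodup h1, ← Finset.card_image_of_injective _ enc_inj']
  congr 1
  ext x
  rw [Finset.mem_image, List.mem_toFinset]
  constructor
  · rintro ⟨Q, hQ, rfl⟩; exact (H Q).1 hQ
  · intro hx
    have := enc_dec (h2 x hx)
    exact ⟨dec x, (H _).2 (by rwa [this]), this⟩

theorem six5 : Six 5 := by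
  intro u G h tf hu hc
  obtain ⟨f, hf, h0, r, hr, H⟩ := cls h (bool7 (by omega) h tf hu) tf hu (by omega)
  have hl := rep_card hr H
  rw [Finset.card_image_of_injective _ hf.inj, hc] at hl
  have h6 : 3108 ∈ r := by clear H; revert r; decide
  have e := enc_dec (show 3108 < 7776 by norm_num)
  rw [← e, ← H, Finset.mem_image] at h6
  obtain ⟨Q, hQ, hfQ⟩ := h6
  obtain ⟨σ, k, k1, k2, rfl⟩ := hf
  have d0 : k 0 (Q (σ 0)) = 0 := (congrFun hfQ 0).trans (by decide)
  have u0' : k 0 (u (σ 0)) = 2 := congrFun h0 0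
  refine ⟨Q, hQ, σ 0, Q (σ 0), ?_, ?_⟩
  · intro e; rw [e, u0'] at d0; exact absurd d0 (by decide)
  · funext i
    by_cases hi : i = σ 0
    · subst hi; simp
    · rw [Function.update_of_ne hi]
      have a := congrFun hfQ (σ.symm i)
      have b := congrFun h0 (σ.symm i)
      simp only [Equiv.apply_symm_apply] at a b
      apply (k1 (σ.symm i)).1
      rw [a, b]
      have : σ.symm i ≠ 0 := fun e => hi (by rw [← e]; simp)
      generalize σ.symm i = m at this
      revert m; decide

theorem boo5 {u : W 5} {F : Finset (W 5)} (hc : F.card ≤ 8) (h : IsCov u F) (tf : TF F) (hu : u ∉ F) : Boo u F :=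
  bool8 six5 hc h tf hu

end Cov
namespace Cov

theorem mem_iff (m w : ℕ) : mem m w = true ↔ tb m w = true := by
  unfold mem
  rw [nz_iff]
  constructor
  · rintro ⟨x, hx⟩
    rw [tb_land, tb_b1] at hx
    simp at hx
    rw [← hx.2]; exact hx.1
  · intro h
    exact ⟨w, by rw [tb_land, tb_b1]; simp [h]⟩

theorem orb_low (xs : List ℕ) : ∀ i, i < 64 → Nat.testBit (orb xs) i = false := by
  intro i hi
  induction xs with
  | nil => simp [orb, fold_nil]
  | cons x t ih =>
    have e : orb (x :: t) = orb t ||| b1 x := rfl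
    rw [e, Nat.testBit_lor, ih]
    have : b1 x = 2 ^ 64 <<< x := rfl
    rw [this, ← Nat.one_shiftLeft, ← Nat.shiftLeft_add, Nat.one_shiftLeft, Nat.testBit_two_pow]
    simp; omega

theorem lit_lt {p l : ℕ} (hp : p ∈ ps) (hl : l < 6) : lit p l < 2 ^ 7840 := by
  apply Nat.lt_pow_two_of_testBit
  intro i hi
  have e : lit p l = bs p <<< (64 + l * p) := rfl
  rw [e, Nat.testBit_shiftLeft, tb_bs hp]
  simp only [ps, List.mem_cons, List.not_mem_nil, or_false] at hp
  rcases hp with rfl | rfl | rfl | rfl | rfl <;>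
  · simp; omega

theorem tb_ndl {j : Fin 5} (v Q : W 5) : tb (ndl (pl j) (v j).val) (enc Q) = true ↔ Q j ≠ compl6 (v j) := by
  unfold ndl
  have hl := xor_lt _ (v j).isLt
  rw [tb_topsub' (enc_lt Q) (lit_lt (pl_mem j) hl), tb_lit_enc hl, ← compl_val]
  simp [Fin.ext_iff]

theorem tb_ndm (v Q : W 5) (c : ℕ) : tb (ndm (enc v) c) (enc Q) = true ↔ tb c (enc Q) = true ∧ Nd v Q := by
  unfold ndm
  rw [tb_fold_land (fun p => ndl p (dg p (enc v)))]
  apply and_congr_right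
  intro _
  constructor
  · intro h j
    have := h _ (pl_mem j)
    rw [dg_enc] at this
    exact (tb_ndl v Q).1 this
  · intro h p hp
    obtain ⟨j, rfl⟩ := mem_ps hp
    rw [dg_enc]
    exact (tb_ndl v Q).2 (h j)

theorem tb_rest {v Q : W 5} {xs : List ℕ} (h : ∀ x ∈ xs, ∃ P, enc P = x ∧ ∀ j, P j ≠ v j → Q j ≠ v j → Q j = P j ∨ Q j = compl6 (P j)) :
    tb (rest (enc v) xs) (enc Q) = true := by
  have key : ∀ j c, tb c (enc Q) = true → tb (fold (fun x c => Nat.land c (rl (pl j) (dg (pl j) (enc v)) (dg (pl j) x))) c xs) (enc Q) = true := by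
    intro j c hc
    rw [tb_fold_land (fun x => rl (pl j) (dg (pl j) (enc v)) (dg (pl j) x))]
    refine ⟨hc, fun x hx => ?_⟩
    obtain ⟨P, rfl, hP⟩ := h x hx
    rw [dg_enc, dg_enc]
    unfold rl
    rw [sel_eq]
    split_ifs with e
    · exact tb_top (enc_lt Q)
    · have hj : P j ≠ v j := fun h => e (by rw [h]; simp)
      rw [tb_lor, tb_lor, tb_lit_enc (v j).isLt, tb_lit_enc (P j).isLt, tb_lit_enc (xor_lt _ (P j).isLt), ← compl_val]
      by_cases hq : Q j = v j
      · simp [hq]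
      · rcases hP j hj hq with h | h <;> simp [h]
  have e : rest (enc v) xs = fold (fun p c => fold (fun x c => Nat.land c (rl p (dg p (enc v)) (dg p x))) c xs) top [pl 0, pl 1, pl 2, pl 3, pl 4] := rfl
  rw [e, fold_cons, fold_cons, fold_cons, fold_cons, fold_cons, fold_nil]
  exact key _ _ (key _ _ (key _ _ (key _ _ (key _ _ (tb_top (enc_lt Q))))))

theorem tb_cand0 {C : List ℕ} {Q : W 5} (h0 : Dich u0 Q) (h : ∀ x ∈ C, ∃ P, enc P = x ∧ Gd P Q) : tb (cand0 C) (enc Q) = true := by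
  have e : ∀ m, tb (Nat.shiftLeft (Nat.shiftRight m 64) 64) (enc Q) = tb m (enc Q) := by
    intro m
    show Nat.testBit ((m >>> 64) <<< 64) _ = _
    rw [Nat.testBit_shiftLeft, Nat.testBit_shiftRight]
    simp [tb]
  unfold cand0
  rw [e, tb_fold_land]
  refine ⟨by rw [← enc_u0, tb_dm]; exact h0, fun x hx => ?_⟩
  obtain ⟨P, rfl, hP⟩ := h x hx
  exact (tb_gm P Q).2 hP

structure VX (C : Finset (W 5)) (v : W 5) (X : Finset (W 5)) : Prop where
  gd : Gd u0 v
  nv : v ∉ C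
  nx : v ∉ X
  xd : ∀ Q ∈ X, Dich u0 Q
  xc : ∀ Q ∈ X, ∀ P ∈ C, Gd P Q
  cov : IsCov v (C.filter (Nd v ·) ∪ X)
  tf : TF (C.filter (Nd v ·) ∪ X)
  c9 : X.card + C.card ≤ 9
  cm : (C.filter (Nd v ·)).card + X.card ≤ C.card

theorem VX.disj {C X : Finset (W 5)} {v : W 5} (h : VX C v X) : Disjoint (C.filter (Nd v ·)) X := by
  rw [Finset.disjoint_left]
  intro P hP hX
  exact (h.xc P hX P (Finset.mem_filter.1 hP).1).1.ne rfl

theorem VX.boo {C X : Finset (W 5)} {v : W 5} (h : VX C v X) (hc : C.card ≤ 8) : Boo v (C.filter (Nd v ·) ∪ X) := by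
  apply boo5 _ h.cov h.tf
  · rw [Finset.mem_union, Finset.mem_filter]
    rintro (e | e)
    · exact h.nv e.1
    · exact h.nx e
  · have := Finset.card_union_le (C.filter (Nd v ·)) X
    have := h.cm
    omega

theorem VX.c4 {C X : Finset (W 5)} {v : W 5} (h : VX C v X) : C.card - 4 ≤ (C.filter (Nd v ·)).card := by
  have := five h.cov h.tf (by
    rw [Finset.mem_union, Finset.mem_filter]
    rintro (e | e)
    · exact h.nv e.1
    · exact h.nx e)
  have := Finset.card_union_le (C.filter (Nd v ·)) X
  have := h.c9
  omega

theorem leaf_ok {C X : Finset (W 5)} {v : W 5} (h : VX C v X) {r sh : List ℕ} (hr : ∀ Q, Q ∈ C ↔ enc Q ∈ r) (hr7 : ∀ x ∈ r, x < 7776)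
    (hn : C.card = r.length) (hc8 : C.card ≤ 8) (hsn : sh.Nodup) (hsr : ∀ x ∈ sh, x ∈ r) (hs : ∀ Q, enc Q ∈ sh ↔ Q ∈ C ∧ Nd v Q) :
    ∃ Y, (enc v, Y) ∈ leaf2 r.length r (cand0 r) (enc v) sh ∧ ∀ Q, Q ∈ X ↔ enc Q ∈ Y := by
  have hlen : sh.length = (C.filter (Nd v ·)).card := by
    rw [← List.toFinset_card_of_nodup hsn, ← Finset.card_image_of_injective _ enc_inj']
    congr 1
    ext x
    rw [Finset.mem_image, List.mem_toFinset]
    constructor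
    · intro hx
      have e := enc_dec (hr7 x (hsr x hx))
      exact ⟨dec x, Finset.mem_filter.2 ((hs _).1 (by rwa [e])), e⟩
    · rintro ⟨Q, hQ, rfl⟩
      exact (hs Q).2 (Finset.mem_filter.1 hQ)
  have hsh : ∀ x ∈ sh, ∃ P ∈ C.filter (Nd v ·), enc P = x := by
    intro x hx
    have e := enc_dec (hr7 x (hsr x hx))
    exact ⟨dec x, Finset.mem_filter.2 ((hs _).1 (by rwa [e])), e⟩
  have hboo := h.boo hc8
  have hrest : ∀ Q ∈ C.filter (Nd v ·) ∪ X, tb (rest (enc v) sh) (enc Q) = true := by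
    intro Q hQ
    apply tb_rest
    intro x hx
    obtain ⟨P, hP, rfl⟩ := hsh x hx
    exact ⟨P, rfl, hboo P (Finset.mem_union_left _ hP) Q hQ⟩
  have hsl := tb_slt (enc_lt v)
  obtain ⟨Y, h1, h2, h3, h4⟩ := run_full (js := ps) (fun p hp => hp) (by decide) (fun p hp => hp) (v := v) (X := X) (L := sh)
    h.cov h.tf Finset.subset_union_right (k := Nat.sub (mn (Nat.sub 9 r.length) (Nat.sub r.length (len sh))) 1)
    (cand := sel (Nat.beq (mn (Nat.sub 9 r.length) (Nat.sub r.length (len sh))) 0) 0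
      (Nat.xor (slt (enc v)) (ndm (enc v) (Nat.land (cand0 r) (rest (enc v) sh)))))
    (ch := Nat.xor (slt (enc v)) (orb sh))
    (by
      intro Q
      rw [Finset.mem_union, Finset.mem_filter, hs])
    (by
      have := h.c9; have := h.cm
      rw [len_eq, hlen]
      show X.card ≤ (mn (9 - r.length) (r.length - _) - 1) + 1
      unfold mn; rw [sel_eq]; split_ifs <;> omega)
    (by
      intro Q hQ
      have hk : ¬ (Nat.beq (mn (Nat.sub 9 r.length) (Nat.sub r.length (len sh))) 0 = true) := by
        have : 0 < X.card := Finset.card_pos.2 ⟨Q, hQ⟩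
        have := h.c9; have := h.cm
        intro e
        have e := Nat.eq_of_beq_eq_true e
        rw [len_eq, hlen] at e
        have e : mn (9 - r.length) (r.length - (C.filter (Nd v ·)).card) = 0 := e
        unfold mn at e; rw [sel_eq] at e; split_ifs at e <;> omega
      rw [sel_eq, if_neg hk, tb_xor, hsl, Bool.false_xor, tb_ndm, tb_land, Bool.and_eq_true]
      refine ⟨⟨tb_cand0 (h.xd Q hQ) ?_, hrest Q (Finset.mem_union_right _ hQ)⟩, h.cov.nd Q (Finset.mem_union_right _ hQ)⟩
      intro x hx
      have e := enc_dec (hr7 x hx)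
      exact ⟨dec x, e, h.xc Q hQ _ ((hr _).2 (by rwa [e]))⟩)
    (by intro Q; rw [tb_xor, hsl, Bool.false_xor, tb_orb])
    (by intro x; rw [tb_xor, hsl, Bool.false_xor, tb_orb]; exact id)
    (fun x hx => hr7 x (hsr x hx)) []
  rw [List.append_nil] at h1
  refine ⟨Y, ?_, fun Q => ⟨fun hQ => ?_, h4 Q⟩⟩
  · unfold leaf2
    rw [sel_eq, if_pos (show mem (gm U0) (enc v) = true from (mem_iff _ _).2 ((tb_gm u0 v).2 h.gd)), sel_eq, if_neg (by rw [mem_iff, tb_orb, ← hr]; exact h.nv)]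
    rw [force_eq, force_eq, sel_eq, if_pos, force_eq, force_eq, force_eq, fmap_eq, List.mem_flatMap]
    · exact ⟨Y, h1, List.mem_singleton_self _⟩
    · have : Nat.land (orb sh) (rest (enc v) sh) = orb sh := by
        apply Nat.eq_of_testBit_eq
        intro i
        show Nat.testBit (orb sh &&& rest (enc v) sh) i = _
        rw [Nat.testBit_land]
        by_cases hi : i < 64
        · rw [orb_low _ _ hi]; rfl
        · obtain ⟨x, rfl⟩ := Nat.exists_eq_add_of_le (not_lt.1 hi)
          show (tb (orb sh) x && tb (rest (enc v) sh) x) = tb (orb sh) x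
          by_cases hx : x ∈ sh
          · obtain ⟨P, hP, rfl⟩ := hsh x hx
            rw [hrest P (Finset.mem_union_left _ hP), Bool.and_true]
          · have : tb (orb sh) x = false := by rw [← Bool.not_eq_true, tb_orb]; exact hx
            rw [this]; rfl
      rw [this]; simp
  · rcases h3 Q hQ with e | e
    · exact e
    · exact absurd rfl (h.xc Q hQ Q ((hs Q).1 e).1).1.ne

theorem vgo_ok {β : Type} {m : ℕ} {lets : ℕ → List ℕ} {leaf : ℕ → List ℕ → List β} {l : ℕ → ℕ} {z : β} (js : List ℕ) :
    ∀ (x : ℕ) (sh : List ℕ), (∀ p ∈ js, l p ∈ lets p) →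
    m ≤ (js.foldl (fun s p => s.filter (fun y => sel (Nat.beq (dg p y) (Nat.xor (l p) 1)) false true)) sh).length →
    z ∈ leaf (js.foldl (fun x p => x + l p * p) x) (js.foldl (fun s p => s.filter (fun y => sel (Nat.beq (dg p y) (Nat.xor (l p) 1)) false true)) sh) →
    z ∈ vgo m lets leaf js x sh := by
  have hle : ∀ (js : List ℕ) (sh : List ℕ), (js.foldl (fun s p => s.filter (fun y => sel (Nat.beq (dg p y) (Nat.xor (l p) 1)) false true)) sh).length ≤ sh.length := by
    intro js
    induction js with
    | nil => intro sh; exact le_rfl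
    | cons p t ih => intro sh; exact (ih _).trans (List.length_filter_le _ _)
  induction js with
  | nil => intro x sh _ _ h; exact h
  | cons p t ih =>
    intro x sh hl hm hz
    show z ∈ fmap (fun l => (fun sh' => sel (Nat.ble m (len sh')) (force (Nat.add x (Nat.mul l p)) fun v' => vgo m lets leaf t v' sh') [])
       (flt (fun x => sel (Nat.beq (dg p x) (Nat.xor l 1)) false true) sh)) (lets p)
    rw [fmap_eq, List.mem_flatMap]
    refine ⟨l p, hl p List.mem_cons_self, ?_⟩
    beta_reduce
    rw [flt_eq, sel_eq, len_eq, force_eq, if_pos]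
    · exact ih _ _ (fun q hq => hl q (List.mem_cons_of_mem _ hq)) hm hz
    · rw [Nat.ble_eq]; exact hm.trans (hle t _)

noncomputable section
def triv (p : ℕ) (C : List ℕ) : Bool := all (fun x => Nat.beq (dg p x) 2) C
end

theorem stage2_ok {C X : Finset (W 5)} {v : W 5} (h : VX C v X) {r : List ℕ} (hr : ∀ Q, Q ∈ C ↔ enc Q ∈ r) (hrr : r ∈ repl)
    (hl : ∀ j, (v j).val ∈ sel (triv (pl j) r) [2, 3, 4] [0, 1, 2, 3, 4]) :
    ∃ Y, (enc v, Y) ∈ stage2 r.length r ∧ ∀ Q, Q ∈ X ↔ enc Q ∈ Y := by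
  obtain ⟨hnd, hr7⟩ := repl_ok r hrr
  have hn := rep_card hrr hr
  have hc8 : C.card ≤ 8 := by rw [hn]; clear hr hn hr7 hnd hl; revert r; decide
  let G : ℕ → List ℕ → List ℕ := fun p s => s.filter (fun y => sel (Nat.beq (dg p y) (Nat.xor (dg p (enc v)) 1)) false true)
  have hG : ∀ j s Q, enc Q ∈ G (pl j) s ↔ enc Q ∈ s ∧ Q j ≠ compl6 (v j) := by
    intro j s Q
    simp only [G, List.mem_filter]
    apply and_congr_right; intro _
    rw [dg_enc, dg_enc, ← compl_val, sel_eq, ne_eq, Fin.ext_iff]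
    by_cases e : (Q j).val = (compl6 (v j)).val
    · simp [e]
    · rw [if_neg (fun h => e (Nat.eq_of_beq_eq_true h))]; simp [e]
  have hGs : ∀ p s x, x ∈ G p s → x ∈ s := fun p s x hx => (List.mem_filter.1 hx).1
  have hGn : ∀ p s, s.Nodup → (G p s).Nodup := fun p s hs => hs.filter _
  have hsl : ∀ x ∈ G (pl 4) (G (pl 3) (G (pl 2) (G (pl 1) (G (pl 0) r)))), x ∈ r :=
    fun x hx => hGs _ _ _ (hGs _ _ _ (hGs _ _ _ (hGs _ _ _ (hGs _ _ _ hx))))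
  have hsn := hGn (pl 4) _ (hGn (pl 3) _ (hGn (pl 2) _ (hGn (pl 1) _ (hGn (pl 0) _ hnd))))
  have hs : ∀ Q, enc Q ∈ G (pl 4) (G (pl 3) (G (pl 2) (G (pl 1) (G (pl 0) r)))) ↔ Q ∈ C ∧ Nd v Q := by
    intro Q
    rw [hG, hG, hG, hG, hG, ← hr]
    unfold Nd
    constructor
    · rintro ⟨⟨⟨⟨⟨a, h0⟩, h1⟩, h2⟩, h3⟩, h4⟩
      refine ⟨a, fun j => ?_⟩
      fin_cases j <;> assumption
    · rintro ⟨a, h⟩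
      exact ⟨⟨⟨⟨⟨a, h 0⟩, h 1⟩, h 2⟩, h 3⟩, h 4⟩
  obtain ⟨Y, hY, hX⟩ := leaf_ok h hr hr7 hn hc8 hsn hsl hs
  refine ⟨Y, ?_, hX⟩
  unfold stage2
  rw [force_eq]
  apply vgo_ok (l := fun p => dg p (enc v))
  · intro p hp
    obtain ⟨j, rfl⟩ := mem_ps hp
    rw [dg_enc]
    exact hl j
  · show r.length - 4 ≤ (G (pl 4) (G (pl 3) (G (pl 2) (G (pl 1) (G (pl 0) r))))).length
    have := h.c4
    rw [hn] at this
    refine this.trans (le_of_eq ?_)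
    rw [← List.toFinset_card_of_nodup hsn, ← Finset.card_image_of_injective _ enc_inj']
    congr 1
    ext x
    rw [Finset.mem_image, List.mem_toFinset]
    constructor
    · rintro ⟨Q, hQ, rfl⟩
      exact (hs Q).2 (Finset.mem_filter.1 hQ)
    · intro hx
      have e := enc_dec (hr7 x (hsl x hx))
      exact ⟨dec x, Finset.mem_filter.2 ((hs _).1 (by rwa [e])), e⟩
  · have e : ps.foldl (fun x p => x + dg p (enc v) * p) 0 = enc v := by
      show 0 + dg (pl 0) (enc v) * 1 + dg (pl 1) (enc v) * 6 + dg (pl 2) (enc v) * 36 + dg (pl 3) (enc v) * 216 + dg (pl 4) (enc v) * 1296 = _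
      simp only [dg_enc]; unfold enc; ring
    rw [e]
    exact hY

end Cov
namespace Cov

def q0 : List ℕ := [3096, 3037, 3030, 3061, 3068]
def e0 : List (ℕ × List ℕ) := [(441, [451, 4335, 4338]), (450, [540, 4410, 4434]), (471, [540, 4395, 4429]), (487, [477, 4359, 4376]), (541, [451, 4375, 4441]), (546,
  [477, 4329, 4436]), (1737, [1747, 4335, 4338]), (1746, [1836, 4410, 4434]), (1767, [1836, 4395, 4429]), (1783, [1773, 4359, 4376]), (1837,
  [1747, 4375, 4441]), (1842, [1773, 4329, 4436]), (2601, [2611, 3255, 3258]), (2610, [2700, 3330, 3354]), (2631, [2700, 3315, 3349]), (2647,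
  [2637, 3279, 3296]), (2701, [2611, 3295, 3361]), (2706, [2637, 3249, 3356]), (2817, [2827, 3255, 3258]), (2826, [2916, 3330, 3354]), (2847,
  [2916, 3315, 3349]), (2863, [2853, 3279, 3296]), (2917, [2827, 3295, 3361]), (2922, [2853, 3249, 3356]), (3465, [3255, 3258, 3475]), (3474,
  [3330, 3354, 3564]), (3495, [3315, 3349, 3564]), (3511, [3279, 3296, 3501]), (3565, [3295, 3361, 3475]), (3570, [3249, 3356, 3501]), (3681,
  [3255, 3258, 3691]), (3690, [3330, 3354, 3780]), (3711, [3315, 3349, 3780]), (3727, [3279, 3296, 3717]), (3781, [3295, 3361, 3691]), (3786,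
  [3249, 3356, 3717]), (5625, [4335, 4338, 5635]), (5634, [4410, 4434, 5724]), (5655, [4395, 4429, 5724]), (5671, [4359, 4376, 5661]), (5725,
  [4375, 4441, 5635]), (5730, [4329, 4436, 5661]), (6921, [4335, 4338, 6931]), (6930, [4410, 4434, 7020]), (6951, [4395, 4429, 7020]), (6967,
  [4359, 4376, 6957]), (7021, [4375, 4441, 6931]), (7026, [4329, 4436, 6957])]
def q1 : List ℕ := [3108, 3025, 2671, 2629, 2815, 2857]
def e1 : List (ℕ × List ℕ) := [(55, [115, 3979, 3997]), (109, [649, 4429, 4573]), (235, [649, 4339, 4543]), (331, [271, 4123, 4225]), (655, [115, 4219, 4615]), (685, [271,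
  3943, 4585]), (1351, [1411, 3979, 3997]), (1405, [1945, 4429, 4573]), (1531, [1945, 4339, 4543]), (1627, [1567, 4123, 4225]), (1951, [1411,
  4219, 4615]), (1981, [1567, 3943, 4585]), (2648, [2682, 2700, 2708]), (2649, [2682, 2700, 2709]), (2650, [2682, 2700, 2710]), (2651, [2682,
  2700, 2711]), (2702, [3132, 3242, 3276]), (2703, [3132, 3243, 3276]), (2704, [3132, 3244, 3276]), (2705, [3132, 3245, 3276]), (2828, [3042,
  3242, 3246]), (2829, [3042, 3243, 3246]), (2830, [3042, 3244, 3246]), (2831, [3042, 3245, 3246]), (2924, [2826, 2864, 2928]), (2925, [2826,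
  2865, 2928]), (2926, [2826, 2866, 2928]), (2927, [2826, 2867, 2928]), (3248, [2708, 2922, 3318]), (3249, [2709, 2922, 3318]), (3250, [2710,
  2922, 3318]), (3251, [2711, 2922, 3318]), (3278, [2646, 2864, 3288]), (3279, [2646, 2865, 3288]), (3280, [2646, 2866, 3288]), (3281, [2646,
  2867, 3288]), (5239, [3979, 3997, 5299]), (5293, [4429, 4573, 5833]), (5419, [4339, 4543, 5833]), (5515, [4123, 4225, 5455]), (5839, [4219,
  4615, 5299]), (5869, [3943, 4585, 5455]), (6535, [3979, 3997, 6595]), (6589, [4429, 4573, 7129]), (6715, [4339, 4543, 7129]), (6811, [4123,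
  4225, 6751]), (7135, [4219, 4615, 6595]), (7165, [3943, 4585, 6751])]
def q2 : List ℕ := [3108, 3097, 2599, 475, 223, 1339, 1591]
def e2 : List (ℕ × List ℕ) := [(3115, [])]
def q3 : List ℕ := [3096, 3037, 3030, 2641, 2634, 2845, 2852]
def e3 : List (ℕ × List ℕ) := [(698, [3276, 4586]), (1994, [3276, 4586]), (2679, [3255, 3276]), (2682, [3258, 3276]), (3099, [2683, 2827]), (3133, [2719, 2827]), (3140,
  [2719, 2827]), (3290, [3276]), (3362, [3254, 3276]), (3398, [3254, 3276]), (3434, [3254, 3276]), (5882, [3276, 4586]), (7178, [3276, 4586])]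
def q4 : List ℕ := [3096, 3037, 2670, 2814, 2852, 2641, 2845]
def e4 : List (ℕ × List ℕ) := [(2936, [2827, 2916]), (3039, [2712, 2916]), (3042, [2718, 2916]), (3099, [2683, 2827]), (3133, [2719, 2827])]
def q5 : List ℕ := [3108, 3025, 2671, 2629, 265, 1549, 1591, 223]
def e5 : List (ℕ × List ℕ) := [(4189, [4105])]
def q6 : List ℕ := [3108, 3025, 2671, 469, 1333, 1561, 295, 1519]
def e6 : List (ℕ × List ℕ) := []
def q7 : List ℕ := [3096, 3025, 2641, 2845, 2600, 3066, 2814, 2887]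
def e7 : List (ℕ × List ℕ) := []
def q8 : List ℕ := [3024, 2665, 2640, 2600, 3067, 2821, 2886, 2846]
def e8 : List (ℕ × List ℕ) := []
def RR : List (List ℕ × List (ℕ × List ℕ)) := [(q0, e0), (q1, e1), (q2, e2), (q3, e3), (q4, e4), (q5, e5), (q6, e6), (q7, e7), (q8, e8)]
theorem repl_RR : repl = RR.map Prod.fst := rfl
noncomputable section
def inR (a m : ℕ) (R : List (ℕ × List ℕ)) : Bool := List.rec false (fun e _ ih => sel (Nat.beq a e.1) (sel (Nat.beq m (orb e.2)) true ih) ih) R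
def ck (n : ℕ) (r : List ℕ) (R : List (ℕ × List ℕ)) : Bool := all (fun e => force (orb e.2) fun m => inR e.1 m R) (stage2 n r)
def cl (r : List ℕ) (R : List (ℕ × List ℕ)) : Bool := all (fun p => all (fun e =>
  sel (force (orb (mp (lpc f45 p) e.2)) fun m => inR (lpc f45 p e.1) m R)
    (sel (triv p r) (force (orb (mp (lpc f04 p) e.2)) fun m => inR (lpc f04 p e.1) m R) true) false) R) ps
end
theorem k0 : ck 5 q0 e0 = true := by decide +kernel
theorem l0 : cl q0 e0 = true := by decide +kernel
theorem k1 : ck 6 q1 e1 = true := by decide +kernel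
theorem l1 : cl q1 e1 = true := by decide +kernel
theorem k2 : ck 7 q2 e2 = true := by decide +kernel
theorem l2 : cl q2 e2 = true := by decide +kernel
theorem k3 : ck 7 q3 e3 = true := by decide +kernel
theorem l3 : cl q3 e3 = true := by decide +kernel
theorem k4 : ck 7 q4 e4 = true := by decide +kernel
theorem l4 : cl q4 e4 = true := by decide +kernel
theorem k5 : ck 8 q5 e5 = true := by decide +kernel
theorem l5 : cl q5 e5 = true := by decide +kernel
theorem k6 : ck 8 q6 e6 = true := by decide +kernel
theorem l6 : cl q6 e6 = true := by decide +kernel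
theorem k7 : ck 8 q7 e7 = true := by decide +kernel
theorem l7 : cl q7 e7 = true := by decide +kernel
theorem k8 : ck 8 q8 e8 = true := by decide +kernel
theorem l8 : cl q8 e8 = true := by decide +kernel
end Cov
namespace Cov

theorem VX.iso {C X : Finset (W 5)} {v : W 5} (h : VX C v X) {f : W 5 → W 5} (hf : IsoF f) (f0 : f u0 = u0) (fc : ∀ P ∈ C, f P = P) :
    VX C (f v) (X.image f) := by
  have eC : C.image f = C := by
    ext Q
    rw [Finset.mem_image]
    constructor
    · rintro ⟨P, hP, rfl⟩; rw [fc P hP]; exact hP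
    · intro hQ; exact ⟨Q, hQ, fc Q hQ⟩
  have eF : C.filter (Nd (f v) ·) = (C.filter (Nd v ·)).image f := by
    conv_lhs => rw [← eC]
    exact hf.filter v C
  have gdi : ∀ {a b}, Gd (f a) (f b) ↔ Gd a b := by
    intro a b; unfold Gd; rw [hf.dich, hf.twin]
  refine ⟨?_, ?_, hf.not_mem h.nx, ?_, ?_, ?_, ?_, ?_, ?_⟩
  · rw [← f0]; exact gdi.2 h.gd
  · have := hf.not_mem h.nv; rwa [eC] at this
  · intro Q hQ
    obtain ⟨P, hP, rfl⟩ := Finset.mem_image.1 hQ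
    rw [← f0]; exact hf.dich.2 (h.xd P hP)
  · intro Q hQ P hP
    obtain ⟨Q, kQ, rfl⟩ := Finset.mem_image.1 hQ
    rw [← fc P hP]; exact gdi.2 (h.xc Q kQ P hP)
  · rw [eF, ← Finset.image_union]; exact hf.cov h.cov
  · rw [eF, ← Finset.image_union]; exact hf.tf h.tf
  · rw [Finset.card_image_of_injective _ hf.inj]; exact h.c9
  · rw [eF, Finset.card_image_of_injective _ hf.inj, Finset.card_image_of_injective _ hf.inj]; exact h.cm

theorem inR_ok {a m : ℕ} {R : List (ℕ × List ℕ)} (h : inR a m R = true) : ∃ e ∈ R, a = e.1 ∧ m = orb e.2 := by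
  induction R with
  | nil => exact absurd h (by simp [inR])
  | cons e t ih =>
    have e1 : inR a m (e :: t) = sel (Nat.beq a e.1) (sel (Nat.beq m (orb e.2)) true (inR a m t)) (inR a m t) := rfl
    rw [e1, sel_eq, sel_eq] at h
    have tl : inR a m t = true → ∃ e' ∈ e :: t, a = e'.1 ∧ m = orb e'.2 := by
      intro h
      obtain ⟨e', h1, h2⟩ := ih h
      exact ⟨e', List.mem_cons_of_mem _ h1, h2⟩
    split_ifs at h with h1 h2
    · exact ⟨e, List.mem_cons_self, Nat.eq_of_beq_eq_true h1, Nat.eq_of_beq_eq_true h2⟩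
    · exact tl h
    · exact tl h

def InR (v : W 5) (X : Finset (W 5)) (R : List (ℕ × List ℕ)) : Prop := ∃ e ∈ R, e.1 = enc v ∧ ∀ Q, Q ∈ X ↔ enc Q ∈ e.2

theorem InR.back {v : W 5} {X : Finset (W 5)} {R : List (ℕ × List ℕ)} (hR : ∀ e ∈ R, ∀ x ∈ e.2, x < 7776) (j : Fin 5) {π : Fin 6 → Fin 6}
    {f : ℕ → ℕ} (hb : ∀ l, π (π l) = l) (hf : ∀ l, (π l).val = f l.val)
    (hc : ∀ e ∈ R, inR (lpc f (pl j) e.1) (orb (mp (lpc f (pl j)) e.2)) R = true)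
    (h : InR (Function.update v j (π (v j))) (X.image (fun v => Function.update v j (π (v j)))) R) : InR v X R := by
  obtain ⟨e, he, h1, h2⟩ := h
  obtain ⟨e', he', k1, k2⟩ := inR_ok (hc e he)
  let g : W 5 → W 5 := fun v => Function.update v j (π (v j))
  have hg : ∀ w, g (g w) = w := by intro w; simp [g, hb]
  have hl : ∀ w, enc (g w) = lpc f (pl j) (enc w) := fun w => enc_lp w j π f hf
  have h2 : ∀ Q, Q ∈ X.image g ↔ enc Q ∈ e.2 := h2
  have h1 : e.1 = enc (g v) := h1
  refine ⟨e', he', ?_, fun Q => ?_⟩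
  · rw [← k1, h1, ← hl, hg]
  · rw [← orb_mem_iff k2, mp_eq, List.mem_map]
    constructor
    · intro hQ
      refine ⟨enc (g Q), (h2 _).1 (Finset.mem_image_of_mem g hQ), ?_⟩
      rw [← hl, hg]
    · rintro ⟨x, hx, hxe⟩
      have ex := enc_dec (hR e he x hx)
      rw [← ex] at hx hxe
      rw [← hl] at hxe
      have := (h2 _).2 hx
      obtain ⟨P, hP, e2⟩ := Finset.mem_image.1 this
      rw [← enc_inj hxe, ← e2, hg]; exact hP

theorem p45_p45 : ∀ l, p45 (p45 l) = l := by decide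
theorem p04_p04 : ∀ l, p04 (p04 l) = l := by decide

theorem ent0 {C : Finset (W 5)} {r : List ℕ} {R : List (ℕ × List ℕ)} (hr : ∀ Q, Q ∈ C ↔ enc Q ∈ r) (hrr : r ∈ repl)
    (hb3 : ∀ x ∈ r, ∀ p ∈ ps, dg p x ≤ 2) (hR : ∀ e ∈ R, ∀ x ∈ e.2, x < 7776) (hck : ck r.length r R = true) (hcl : cl r R = true)
    {v : W 5} {X : Finset (W 5)} (h : VX C v X) : InR v X R := by
  have c1 : ∀ j, ∀ e ∈ R, inR (lpc f45 (pl j) e.1) (orb (mp (lpc f45 (pl j)) e.2)) R = true ∧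
      (triv (pl j) r = true → inR (lpc f04 (pl j) e.1) (orb (mp (lpc f04 (pl j)) e.2)) R = true) := by
    intro j e he
    unfold cl at hcl
    rw [all_eq, List.all_eq_true] at hcl
    have := hcl _ (pl_mem j)
    rw [all_eq, List.all_eq_true] at this
    have := this e he
    simp only [force_eq, sel_eq] at this
    split_ifs at this with a b
    · exact ⟨a, fun _ => this⟩
    · exact ⟨a, fun h => absurd h b⟩
  have a45 : ∀ v : W 5, ∀ j, (∀ X, VX C (Function.update v j (p45 (v j))) X → InR (Function.update v j (p45 (v j))) X R) → ∀ X, VX C v X → InR v X R := by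
    intro v j H X hX
    refine InR.back hR j p45_p45 p45_v (fun e he => (c1 j e he).1) (H _ (hX.iso (isoF_lp j p45 p45_b p45_c) ?_ ?_))
    · funext i; by_cases hi : i = j
      · subst hi; simp [u0]; decide
      · simp [hi]
    · intro P hP
      have := hb3 _ ((hr P).1 hP) _ (pl_mem j)
      rw [dg_enc] at this
      have : p45 (P j) = P j := by
        generalize P j = l at *; revert l; decide
      rw [this, Function.update_eq_self]
  have a04 : ∀ v : W 5, ∀ j, triv (pl j) r = true → (∀ X, VX C (Function.update v j (p04 (v j))) X → InR (Function.update v j (p04 (v j))) X R) → ∀ X, VX C v X → InR v X R := by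
    intro v j ht H X hX
    refine InR.back hR j p04_p04 p04_v (fun e he => (c1 j e he).2 ht) (H _ (hX.iso (isoF_lp j p04 p04_b p04_c) ?_ ?_))
    · funext i; by_cases hi : i = j
      · subst hi; simp [u0]; decide
      · simp [hi]
    · intro P hP
      unfold triv at ht
      rw [all_eq, List.all_eq_true] at ht
      have := Nat.eq_of_beq_eq_true (ht _ ((hr P).1 hP))
      rw [dg_enc] at this
      have : p04 (P j) = P j := by
        generalize P j = l at *; revert l; decide
      rw [this, Function.update_eq_self]
  have key : ∀ k, ∀ v : W 5, (∀ j : Fin 5, k ≤ j.val → (v j).val ∈ sel (triv (pl j) r) [2, 3, 4] [0, 1, 2, 3, 4]) → ∀ X, VX C v X → InR v X R := by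
    intro k
    induction k with
    | zero =>
      intro v hv X hX
      obtain ⟨Y, hY, hQ⟩ := stage2_ok hX hr hrr (fun j => hv j (Nat.zero_le _))
      unfold ck at hck
      rw [all_eq, List.all_eq_true] at hck
      have := hck _ hY
      rw [force_eq] at this
      obtain ⟨e, he, h1, h2⟩ := inR_ok this
      exact ⟨e, he, h1.symm, fun Q => by rw [hQ, ← orb_mem_iff h2]⟩
    | succ k ih =>
      intro v hv
      by_cases hk : k < 5
      swap
      · exact ih v (fun j hj => absurd j.isLt (by omega))
      let j : Fin 5 := ⟨k, hk⟩
      have T : ∀ l : Fin 6, l.val ∈ sel (triv (pl j) r) [2, 3, 4] [0, 1, 2, 3, 4] → ∀ X, VX C (Function.update v j l) X → InR (Function.update v j l) X R := by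
        intro l hl
        apply ih
        intro i hi
        by_cases e : i = j
        · subst e; simpa using hl
        · rw [Function.update_of_ne e]
          apply hv
          have : i.val ≠ k := fun h => e (Fin.ext h)
          omega
      have b45 : ∀ l : Fin 6, (∀ X, VX C (Function.update v j (p45 l)) X → InR (Function.update v j (p45 l)) X R) → ∀ X, VX C (Function.update v j l) X → InR (Function.update v j l) X R := by
        intro l H
        apply a45 _ j
        simpa using H
      have b04 : triv (pl j) r = true → ∀ l : Fin 6, (∀ X, VX C (Function.update v j (p04 l)) X → InR (Function.update v j (p04 l)) X R) → ∀ X, VX C (Function.update v j l) X → InR (Function.update v j l) X R := by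
        intro ht l H
        apply a04 _ j ht
        simpa using H
      have hall : ∀ l : Fin 6, ∀ X, VX C (Function.update v j l) X → InR (Function.update v j l) X R := by
        by_cases ht : triv (pl j) r = true
        · rw [sel_eq, if_pos ht] at T
          have b04 := b04 ht
          have t4 := T 4 (by decide)
          have t5 := b45 5 t4
          intro l
          fin_cases l
          · exact b04 0 t4
          · exact b04 1 t5
          · exact T 2 (by decide)
          · exact T 3 (by decide)
          · exact t4
          · exact t5
        · rw [sel_eq, if_neg ht] at T
          have t4 := T 4 (by decide)
          intro l
          fin_cases l
          · exact T 0 (by decide)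
          · exact T 1 (by decide)
          · exact T 2 (by decide)
          · exact T 3 (by decide)
          · exact t4
          · exact b45 5 t4
      have := hall (v j)
      rwa [Function.update_eq_self] at this
  exact key 5 v (fun j hj => absurd j.isLt (by omega)) X h

theorem RR_lt : ∀ q ∈ RR, ∀ e ∈ q.2, ∀ x ∈ e.2, x < 7776 := by decide +kernel
theorem RR_b3 : ∀ q ∈ RR, ∀ x ∈ q.1, ∀ p ∈ ps, dg p x ≤ 2 := by decide +kernel
theorem RR_ck : ∀ q ∈ RR, ck q.1.length q.1 q.2 = true ∧ cl q.1 q.2 = true := by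
  intro q hq
  simp only [RR, List.mem_cons, List.not_mem_nil, or_false] at hq
  rcases hq with rfl | rfl | rfl | rfl | rfl | rfl | rfl | rfl | rfl
  · exact ⟨k0, l0⟩
  · exact ⟨k1, l1⟩
  · exact ⟨k2, l2⟩
  · exact ⟨k3, l3⟩
  · exact ⟨k4, l4⟩
  · exact ⟨k5, l5⟩
  · exact ⟨k6, l6⟩
  · exact ⟨k7, l7⟩
  · exact ⟨k8, l8⟩

theorem ent {C : Finset (W 5)} {q : List ℕ × List (ℕ × List ℕ)} (hq : q ∈ RR) (hr : ∀ Q, Q ∈ C ↔ enc Q ∈ q.1)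
    {v : W 5} {X : Finset (W 5)} (h : VX C v X) : InR v X q.2 :=
  ent0 hr (by rw [repl_RR]; exact List.mem_map_of_mem hq) (RR_b3 q hq) (RR_lt q hq) (RR_ck q hq).1 (RR_ck q hq).2 h

end Cov
namespace Cov
noncomputable section
def fw (q : List ℕ) (e : ℕ × List ℕ) : List (List ℕ) :=
  force (fold (fun x c => Nat.land c (gm x)) (Nat.land (dm U0) (dm e.1)) (app q e.2)) fun ca =>
  force (orb (app q e.2)) fun ch =>
  bloop (fun w => force (ndm w ca) fun ca => run 1 ca ch (pts w) []) 8000 (fold (fun x c => ndm x c) (Nat.land (gm U0) (gm e.1)) (app q e.2))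
def emp {α : Type} (xs : List α) : Bool := List.rec true (fun _ _ _ => false) xs
def L6 : List (ℕ × ℕ) := [(2679, 3290), (2682, 3290), (3133, 3140), (3140, 3133), (3290, 2679), (3290, 2682)]
def pq (q : List ℕ) (e e' : ℕ × List ℕ) : Bool := sel (mem (gm e.1) e'.1) (sel (Nat.ble (q ++ e.2 ++ e'.2).dedup.length 9)
   (sel (Nat.ble (q ++ e.2 ++ e'.2).dedup.length 8) false (decide ((e.1, e'.1) ∈ L6))) true) true
end
theorem fw_ok : all (fun q => all (fun e => emp (fw q.1 e)) q.2) RR = true := by decide +kernel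
theorem pq_ok : all (fun q => all (fun e => all (fun e' => pq q.1 e e') q.2) q.2) RR = true := by decide +kernel
theorem RR_l : ∀ q ∈ RR, ∀ e ∈ q.2, e.1 < 7776 ∧ 7 ≤ (q.1 ++ e.2).length ∧ (q.1 ++ e.2).Nodup ∧ ((q.1 ++ e.2).length ≤ 7 → q.1 = q2 ∧ e = (3115, [])) := by decide +kernel
theorem L6_tri : ∀ x ∈ L6, ∀ y ∈ L6, ∀ z ∈ L6, x.2 = y.1 → x.1 = z.1 → y.2 = z.2 → False := by decide

theorem pq_sem {q : List ℕ × List (ℕ × List ℕ)} (hq : q ∈ RR) {e e' : ℕ × List ℕ} (he : e ∈ q.2) (he' : e' ∈ q.2) {v w : W 5}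
    (h1 : e.1 = enc v) (h2 : e'.1 = enc w) (hg : Gd v w) (hc : (q.1 ++ e.2 ++ e'.2).toFinset.card ≤ 9) :
    8 < (q.1 ++ e.2 ++ e'.2).toFinset.card ∧ (e.1, e'.1) ∈ L6 := by
  have := pq_ok
  rw [all_eq, List.all_eq_true] at this
  have := this q hq
  rw [all_eq, List.all_eq_true] at this
  have := this e he
  rw [all_eq, List.all_eq_true] at this
  have := this e' he'
  unfold pq at this
  rw [List.card_toFinset] at hc ⊢
  rw [sel_eq, if_pos (by rw [mem_iff, h1, h2, tb_gm]; exact hg), sel_eq, if_pos (by rw [Nat.ble_eq]; exact hc), sel_eq] at this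
  split_ifs at this with h
  rw [Nat.ble_eq] at h
  exact ⟨by omega, of_decide_eq_true this⟩

theorem fw_sem {q : List ℕ × List (ℕ × List ℕ)} (hq : q ∈ RR) {e : ℕ × List ℕ} (he : e ∈ q.2) {v w : W 5} {C : Finset (W 5)}
    (h1 : e.1 = enc v) (hu : Gd u0 w) (hv : Gd v w) (hC : IsCov w C) (tf : TF C) (hc : C.card ≤ 9)
    (hD : ∀ x ∈ q.1 ++ e.2, ∃ Q ∈ C, enc Q = x) (hX : ∀ Q ∈ C, enc Q ∉ q.1 ++ e.2 → Dich u0 Q ∧ Dich v Q) : False := by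
  obtain ⟨l1, l2, l3, -⟩ := RR_l q hq e he
  have := fw_ok
  rw [all_eq, List.all_eq_true] at this
  have := this q hq
  rw [all_eq, List.all_eq_true] at this
  have hemp := this e he
  have l7 : ∀ x ∈ q.1 ++ e.2, x < 7776 := by
    intro x hx
    obtain ⟨Q, _, rfl⟩ := hD x hx
    exact enc_lt Q
  set L := q.1 ++ e.2 with hL
  let X := C.filter (fun Q => enc Q ∉ L)
  have hXc : X.card ≤ 1 + 1 := by
    have : (C.filter (fun Q => enc Q ∈ L)).card = L.length := by
      rw [← List.toFinset_card_of_nodup l3, ← Finset.card_image_of_injective _ enc_inj']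
      congr 1
      ext x
      simp only [Finset.mem_image, Finset.mem_filter, List.mem_toFinset]
      constructor
      · rintro ⟨Q, ⟨_, h⟩, rfl⟩; exact h
      · intro hx
        obtain ⟨Q, hQ, rfl⟩ := hD x hx
        exact ⟨Q, ⟨hQ, hx⟩, rfl⟩
    have h2 := Finset.card_filter_add_card_filter_not (s := C) (fun Q => enc Q ∈ L)
    have h3 : X.card = (C.filter (fun Q => ¬ enc Q ∈ L)).card := rfl
    omega
  obtain ⟨Y, hY, -⟩ := run_full (js := ps) (fun p hp => hp) (by decide) (fun p hp => hp) (v := w) (F := C) (X := X) (L := L) hC tf (Finset.filter_subset _ _)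
    (by
      intro Q
      simp only [X, Finset.mem_filter]
      constructor
      · intro h; by_cases h' : enc Q ∈ L
        · exact Or.inl h'
        · exact Or.inr ⟨h, h'⟩
      · rintro (h | h)
        · obtain ⟨P, hP, e⟩ := hD _ h
          rw [← enc_inj e]; exact hP
        · exact h.1)
    (k := 1) hXc (cand := ndm (enc w) (fold (fun x c => Nat.land c (gm x)) (Nat.land (dm U0) (dm e.1)) (app q.1 e.2))) (ch := orb (app q.1 e.2))
    (by
      intro Q hQ
      obtain ⟨hQC, hQL⟩ := Finset.mem_filter.1 hQ
      obtain ⟨d1, d2⟩ := hX Q hQC hQL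
      rw [tb_ndm, tb_fold_land gm, app_eq, tb_land, Bool.and_eq_true, h1, ← enc_u0, tb_dm, tb_dm]
      refine ⟨⟨⟨d1, d2⟩, fun x hx => ?_⟩, hC.nd Q hQC⟩
      obtain ⟨P, hP, rfl⟩ := hD x hx
      rw [tb_gm]
      exact ⟨hC.dich P hP Q hQC (fun e => hQL (by rw [← e]; exact hx)), tf P hP Q hQC⟩)
    (by intro Q; rw [tb_orb, app_eq])
    (by intro x; rw [tb_orb, app_eq]; exact id) l7 []
  have key : (Y ++ []) ∈ fw q.1 e := by
    unfold fw
    rw [force_eq, force_eq]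
    refine bloop_sound _ ((enc_lt w).trans (by norm_num)) (x := enc w) (by rw [force_eq]; exact hY) 8000 _ 0 (by simp) ?_ (by norm_num)
    rw [app_eq]
    have : ∀ (L : List ℕ) c, (∀ x ∈ L, ∃ Q ∈ C, enc Q = x) → tb c (enc w) = true → tb (fold (fun x c => ndm x c) c L) (enc w) = true := by
      intro L c
      induction L with
      | nil => intro _ h; exact h
      | cons x t ih =>
        intro h h'
        obtain ⟨P, hP, rfl⟩ := h x List.mem_cons_self
        rw [fold_cons, tb_ndm]
        exact ⟨ih (fun y hy => h y (List.mem_cons_of_mem _ hy)) h', (hC.nd P hP).symm⟩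
    apply this _ _ hD
    rw [tb_land, Bool.and_eq_true, h1, ← enc_u0, tb_gm, tb_gm]
    exact ⟨hu, hv⟩
  revert hemp key
  cases fw q.1 e with
  | nil => intro _ h; cases h
  | cons a t => intro h; exact absurd h (by simp [emp])

end Cov
namespace Cov

structure GP (U C : Finset (W d)) : Prop where
  ud : ∀ u ∈ U, ∀ v ∈ U, u ≠ v → Dich u v
  cd : ∀ u ∈ C, ∀ v ∈ C, u ≠ v → Dich u v
  ut : TF U
  ct : TF C
  dis : ∀ u ∈ U, u ∉ C
  cov : ∀ u ∈ U, IsCov u (C.filter (Nd u ·))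

theorem GP.iso {U C : Finset (W d)} (h : GP U C) {f : W d → W d} (hf : IsoF f) : GP (U.image f) (C.image f) := by
  have dd : ∀ F : Finset (W d), (∀ u ∈ F, ∀ v ∈ F, u ≠ v → Dich u v) → ∀ u ∈ F.image f, ∀ v ∈ F.image f, u ≠ v → Dich u v := by
    intro F H u hu v hv huv
    obtain ⟨u, ku, rfl⟩ := Finset.mem_image.1 hu
    obtain ⟨v, kv, rfl⟩ := Finset.mem_image.1 hv
    exact hf.dich.2 (H u ku v kv (fun e => huv (by rw [e])))
  refine ⟨dd U h.ud, dd C h.cd, hf.tf h.ut, hf.tf h.ct, ?_, ?_⟩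
  · intro u hu
    obtain ⟨u, ku, rfl⟩ := Finset.mem_image.1 hu
    exact hf.not_mem (h.dis u ku)
  · intro u hu
    obtain ⟨u, ku, rfl⟩ := Finset.mem_image.1 hu
    rw [hf.filter]; exact hf.cov (h.cov u ku)


abbrev cn (C : Finset (W d)) (u : W d) : ℕ := (C.filter (Nd u ·)).card

theorem GP.vx {U C : Finset (W 5)} (h : GP U C) {v : W 5} (hu : u0 ∈ U) (hv : v ∈ U) (hne : u0 ≠ v) (hm : cn C v ≤ cn C u0) (hc : C.card ≤ 9) :
    VX (C.filter (Nd u0 ·)) v (C.filter (fun Q => Nd v Q ∧ ¬ Nd u0 Q)) := by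
  have e1 : (C.filter (Nd u0 ·)).filter (Nd v ·) ∪ C.filter (fun Q => Nd v Q ∧ ¬ Nd u0 Q) = C.filter (Nd v ·) := by
    ext Q
    simp only [Finset.mem_union, Finset.mem_filter]
    tauto
  have e2 : Disjoint ((C.filter (Nd u0 ·)).filter (Nd v ·)) (C.filter (fun Q => Nd v Q ∧ ¬ Nd u0 Q)) := by
    rw [Finset.disjoint_left]
    intro Q
    simp only [Finset.mem_filter]
    tauto
  have e3 : Disjoint (C.filter (fun Q => Nd v Q ∧ ¬ Nd u0 Q)) (C.filter (Nd u0 ·)) := by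
    rw [Finset.disjoint_left]
    intro Q
    simp only [Finset.mem_filter]
    tauto
  refine ⟨⟨h.ud _ hu _ hv hne, h.ut _ hu _ hv⟩, ?_, ?_, ?_, ?_, ?_, ?_, ?_, ?_⟩
  · intro hh; exact h.dis v hv (Finset.mem_filter.1 hh).1
  · intro hh; exact h.dis v hv (Finset.mem_filter.1 hh).1
  · intro Q hQ; exact not_nd.1 (Finset.mem_filter.1 hQ).2.2
  · intro Q hQ P hP
    refine ⟨h.cd _ (Finset.mem_filter.1 hP).1 _ (Finset.mem_filter.1 hQ).1 ?_, h.ct _ (Finset.mem_filter.1 hP).1 _ (Finset.mem_filter.1 hQ).1⟩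
    rintro rfl
    exact (Finset.mem_filter.1 hQ).2.2 (Finset.mem_filter.1 hP).2
  · rw [e1]; exact h.cov v hv
  · rw [e1]; exact h.ct.mono (Finset.filter_subset _ _)
  · rw [← Finset.card_union_of_disjoint e3]
    refine (Finset.card_le_card ?_).trans hc
    exact Finset.union_subset (Finset.filter_subset _ _) (Finset.filter_subset _ _)
  · rw [← Finset.card_union_of_disjoint e2, e1]; exact hm

/-- normalised pair -/
structure NP (U C : Finset (W 5)) (q : List ℕ × List (ℕ × List ℕ)) : Prop where
  gp : GP U C
  hq : q ∈ RR
  hu : u0 ∈ U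
  hr : ∀ Q, Q ∈ C.filter (Nd u0 ·) ↔ enc Q ∈ q.1

theorem GP.norm {U C : Finset (W 5)} (h : GP U C) {u : W 5} (hu : u ∈ U) (hc : cn C u ≤ 8) :
    ∃ f, IsoF f ∧ f u = u0 ∧ ∃ q, NP (U.image f) (C.image f) q := by
  have tf : TF (C.filter (Nd u ·)) := h.ct.mono (Finset.filter_subset _ _)
  have nu : u ∉ C.filter (Nd u ·) := fun hh => h.dis u hu (Finset.mem_filter.1 hh).1
  obtain ⟨f, hf, f0, r, hr, H⟩ := cls (h.cov u hu) (boo5 hc (h.cov u hu) tf nu) tf nu hc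
  rw [repl_RR, List.mem_map] at hr
  obtain ⟨q, hq, rfl⟩ := hr
  refine ⟨f, hf, f0, q, h.iso hf, hq, ?_, ?_⟩
  · rw [← f0]; exact Finset.mem_image_of_mem _ hu
  · rw [← f0, hf.filter]; exact H

/-- entry for the word v -/
structure EN (C : Finset (W 5)) (q : List ℕ × List (ℕ × List ℕ)) (v : W 5) (e : ℕ × List ℕ) : Prop where
  he : e ∈ q.2
  h1 : e.1 = enc v
  h2 : ∀ Q, Q ∈ C.filter (fun Q => Nd v Q ∧ ¬ Nd u0 Q) ↔ enc Q ∈ e.2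

theorem NP.en {U C : Finset (W 5)} {q : List ℕ × List (ℕ × List ℕ)} (h : NP U C q) {v : W 5} (hv : v ∈ U) (hne : u0 ≠ v) (hm : cn C v ≤ cn C u0) (hc : C.card ≤ 9) :
    ∃ e, EN C q v e := by
  obtain ⟨e, he, h1, h2⟩ := ent h.hq h.hr (h.gp.vx h.hu hv hne hm hc)
  exact ⟨e, he, h1, h2⟩

theorem NP.mem {U C : Finset (W 5)} {q : List ℕ × List (ℕ × List ℕ)} (h : NP U C q) : ∀ x ∈ q.1, ∃ Q ∈ C, enc Q = x := by
  intro x hx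
  have := (repl_ok q.1 (by rw [repl_RR]; exact List.mem_map_of_mem h.hq)).2 x hx
  have e := enc_dec this
  exact ⟨dec x, (Finset.mem_filter.1 ((h.hr _).2 (by rwa [e]))).1, e⟩

theorem EN.mem {C : Finset (W 5)} {q : List ℕ × List (ℕ × List ℕ)} (hq : q ∈ RR) {v : W 5} {e : ℕ × List ℕ} (h : EN C q v e) : ∀ x ∈ e.2, ∃ Q ∈ C, enc Q = x := by
  intro x hx
  have e' := enc_dec (RR_lt q hq e h.he x hx)
  exact ⟨dec x, (Finset.mem_filter.1 ((h.h2 _).2 (by rwa [e']))).1, e'⟩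

theorem sub_card {C : Finset (W 5)} {L : List ℕ} (h : ∀ x ∈ L, ∃ Q ∈ C, enc Q = x) : L.toFinset.card ≤ C.card := by
  rw [← Finset.card_image_of_injective C enc_inj']
  apply Finset.card_le_card
  intro x hx
  obtain ⟨Q, hQ, rfl⟩ := h x (List.mem_toFinset.1 hx)
  exact Finset.mem_image_of_mem _ hQ

theorem pair_L6 {U C : Finset (W 5)} {q : List ℕ × List (ℕ × List ℕ)} (h : NP U C q) {v w : W 5} {e e' : ℕ × List ℕ}
    (hv : v ∈ U) (hw : w ∈ U) (hvw : v ≠ w) (hc : C.card ≤ 9) (he : EN C q v e) (he' : EN C q w e') : 8 < C.card ∧ (e.1, e'.1) ∈ L6 := by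
  have hs : (q.1 ++ e.2 ++ e'.2).toFinset.card ≤ C.card := by
    apply sub_card
    intro x hx
    rw [List.mem_append, List.mem_append] at hx
    rcases hx with (hx | hx) | hx
    · exact h.mem x hx
    · exact he.mem h.hq x hx
    · exact he'.mem h.hq x hx
  have := pq_sem h.hq he.he he'.he he.h1 he'.h1 ⟨h.gp.ud v hv w hw hvw, h.gp.ut v hv w hw⟩ (hs.trans hc)
  exact ⟨by omega, this.2⟩

theorem cn_iso {f : W 5 → W 5} (hf : IsoF f) (C : Finset (W 5)) (u : W 5) : cn (C.image f) (f u) = cn C u := by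
  unfold cn; rw [hf.filter, Finset.card_image_of_injective _ hf.inj]

theorem cn_le (C : Finset (W 5)) (u : W 5) : cn C u ≤ C.card := Finset.card_le_card (Finset.filter_subset _ _)

/-- maximal choice inside a subset -/
theorem GP.pick {U C V : Finset (W 5)} (h : GP U C) (hV : V ⊆ U) (hne : V.Nonempty) (h8 : ∀ v ∈ V, cn C v ≤ 8) :
    ∃ f, IsoF f ∧ ∃ q, NP (U.image f) (C.image f) q ∧ u0 ∈ V.image f ∧ ∀ v ∈ V.image f, cn (C.image f) v ≤ cn (C.image f) u0 := by
  obtain ⟨u, hu, hm⟩ := Finset.exists_max_image V (cn C) hne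
  obtain ⟨f, hf, f0, q, hq⟩ := h.norm (hV hu) (h8 u hu)
  refine ⟨f, hf, q, hq, by rw [← f0]; exact Finset.mem_image_of_mem _ hu, ?_⟩
  intro v hv
  obtain ⟨v, kv, rfl⟩ := Finset.mem_image.1 hv
  rw [← f0, cn_iso hf, cn_iso hf]; exact hm v kv

theorem partB {U C : Finset (W 5)} (h : GP U C) (hU : U.card = 3) : 9 ≤ C.card := by
  by_contra hc
  obtain ⟨f, hf, q, hq, hu, hm⟩ := h.pick (V := U) subset_rfl (Finset.card_pos.1 (by omega)) (fun v _ => (cn_le C v).trans (by omega))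
  have hU' : (U.image f).card = 3 := by rw [Finset.card_image_of_injective _ hf.inj, hU]
  have hC' : (C.image f).card = C.card := Finset.card_image_of_injective _ hf.inj
  have h2 : ((U.image f).erase u0).card = 2 := by rw [Finset.card_erase_of_mem hu, hU']
  obtain ⟨v, w, hvw, e⟩ := Finset.card_eq_two.1 h2
  have hv : v ∈ (U.image f).erase u0 := by rw [e]; simp
  have hw : w ∈ (U.image f).erase u0 := by rw [e]; simp
  obtain ⟨nv, hv⟩ := Finset.mem_erase.1 hv
  obtain ⟨nw, hw⟩ := Finset.mem_erase.1 hw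
  obtain ⟨a, ha⟩ := hq.en hv nv.symm (hm v hv) (by omega)
  obtain ⟨b, hb⟩ := hq.en hw nw.symm (hm w hw) (by omega)
  have := (pair_L6 hq hv hw hvw (by omega) ha hb).1
  omega

theorem full_eq {C : Finset (W 5)} {w : W 5} (h : ¬ cn C w ≤ 8) (hc : C.card ≤ 9) : C.filter (Nd w ·) = C := by
  apply Finset.eq_of_subset_of_card_le (Finset.filter_subset _ _)
  have : (C.filter (Nd w ·)).card = cn C w := rfl
  omega

theorem partC {U C : Finset (W 5)} (h : GP U C) (hU : U.card = 4) : 10 ≤ C.card := by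
  by_contra hc
  have hc : C.card ≤ 9 := by omega
  have hful : ∀ w ∈ U, ¬ cn C w ≤ 8 → IsCov w C := by
    intro w hw h8
    have := h.cov w hw
    rwa [full_eq h8 hc] at this
  let V := U.filter (fun v => cn C v ≤ 8)
  have hsp := Finset.card_filter_add_card_filter_not (s := U) (fun v => cn C v ≤ 8)
  have hV2 : 2 ≤ V.card := by
    by_contra hlt
    have : 2 < (U.filter (fun v => ¬ cn C v ≤ 8)).card := by
      have : V.card = (U.filter (fun v => cn C v ≤ 8)).card := rfl
      omega
    obtain ⟨a, b, c, ha, hb, hc', hab, hac, hbc⟩ := Finset.two_lt_card_iff.1 this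
    rw [Finset.mem_filter] at ha hb hc'
    exact three six5 (hful a ha.1 ha.2) (hful b hb.1 hb.2) (hful c hc'.1 hc'.2) h.ct (h.dis a ha.1) (h.dis b hb.1) hc
      (h.ud _ ha.1 _ hb.1 hab) (h.ud _ ha.1 _ hc'.1 hac) (h.ud _ hb.1 _ hc'.1 hbc)
      (h.ut _ ha.1 _ hb.1) (h.ut _ ha.1 _ hc'.1) (h.ut _ hb.1 _ hc'.1)
  obtain ⟨f, hf, q, hq, hu, hm⟩ := h.pick (V := V) (Finset.filter_subset _ _) (Finset.card_pos.1 (by omega)) (fun v hv => (Finset.mem_filter.1 hv).2)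
  have hVU : V.image f ⊆ U.image f := Finset.image_subset_image (Finset.filter_subset _ _)
  have hV2' : 2 ≤ (V.image f).card := by rwa [Finset.card_image_of_injective _ hf.inj]
  have hU' : (U.image f).card = 4 := by rw [Finset.card_image_of_injective _ hf.inj, hU]
  have hC' : (C.image f).card ≤ 9 := by rwa [Finset.card_image_of_injective _ hf.inj]
  obtain ⟨v, hv, nv⟩ := Finset.exists_mem_ne hV2' u0
  obtain ⟨a, ha⟩ := hq.en (hVU hv) nv.symm (hm v hv) hC'
  by_cases hall : ∀ w ∈ U, cn C w ≤ 8
  · have hVe : V = U := Finset.filter_true_of_mem hall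
    rw [hVe] at hm hu
    have h3 : 2 < ((U.image f).erase u0).card := by rw [Finset.card_erase_of_mem hu, hU']; omega
    obtain ⟨x, y, z, hx, hy, hz, hxy, hxz, hyz⟩ := Finset.two_lt_card_iff.1 h3
    obtain ⟨nx, hx⟩ := Finset.mem_erase.1 hx
    obtain ⟨ny, hy⟩ := Finset.mem_erase.1 hy
    obtain ⟨nz, hz⟩ := Finset.mem_erase.1 hz
    obtain ⟨ex, hex⟩ := hq.en hx nx.symm (hm x hx) hC'
    obtain ⟨ey, hey⟩ := hq.en hy ny.symm (hm y hy) hC'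
    obtain ⟨ez, hez⟩ := hq.en hz nz.symm (hm z hz) hC'
    exact L6_tri _ (pair_L6 hq hx hy hxy hC' hex hey).2 _ (pair_L6 hq hy hz hyz hC' hey hez).2 _ (pair_L6 hq hx hz hxz hC' hex hez).2 rfl rfl rfl
  · push Not at hall
    obtain ⟨w, hw, hw8⟩ := hall
    have hwU : f w ∈ U.image f := Finset.mem_image_of_mem _ hw
    have cw := hf.cov (hful w hw (by omega))
    have hwV : ∀ x ∈ V.image f, x ≠ f w := by
      rintro x hx rfl
      obtain ⟨y, hy, e⟩ := Finset.mem_image.1 hx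
      have := (Finset.mem_filter.1 hy).2
      rw [hf.inj e] at this
      omega
    refine fw_sem hq.hq ha.he ha.h1 ⟨hq.gp.ud _ hq.hu _ hwU (hwV _ hu), hq.gp.ut _ hq.hu _ hwU⟩
      ⟨hq.gp.ud _ (hVU hv) _ hwU (hwV _ hv), hq.gp.ut _ (hVU hv) _ hwU⟩ cw hq.gp.ct hC' ?_ ?_
    · intro x hx
      rcases List.mem_append.1 hx with hx | hx
      · exact hq.mem x hx
      · exact ha.mem hq.hq x hx
    · intro Q hQ hn
      rw [List.mem_append, ← hq.hr, ← ha.h2, Finset.mem_filter, Finset.mem_filter] at hn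
      rw [← not_nd, ← not_nd]
      tauto

theorem partA {U C : Finset (W 5)} (h : GP U C) (hU : U.card = 2) (hc : C.card ≤ 7) : C.card = 7 ∧ ∃ f, IsoF f ∧
    (∀ Q, Q ∈ U.image f ↔ Q = u0 ∨ enc Q = 3115) ∧ ∀ Q, Q ∈ C.image f ↔ enc Q ∈ q2 := by
  obtain ⟨f, hf, q, hq, hu, hm⟩ := h.pick (V := U) subset_rfl (Finset.card_pos.1 (by omega)) (fun v _ => (cn_le C v).trans (by omega))
  have hU' : (U.image f).card = 2 := by rw [Finset.card_image_of_injective _ hf.inj, hU]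
  have hC' : (C.image f).card = C.card := Finset.card_image_of_injective _ hf.inj
  obtain ⟨v, hv, nv⟩ := Finset.exists_mem_ne (by omega : 1 < (U.image f).card) u0
  obtain ⟨a, ha⟩ := hq.en hv nv.symm (hm v hv) (by omega)
  obtain ⟨l1, l2, l3, l4⟩ := RR_l q hq.hq a ha.he
  have hs : (q.1 ++ a.2).length ≤ C.card := by
    rw [← List.toFinset_card_of_nodup l3, ← hC']
    apply sub_card
    intro x hx
    rcases List.mem_append.1 hx with hx | hx
    · exact hq.mem x hx
    · exact ha.mem hq.hq x hx
  obtain ⟨e1, e2⟩ := l4 (by omega)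
  have h7 : C.card = 7 := by omega
  refine ⟨h7, f, hf, ?_, ?_⟩
  · have : {u0, v} = U.image f := by
      apply Finset.eq_of_subset_of_card_le
      · intro x hx
        rw [Finset.mem_insert, Finset.mem_singleton] at hx
        rcases hx with rfl | rfl
        · exact hu
        · exact hv
      · rw [hU', Finset.card_pair nv.symm]
    intro Q
    have h1 := ha.h1
    rw [e2] at h1
    have h1 : 3115 = enc v := h1
    rw [← this, Finset.mem_insert, Finset.mem_singleton, h1, enc_inj'.eq_iff]
  · have hcn : cn (C.image f) u0 = 7 := by
      have := rep_card (by rw [repl_RR]; exact List.mem_map_of_mem hq.hq) hq.hr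
      unfold cn
      rw [this, e1]; rfl
    have : (C.image f).filter (Nd u0 ·) = C.image f := by
      apply Finset.eq_of_subset_of_card_le (Finset.filter_subset _ _)
      have : ((C.image f).filter (Nd u0 ·)).card = cn (C.image f) u0 := rfl
      omega
    intro Q
    rw [← this, hq.hr, e1]

end Cov
namespace Cov

def gx : W 5 → W 5 := fun v i => (![fun l => l, p01, p01, fun l => l, fun l => l] : Fin 5 → Fin 6 → Fin 6) i (v (Equiv.swap 0 1 i))

theorem gx_iso : IsoF gx := by
  refine ⟨Equiv.swap 0 1, ![fun l => l, p01, p01, fun l => l, fun l => l], ?_, ?_, rfl⟩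
  · intro i; fin_cases i
    · exact Function.bijective_id
    · exact p01_b
    · exact p01_b
    · exact Function.bijective_id
    · exact Function.bijective_id
  · intro i; fin_cases i
    · intro l; rfl
    · exact p01_c
    · exact p01_c
    · intro l; rfl
    · intro l; rfl

theorem gx_U : ({u0, dec 3115} : Finset (W 5)).image gx = Uex := by decide +kernel
theorem gx_C : ((q2.map dec).toFinset : Finset (W 5)).image gx = Cex := by decide +kernel
theorem q2_lt : ∀ x ∈ q2, x < 7776 := by decide
theorem q2_nc : ∀ i : Fin 5, ∃ x ∈ q2, ∃ y ∈ q2, dec x i ≠ dec y i := by decide +kernel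

theorem partA' {U C : Finset (W 5)} (h : GP U C) (hU : U.card = 2) (hc : C.card ≤ 7) : C.card = 7 ∧ PairIsomorphic U C Uex Cex := by
  obtain ⟨h7, f, hf, h1, h2⟩ := partA h hU hc
  refine ⟨h7, ?_⟩
  obtain ⟨σ, k, k1, k2, k3⟩ := gx_iso.comp hf
  have e1 : U.image f = {u0, dec 3115} := by
    ext Q
    rw [h1, Finset.mem_insert, Finset.mem_singleton]
    apply or_congr_right
    constructor
    · intro h; rw [← h, dec_enc]
    · rintro rfl; exact enc_dec (by norm_num)
  have e2 : C.image f = (q2.map dec).toFinset := by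
    ext Q
    rw [h2, List.mem_toFinset, List.mem_map]
    constructor
    · intro h; exact ⟨_, h, dec_enc Q⟩
    · rintro ⟨x, hx, rfl⟩; rwa [enc_dec (q2_lt x hx)]
  refine ⟨σ, k, k1, k2, ?_, ?_⟩
  · rw [← k3, ← gx_U, ← e1, Finset.image_image]; rfl
  · rw [← k3, ← gx_C, ← e2, Finset.image_image]; rfl

theorem GP.of {U C : Finset (W d)} (h : GoodCoverPair U C) : GP U C := by
  obtain ⟨h1, h2, h3, h4, h5, h6⟩ := h
  refine ⟨h1, h2, h3, h4, fun u hu hc => (Finset.disjoint_left.1 h5 hu hc), fun u hu => ⟨?_, ?_, ?_⟩⟩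
  · intro v hv w hw
    exact h2 v (Finset.mem_filter.1 hv).1 w (Finset.mem_filter.1 hw).1
  · intro v hv; exact (Finset.mem_filter.1 hv).2
  · intro p hp
    have hx : (fun i => {l | sat (p i) l = true}) ∈ WordBox compl6 u := by
      intro i
      refine ⟨?_, hp i⟩
      intro l
      simp only [Set.mem_setOf_eq, sat_c]
      cases sat (p i) l <;> simp [Xor']
    have := h6 u hu hx
    simp only [CodeReal, Set.mem_iUnion] at this
    obtain ⟨v, hv, hxv⟩ := this
    have hin : In p v := fun i => (hxv i).2
    exact ⟨v, Finset.mem_filter.2 ⟨hv, hp.not_dich hin⟩, hin⟩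

def pad (v : W d) : W (d + 1) := Fin.snoc (α := fun _ => Fin 6) v 2
theorem pad_c (v : W d) (i : Fin d) : pad v i.castSucc = v i := by simp [pad]
theorem pad_l (v : W d) : pad v (Fin.last d) = 2 := by simp [pad]
theorem pad_inj : Function.Injective (pad (d := d)) := by
  intro v w h
  funext i
  rw [← pad_c v, h, pad_c]
theorem pad_nd {u v : W d} : Nd (pad u) (pad v) ↔ Nd u v := by
  unfold Nd
  rw [Fin.forall_fin_succ']
  simp only [pad_c, pad_l]
  exact and_iff_left (by decide)
theorem pad_dich {u v : W d} : Dich (pad u) (pad v) ↔ Dich u v := by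
  rw [← not_nd, ← not_nd, pad_nd]
theorem pad_twin {u v : W d} : Twin (pad u) (pad v) → Twin u v := by
  rintro ⟨j, h, H⟩
  revert h H
  refine Fin.lastCases ?_ (fun j => ?_) j
  · intro h; rw [pad_l, pad_l] at h; exact absurd h (by decide)
  · intro h H
    rw [pad_c, pad_c] at h
    refine ⟨j, h, fun i hi => ?_⟩
    have := H i.castSucc (fun e => hi (Fin.castSucc_injective _ e))
    rwa [pad_c, pad_c] at this

theorem GP.pad {U C : Finset (W d)} (h : GP U C) : GP (U.image pad) (C.image pad) := by
  have dd : ∀ F : Finset (W d), (∀ u ∈ F, ∀ v ∈ F, u ≠ v → Dich u v) → ∀ u ∈ F.image Cov.pad, ∀ v ∈ F.image Cov.pad, u ≠ v → Dich u v := by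
    intro F H u hu v hv huv
    obtain ⟨u, ku, rfl⟩ := Finset.mem_image.1 hu
    obtain ⟨v, kv, rfl⟩ := Finset.mem_image.1 hv
    exact pad_dich.2 (H u ku v kv (fun e => huv (by rw [e])))
  have tt : ∀ F : Finset (W d), TF F → TF (F.image Cov.pad) := by
    intro F H u hu v hv
    obtain ⟨u, ku, rfl⟩ := Finset.mem_image.1 hu
    obtain ⟨v, kv, rfl⟩ := Finset.mem_image.1 hv
    exact fun t => H u ku v kv (pad_twin t)
  refine ⟨dd U h.ud, dd C h.cd, tt U h.ut, tt C h.ct, ?_, ?_⟩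
  · intro u hu hc
    obtain ⟨u, ku, rfl⟩ := Finset.mem_image.1 hu
    obtain ⟨v, kv, e⟩ := Finset.mem_image.1 hc
    rw [pad_inj e] at kv
    exact h.dis u ku kv
  · intro u hu
    obtain ⟨u, ku, rfl⟩ := Finset.mem_image.1 hu
    refine ⟨fun v hv w hw => dd C h.cd v (Finset.mem_filter.1 hv).1 w (Finset.mem_filter.1 hw).1, fun v hv => (Finset.mem_filter.1 hv).2, ?_⟩
    intro p hp
    obtain ⟨v, hv, hin⟩ := (h.cov u ku).cov (fun i => p i.castSucc) (fun i => by have := hp i.castSucc; rwa [pad_c] at this)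
    obtain ⟨hv, hn⟩ := Finset.mem_filter.1 hv
    refine ⟨Cov.pad v, Finset.mem_filter.2 ⟨Finset.mem_image_of_mem _ hv, pad_nd.2 hn⟩, ?_⟩
    intro i
    refine Fin.lastCases ?_ (fun i => ?_) i
    · have := hp (Fin.last d); rw [pad_l] at this ⊢; exact this
    · rw [pad_c]; exact hin i

theorem two4 {U C : Finset (W 4)} (h : GP U C) (hU : U.card = 2) : 8 ≤ C.card := by
  by_contra hc
  have hC : (C.image pad).card = C.card := Finset.card_image_of_injective _ pad_inj
  obtain ⟨_, f, hf, _, h2⟩ := partA h.pad (by rw [Finset.card_image_of_injective _ pad_inj, hU]) (by omega)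
  obtain ⟨σ, k, k1, k2, rfl⟩ := hf
  obtain ⟨x, hx, y, hy, hxy⟩ := q2_nc (σ.symm (Fin.last 4))
  have key : ∀ x ∈ q2, dec x (σ.symm (Fin.last 4)) = k (σ.symm (Fin.last 4)) 2 := by
    intro x hx
    have := (h2 (dec x)).2 (by rwa [enc_dec (q2_lt x hx)])
    obtain ⟨P, hP, e⟩ := Finset.mem_image.1 this
    obtain ⟨P, _, rfl⟩ := Finset.mem_image.1 hP
    rw [← e]; beta_reduce; rw [Equiv.apply_symm_apply, pad_l]
  exact hxy (by rw [key x hx, key y hy])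

theorem one {U C : Finset (W d)} (h : GP U C) (hU : U.card = 1) : 5 ≤ C.card := by
  obtain ⟨u, rfl⟩ := Finset.card_eq_one.1 hU
  have hu := Finset.mem_singleton_self u
  have := five (h.cov u hu) (h.ct.mono (Finset.filter_subset _ _)) (fun hh => h.dis u hu (Finset.mem_filter.1 hh).1)
  exact this.trans (Finset.card_le_card (Finset.filter_subset _ _))

end Cov
/-- For twin pair free disjoint polybox codes `Uᵢ, Cᵢ ⊆ S^d` over
`S = {a,a',b,b',c,c'}` with `Uᵢ ⊑ Cᵢ` and `|Uᵢ| = i`: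
(i) `|C₁| ≥ 5` for `d ≥ 3`;
(ii) `|C₂| ≥ 7` for `d = 5`, and up to isomorphism there is precisely one cover
`C₂` of `U₂` with `|C₂| = 7`, namely the pair `(Uex, Cex)`;
(iii) `|C₂| ≥ 8` for `d = 4`, and `|C₃| ≥ 9`, `|C₄| ≥ 10` for `d ∈ {4,5}`. -/
theorem cover_cardinalities :
    (∀ d : ℕ, 3 ≤ d → ∀ U C : Finset (Fin d → Fin 6),
      GoodCoverPair U C → U.card = 1 → 5 ≤ C.card) ∧
    (∀ U C : Finset (Fin 5 → Fin 6), GoodCoverPair U C → U.card = 2 →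
      7 ≤ C.card ∧ (C.card = 7 → PairIsomorphic U C Uex Cex)) ∧
    (∀ U C : Finset (Fin 4 → Fin 6), GoodCoverPair U C → U.card = 2 →
      8 ≤ C.card) ∧
    (∀ d : ℕ, d = 4 ∨ d = 5 → ∀ U C : Finset (Fin d → Fin 6),
      GoodCoverPair U C →
        (U.card = 3 → 9 ≤ C.card) ∧ (U.card = 4 → 10 ≤ C.card)) := by
  refine ⟨fun d _ U C h hU => Cov.one (Cov.GP.of h) hU, fun U C h hU => ?_, fun U C h hU => Cov.two4 (Cov.GP.of h) hU, ?_⟩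
  · have h := Cov.GP.of h
    refine ⟨?_, fun hc => (Cov.partA' h hU (by omega)).2⟩
    by_contra hc
    have := (Cov.partA' h hU (by omega)).1
    omega
  · rintro d (rfl | rfl) U C h
    · have h := (Cov.GP.of h).pad
      have e1 : (U.image Cov.pad).card = U.card := Finset.card_image_of_injective _ Cov.pad_inj
      have e2 : (C.image Cov.pad).card = C.card := Finset.card_image_of_injective _ Cov.pad_inj
      exact ⟨fun hU => by rw [← e2]; exact Cov.partB h (e1.trans hU), fun hU => by rw [← e2]; exact Cov.partC h (e1.trans hU)⟩
    · have h := Cov.GP.of h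
      exact ⟨Cov.partB h, Cov.partC h⟩
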